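/- There is no 11-tiling of any triangle: for every triangle ABC and every triangle T, there is no family of 11 triangles, each congruent to T, with pairwise disjoint interiors, whose union is the closed triangle ABC. -/

import Mathlib

open EuclideanGeometry Real

noncomputable section

/-- A point of the Euclidean plane. -/
abbrev Pt : Type := EuclideanSpace ℝ (Fin 2)

/-- A triangle, given by its three vertices. -/
abbrev Tri : Type := Fin 3 → Pt

/-- A genuine (nondegenerate) triangle. -/
def IsTriangle (T : Tri) : Prop := AffineIndependent ℝ T

/-- The closed triangle (convex hull of the vertices). -/
def triSet (T : Tri) : Set Pt := convexHull ℝ (Set.range T)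

/-- Two triangles are congruent iff corresponding distances agree
up to a permutation of the vertices. -/
def CongruentTri (T₁ T₂ : Tri) : Prop :=
  ∃ σ : Equiv.Perm (Fin 3), ∀ i j : Fin 3, dist (T₁ i) (T₁ j) = dist (T₂ (σ i)) (T₂ (σ j))

/-- An `N`-tiling of the triangle `ABC` by the tile `T`: a family of `N` triangles,
each congruent to `T`, with pairwise disjoint interiors, whose union is the
closed triangle `ABC`. -/
structure IsTiling (N : ℕ) (ABC T : Tri) (tiles : Fin N → Tri) : Prop where
  congr : ∀ i, CongruentTri (tiles i) T
  disj : ∀ i j, i ≠ j → interior (triSet (tiles i)) ∩ interior (triSet (tiles j)) = ∅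
  cover : (⋃ i, triSet (tiles i)) = triSet ABC

/-- The interior angle of the triangle `T` at its `k`-th vertex. -/
def triAngle (T : Tri) (k : Fin 3) : ℝ := ∠ (T (k + 1)) (T k) (T (k + 2))

/-- The side of `T` opposite to the `k`-th vertex. -/
def sideLen (T : Tri) (k : Fin 3) : ℝ := dist (T (k + 1)) (T (k + 2))

/-- `T` has angles `α`, `β`, `γ` (at vertices `0`, `1`, `2`, which are opposite
the sides of lengths `a`, `b`, `c` respectively). -/
def HasAngles (T : Tri) (α β γ : ℝ) : Prop :=
  triAngle T 0 = α ∧ triAngle T 1 = β ∧ triAngle T 2 = γ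

/-- Two triangles are similar iff corresponding distances agree up to a
permutation of the vertices and a positive scale factor. -/
def SimilarTri (T₁ T₂ : Tri) : Prop :=
  ∃ r : ℝ, 0 < r ∧ ∃ σ : Equiv.Perm (Fin 3),
    ∀ i j : Fin 3, dist (T₁ i) (T₁ j) = r * dist (T₂ (σ i)) (T₂ (σ j))

section
open MeasureTheory Set
theorem wedge_vol {φ r : ℝ} (h0 : 0 < φ) (h1 : φ < π) (hr : 0 < r) :
    volume {z : ℂ | ‖z‖ < r ∧ 0 < z.im ∧ 0 < sin φ * z.re - cos φ * z.im}
      = ENNReal.ofReal (φ / 2 * r ^ 2) := by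
  set S : Set ℂ := {z : ℂ | ‖z‖ < r ∧ 0 < z.im ∧ 0 < sin φ * z.re - cos φ * z.im}
  have hS : MeasurableSet S := by
    apply IsOpen.measurableSet
    have h1 : IsOpen {z : ℂ | ‖z‖ < r} := isOpen_lt (by fun_prop) (by fun_prop)
    have h2 : IsOpen {z : ℂ | 0 < z.im} := isOpen_lt (by fun_prop) (by fun_prop)
    have h3 : IsOpen {z : ℂ | 0 < sin φ * z.re - cos φ * z.im} :=
      isOpen_lt (by fun_prop) (by fun_prop)
    exact h1.inter (h2.inter h3)
  rw [← lintegral_indicator_one hS, ← Complex.lintegral_comp_polarCoord_symm]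
  have : ∀ p ∈ polarCoord.target, ENNReal.ofReal p.1 • S.indicator (1 : ℂ → ENNReal)
      (Complex.polarCoord.symm p) = (Ioo 0 r ×ˢ Ioo 0 φ).indicator (fun p => ENNReal.ofReal p.1) p := by
    rintro ⟨s, t⟩ hp
    simp only [polarCoord_target, mem_prod, mem_Ioi, mem_Ioo] at hp
    obtain ⟨hs, ht1, ht2⟩ := hp
    have key : Complex.polarCoord.symm (s, t) ∈ S ↔ (s, t) ∈ Ioo 0 r ×ˢ Ioo 0 φ := by
      have e0 : ‖Complex.polarCoord.symm (s, t)‖ = s := by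
        rw [Complex.norm_polarCoord_symm, abs_of_pos hs]
      simp only [S, mem_ofPred_eq, mem_prod, mem_Ioo, e0]
      rw [Complex.polarCoord_symm_apply]
      have e1 : ((s : ℂ) * (cos t + sin t * Complex.I)).im = s * sin t := by
        simp [-Complex.ofReal_sin, -Complex.ofReal_cos]
      have e2 : ((s : ℂ) * (cos t + sin t * Complex.I)).re = s * cos t := by
        simp [-Complex.ofReal_sin, -Complex.ofReal_cos]
      rw [e1, e2]
      have e3 : sin φ * (s * cos t) - cos φ * (s * sin t)
        = s * sin (φ - t) := by rw [Real.sin_sub]; ring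
      rw [e3, mul_pos_iff_of_pos_left hs, mul_pos_iff_of_pos_left hs]
      constructor
      · rintro ⟨h, h2, h3⟩
        have t0 : 0 < t := by
          by_contra hh
          push Not at hh
          linarith [Real.sin_nonpos_of_nonpos_of_neg_pi_le hh ht1.le]
        refine ⟨⟨hs, h⟩, t0, ?_⟩
        by_contra hh
        push Not at hh
        linarith [Real.sin_nonpos_of_nonpos_of_neg_pi_le (x := φ - t) (by linarith) (by linarith)]
      · rintro ⟨⟨_, h⟩, h2, h3⟩
        exact ⟨h, Real.sin_pos_of_pos_of_lt_pi h2 ht2,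
          Real.sin_pos_of_pos_of_lt_pi (by linarith) (by linarith)⟩
    by_cases hm : (s, t) ∈ Ioo 0 r ×ˢ Ioo 0 φ
    · rw [indicator_of_mem (key.2 hm), indicator_of_mem hm]; simp
    · rw [indicator_of_notMem (fun h => hm (key.1 h)), indicator_of_notMem hm]; simp
  rw [setLIntegral_congr_fun polarCoord.open_target.measurableSet this,
    lintegral_indicator (measurableSet_Ioo.prod measurableSet_Ioo), Measure.restrict_restrict
      (measurableSet_Ioo.prod measurableSet_Ioo)]
  have hsub : (Ioo 0 r ×ˢ Ioo 0 φ) ∩ polarCoord.target = Ioo 0 r ×ˢ Ioo 0 φ := by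
    apply inter_eq_left.2
    rintro ⟨s, t⟩ ⟨⟨h1, h2⟩, h3, h4⟩
    simp only [polarCoord_target, mem_prod, mem_Ioi, mem_Ioo]
    simp only at *
    exact ⟨h1, by linarith, by linarith⟩
  rw [hsub, Measure.volume_eq_prod, setLIntegral_prod _ (by fun_prop)]
  simp only [lintegral_const, Measure.restrict_apply MeasurableSet.univ, univ_inter, Real.volume_Ioo,
    sub_zero]
  rw [lintegral_mul_const _ (by fun_prop), ← ofReal_integral_eq_lintegral_ofReal]
  · rw [← integral_Ioc_eq_integral_Ioo, ← intervalIntegral.integral_of_le hr.le, integral_id,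
      ← ENNReal.ofReal_mul (by nlinarith)]
    congr 1; ring
  · rw [← IntegrableOn, ← integrableOn_Ioc_iff_integrableOn_Ioo,
      ← intervalIntegrable_iff_integrableOn_Ioc_of_le hr.le]
    exact intervalIntegral.intervalIntegrable_id
  · exact (ae_restrict_iff' measurableSet_Ioo).2 (Filter.Eventually.of_forall fun x hx => hx.1.le)
theorem exists_isom (u w : Pt) (hu : u ≠ 0) : ∃ g : Pt ≃ₗᵢ[ℝ] ℂ,
    g u = (‖u‖ : ℂ) ∧ (g w).re = ‖w‖ * cos (InnerProductGeometry.angle u w) ∧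
      (g w).im = ‖w‖ * sin (InnerProductGeometry.angle u w) := by
  obtain ⟨g1, hg1⟩ : ∃ g : Pt ≃ₗᵢ[ℝ] ℂ, g u = (‖u‖ : ℂ) := by
    let e := Complex.orthonormalBasisOneI.repr.symm
    have hz : e u ≠ 0 := by simpa using hu
    have hn : ‖e u‖ = ‖u‖ := e.norm_map u
    have hc : ‖(starRingEnd ℂ (e u)) / ‖u‖‖ = 1 := by
      rw [norm_div, RCLike.norm_conj, hn]; simp [hu]
    let c : Circle := ⟨(starRingEnd ℂ (e u)) / ‖u‖, by simpa [Submonoid.unitSphere] using hc⟩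
    refine ⟨e.trans (rotation c), ?_⟩
    have : (e.trans (rotation c)) u = ((starRingEnd ℂ (e u)) / ‖u‖) * e u := by
      exact rotation_apply c (e u)
    rw [this, div_mul_eq_mul_div, mul_comm, Complex.mul_conj, Complex.normSq_eq_norm_sq, hn]
    have : (‖u‖ : ℂ) ≠ 0 := by simpa using hu
    push_cast; field_simp
  have hre : ∀ g : Pt ≃ₗᵢ[ℝ] ℂ, g u = (‖u‖ : ℂ) →
      (g w).re = ‖w‖ * cos (InnerProductGeometry.angle u w) := by
    intro g hg
    have h1 : inner ℝ (g u) (g w) = inner ℝ u w := g.inner_map_map u w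
    rw [hg, ← InnerProductGeometry.cos_angle_mul_norm_mul_norm u w, Complex.inner] at h1
    have : ‖u‖ ≠ 0 := by simpa using hu
    simp at h1
    apply mul_left_cancel₀ this
    linarith
  have him : ∀ g : Pt ≃ₗᵢ[ℝ] ℂ, g u = (‖u‖ : ℂ) →
      (g w).im ^ 2 = (‖w‖ * sin (InnerProductGeometry.angle u w)) ^ 2 := by
    intro g hg
    have h1 : ‖g w‖ = ‖w‖ := g.norm_map w
    have h2 := Complex.sq_norm (g w)
    rw [Complex.normSq_apply, h1, hre g hg] at h2
    have := Real.sin_sq_add_cos_sq (InnerProductGeometry.angle u w)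
    linear_combination (-1) * h2 - ‖w‖ ^ 2 * this
  have hs : 0 ≤ ‖w‖ * sin (InnerProductGeometry.angle u w) :=
    mul_nonneg (norm_nonneg _) (InnerProductGeometry.sin_angle_nonneg u w)
  rcases sq_eq_sq_iff_eq_or_eq_neg.1 (him g1 hg1) with h | h
  · exact ⟨g1, hg1, hre g1 hg1, h⟩
  · refine ⟨g1.trans Complex.conjLIE, ?_, ?_, ?_⟩
    · simp [hg1]
    · simp [hre g1 hg1]
    · simp [h]
theorem wedge_pt (u w : Pt) (hu : u ≠ 0) (hw : w ≠ 0)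
    (hs : 0 < sin (InnerProductGeometry.angle u w))
    (p q : Pt →ₗ[ℝ] ℝ) (hv : ∀ v, v = p v • u + q v • w) {r : ℝ} (hr : 0 < r) :
    volume {v : Pt | ‖v‖ < r ∧ 0 < p v ∧ 0 < q v} =
      ENNReal.ofReal (InnerProductGeometry.angle u w / 2 * r ^ 2) := by
  obtain ⟨g, h1, h2, h3⟩ := exists_isom u w hu
  set φ := InnerProductGeometry.angle u w with hφ
  have p0 : 0 < φ := by
    rcases (InnerProductGeometry.angle_nonneg u w).eq_or_lt with h | h
    · rw [← hφ] at h; rw [← h] at hs; simp at hs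
    · exact h
  have p1 : φ < π := by
    rcases (InnerProductGeometry.angle_le_pi u w).eq_or_lt with h | h
    · rw [← hφ] at h; rw [h] at hs; simp at hs
    · exact h
  rw [← wedge_vol p0 p1 hr, ← (g.measurePreserving).measure_preimage_emb
    g.toHomeomorph.measurableEmbedding]
  congr 1
  ext v
  simp only [mem_ofPred_eq, mem_preimage, g.norm_map]
  have hu' : 0 < ‖u‖ := by simpa using hu
  have hw' : 0 < ‖w‖ := by simpa using hw
  have e : g v = p v • (‖u‖ : ℂ) + q v • g w := by
    conv_lhs => rw [hv v]
    rw [map_add, map_smul, map_smul, h1]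
  have ei : (g v).im = q v * (‖w‖ * sin φ) := by rw [e]; simp [h3]
  have er : (g v).re = p v * ‖u‖ + q v * (‖w‖ * cos φ) := by rw [e]; simp [h2]
  have e3 : sin φ * (g v).re - cos φ * (g v).im = p v * (‖u‖ * sin φ) := by
    rw [ei, er]; ring
  rw [e3, ei, mul_pos_iff_of_pos_right (by positivity), mul_pos_iff_of_pos_right (by positivity)]
  tauto
end
section
open MeasureTheory Set Filter Topology
abbrev AB := AffineBasis (Fin 3) ℝ Pt
def lin (b : AB) (k : Fin 3) : Pt →ₗ[ℝ] ℝ := (b.coord k).linear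
theorem coord_add (b : AB) (k : Fin 3) (X v : Pt) : b.coord k (X + v) = b.coord k X + lin b k v := by
  have := (b.coord k).map_vadd X v
  simp only [vadd_eq_add] at this
  rw [add_comm X v, this, add_comm]; rfl
theorem lin_sub (b : AB) (k : Fin 3) (X Y : Pt) : lin b k (Y - X) = b.coord k Y - b.coord k X := by
  have := coord_add b k X (Y - X)
  rw [add_sub_cancel] at this; linarith
theorem lin_sum (b : AB) (v : Pt) : lin b 0 v + lin b 1 v + lin b 2 v = 0 := by
  have h1 := b.sum_coord_apply_eq_one (b 0 + v)
  have h2 := b.sum_coord_apply_eq_one (b 0)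
  simp only [Fin.sum_univ_three, coord_add] at h1 h2
  linarith
theorem coord_sum (b : AB) (X : Pt) : b.coord 0 X + b.coord 1 X + b.coord 2 X = 1 := by
  have h2 := b.sum_coord_apply_eq_one X
  simpa only [Fin.sum_univ_three] using h2
theorem coord_vert (b : AB) (k l : Fin 3) : b.coord k (b l) = if k = l then 1 else 0 := b.coord_apply k l
theorem eq_of_coord (b : AB) {X Y : Pt} (h : ∀ k, b.coord k X = b.coord k Y) : X = Y := by
  exact b.ext_elem h
theorem eq_of_lin (b : AB) {u v : Pt} (h : ∀ k, lin b k u = lin b k v) : u = v := by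
  have : b 0 + u = b 0 + v := eq_of_coord b (fun k => by rw [coord_add, coord_add, h])
  exact add_left_cancel this
theorem dec_lin (b : AB) (k : Fin 3) (v : Pt) :
    v = lin b (k+1) v • (b (k+1) - b k) + lin b (k+2) v • (b (k+2) - b k) := by
  apply eq_of_lin b
  intro j
  have := lin_sum b v
  simp only [map_add, map_smul, lin_sub, coord_vert, smul_eq_mul]
  fin_cases k <;> fin_cases j <;> simp [Fin.ext_iff] <;> linarith
def vang (b : AB) (k : Fin 3) : ℝ := ∠ (b (k+1)) (b k) (b (k+2))
theorem ab_ne (b : AB) {k l : Fin 3} (h : k ≠ l) : b k ≠ b l := fun e => h (b.ind.injective e)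
theorem vang_sin_pos (b : AB) (k : Fin 3) : 0 < sin (vang b k) := by
  apply EuclideanGeometry.sin_pos_of_not_collinear
  have := b.ind
  have h3 : AffineIndependent ℝ ![b (k+1), b k, b (k+2)] := by
    have := (b.ind).comp_embedding (⟨![k+1, k, k+2], by fin_cases k <;> decide⟩ : Fin 3 ↪ Fin 3)
    convert this using 1
    ext i; fin_cases i <;> rfl
  exact affineIndependent_iff_not_collinear_set.1 h3
def isE (b : AB) (X : Pt) : Prop := ∃ k, b.coord k X = 0 ∧ ∀ l, l ≠ k → 0 < b.coord l X
def isI (b : AB) (X : Pt) : Prop := ∀ k, 0 < b.coord k X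
open Classical in
def angOf (b : AB) (X : Pt) : ℝ :=
  (∑ k, if b k = X then vang b k else 0) + (if isE b X then π else 0) + (if isI b X then 2 * π else 0)
theorem half_vol (f : Pt →ₗ[ℝ] ℝ) (hf : f ≠ 0) {r : ℝ} (hr : 0 < r) :
    volume {v : Pt | ‖v‖ < r ∧ 0 < f v} = ENNReal.ofReal (π / 2 * r ^ 2) := by
  have hfc : Continuous f := f.continuous_of_finiteDimensional
  have hb : volume (Metric.ball (0 : Pt) r) = ENNReal.ofReal (π * r ^ 2) := by
    rw [EuclideanSpace.volume_ball_fin_two, ← ENNReal.ofReal_pow hr.le, mul_comm π,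
      ENNReal.ofReal_mul (by positivity)]
  have hneg : volume {v : Pt | ‖v‖ < r ∧ f v < 0} = volume {v : Pt | ‖v‖ < r ∧ 0 < f v} := by
    rw [← (Measure.measurePreserving_neg (volume : Measure Pt)).measure_preimage_emb
      (Homeomorph.neg Pt).measurableEmbedding]
    congr 1; ext v; simp
  have hz : volume {v : Pt | f v = 0} = 0 := by
    have := Measure.addHaar_submodule (volume : Measure Pt) (LinearMap.ker f)
      (fun h => hf (LinearMap.ker_eq_top.1 h))
    exact this
  have m1 : MeasurableSet {v : Pt | ‖v‖ < r ∧ 0 < f v} := by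
    have h1 : IsOpen {z : Pt | ‖z‖ < r} := isOpen_lt (by fun_prop) (by fun_prop)
    have h2 : IsOpen {z : Pt | 0 < f z} := isOpen_lt (by fun_prop) (by fun_prop)
    exact (h1.inter h2).measurableSet
  have key : volume (Metric.ball (0 : Pt) r) =
      volume {v : Pt | ‖v‖ < r ∧ 0 < f v} + volume {v : Pt | ‖v‖ < r ∧ f v < 0} := by
    rw [← measure_union' _ m1]
    · apply le_antisymm
      · calc _ ≤ volume (({v : Pt | ‖v‖ < r ∧ 0 < f v} ∪ {v : Pt | ‖v‖ < r ∧ f v < 0}) ∪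
            {v : Pt | f v = 0}) := by
              apply measure_mono
              intro v hv
              simp only [Metric.mem_ball, dist_zero_right] at hv
              rcases lt_trichotomy (f v) 0 with h | h | h
              · left; right; exact ⟨hv, h⟩
              · right; exact h
              · left; left; exact ⟨hv, h⟩
          _ ≤ _ := by
              refine (measure_union_le _ _).trans ?_
              rw [hz, add_zero]
      · apply measure_mono
        rintro v (h | h) <;> simpa using h.1
    · rw [Set.disjoint_left]
      rintro v ⟨_, h⟩ ⟨_, h'⟩
      linarith
  rw [hb, hneg, ← two_mul] at key
  have h2 : ENNReal.ofReal (π * r ^ 2) = 2 * ENNReal.ofReal (π / 2 * r ^ 2) := by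
    rw [← ENNReal.ofReal_ofNat, ← ENNReal.ofReal_mul (by norm_num)]; congr 1; ring
  rw [h2] at key
  exact ((ENNReal.mul_right_inj (by norm_num) (by norm_num)).1 key).symm
theorem ball_vol {r : ℝ} (hr : 0 < r) : volume {v : Pt | ‖v‖ < r} = ENNReal.ofReal (2 * π / 2 * r ^ 2) := by
  have : {v : Pt | ‖v‖ < r} = Metric.ball 0 r := by ext v; simp
  rw [this, EuclideanSpace.volume_ball_fin_two, ← ENNReal.ofReal_pow hr.le, mul_div_cancel_left₀ _ two_ne_zero, mul_comm π,
      ENNReal.ofReal_mul (by positivity)]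
theorem small_lin (b : AB) (X : Pt) : ∀ᶠ r in 𝓝[>] (0:ℝ), ∀ v : Pt, ‖v‖ < r → ∀ k,
    b.coord k X = 0 ∨ |lin b k v| < |b.coord k X| := by
  have : ∀ k, ∃ δ > 0, ∀ v : Pt, ‖v‖ < δ → b.coord k X = 0 ∨ |lin b k v| < |b.coord k X| := by
    intro k
    by_cases h : b.coord k X = 0
    · exact ⟨1, one_pos, fun _ _ => Or.inl h⟩
    have hc : Continuous (lin b k) := (lin b k).continuous_of_finiteDimensional
    obtain ⟨δ, hδ, hh⟩ := Metric.continuous_iff.1 hc 0 |b.coord k X| (abs_pos.2 h)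
    refine ⟨δ, hδ, fun v hv => Or.inr ?_⟩
    have := hh v (by simpa using hv)
    simpa [Real.dist_eq] using this
  choose δ hδ hh using this
  have : Ioo (0:ℝ) (min (δ 0) (min (δ 1) (δ 2))) ∈ 𝓝[>] (0:ℝ) := by
    apply Ioo_mem_nhdsGT
    simp [hδ]
  filter_upwards [this] with r hr v hv k
  apply hh k v
  have := hr.2
  simp only [lt_min_iff] at this
  fin_cases k <;> simp <;> linarith
theorem wedge_vang (b : AB) (k : Fin 3) {r : ℝ} (hr : 0 < r) :
    volume {v : Pt | ‖v‖ < r ∧ 0 < lin b (k+1) v ∧ 0 < lin b (k+2) v} =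
      ENNReal.ofReal (vang b k / 2 * r ^ 2) := by
  refine wedge_pt (b (k+1) - b k) (b (k+2) - b k) ?_ ?_ (vang_sin_pos b k) _ _ (dec_lin b k) hr
  · exact sub_ne_zero.2 (ab_ne b (by fin_cases k <;> decide))
  · exact sub_ne_zero.2 (ab_ne b (by fin_cases k <;> decide))
theorem eq_vert (b : AB) (X : Pt) (k : Fin 3) (h1 : b.coord (k+1) X = 0) (h2 : b.coord (k+2) X = 0) :
    b k = X := by
  apply eq_of_coord b
  intro j
  have := coord_sum b X
  rw [coord_vert]
  fin_cases k <;> fin_cases j <;> simp_all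
theorem lin_ne_zero (b : AB) (k : Fin 3) : lin b k ≠ 0 := by
  intro h
  have : lin b k (b k - b (k+1)) = 1 := by
    rw [lin_sub, coord_vert, coord_vert]; fin_cases k <;> simp
  rw [h] at this; simp at this
theorem locvol (b : AB) (X : Pt) : ∀ᶠ r in 𝓝[>] (0:ℝ),
    volume {v : Pt | ‖v‖ < r ∧ ∀ k, 0 < b.coord k X + lin b k v} =
      ENNReal.ofReal (angOf b X / 2 * r ^ 2) := by
  filter_upwards [small_lin b X, self_mem_nhdsWithin] with r hsm hr
  replace hr : 0 < r := hr
  by_cases hneg : ∃ k, b.coord k X < 0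
  · obtain ⟨k, hk⟩ := hneg
    have e1 : {v : Pt | ‖v‖ < r ∧ ∀ k, 0 < b.coord k X + lin b k v} = ∅ := by
      ext v
      simp only [mem_ofPred_eq, mem_empty_iff_false, iff_false, not_and]
      intro hv h
      rcases hsm v hv k with h1 | h1
      · linarith
      · rw [abs_of_neg hk] at h1
        have := le_abs_self (lin b k v)
        linarith [h k]
    have e2 : angOf b X = 0 := by
      unfold angOf
      rw [if_neg, if_neg, Finset.sum_eq_zero]
      · simp
      · intro l _
        rw [if_neg]
        rintro rfl
        rw [coord_vert] at hk
        split_ifs at hk <;> linarith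
      · intro h; linarith [h k]
      · rintro ⟨l, h1, h2⟩
        by_cases hkl : k = l
        · subst hkl; linarith
        · linarith [h2 k hkl]
    rw [e1, e2]; simp
  push Not at hneg
  have hpos : ∀ k, b.coord k X ≠ 0 → ∀ v : Pt, ‖v‖ < r → 0 < b.coord k X + lin b k v := by
    intro k hk v hv
    rcases hsm v hv k with h1 | h1
    · exact absurd h1 hk
    · rw [abs_of_nonneg (hneg k)] at h1
      have := neg_abs_le (lin b k v)
      linarith
  by_cases hv : ∃ k, b k = X
  · obtain ⟨k, hk⟩ := hv
    have e2 : angOf b X = vang b k := by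
      unfold angOf
      rw [if_neg, if_neg, Finset.sum_eq_single k]
      · simp [hk]
      · intro l _ hl
        rw [if_neg]
        rw [← hk]
        exact ab_ne b hl
      · simp
      · intro h
        have := h (k+1)
        rw [← hk, coord_vert] at this
        fin_cases k <;> simp at this
      · rintro ⟨l, h1, h2⟩
        rw [← hk] at h1 h2
        simp only [coord_vert] at h1 h2
        have a1 := h2 (k+1)
        have a2 := h2 (k+2)
        revert h1 a1 a2
        clear * -
        fin_cases k <;> fin_cases l <;> simp
    rw [e2, ← wedge_vang b k hr]
    congr 1
    ext v
    simp only [mem_ofPred_eq]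
    constructor
    · rintro ⟨h1, h2⟩
      refine ⟨h1, ?_, ?_⟩
      · have := h2 (k+1)
        rw [← hk, coord_vert, if_neg (by fin_cases k <;> decide)] at this
        linarith
      · have := h2 (k+2)
        rw [← hk, coord_vert, if_neg (by fin_cases k <;> decide)] at this
        linarith
    · rintro ⟨h1, h2, h3⟩
      refine ⟨h1, fun l => ?_⟩
      by_cases hl : b.coord l X = 0
      · rw [hl, zero_add]
        rw [← hk, coord_vert] at hl
        have : l = k + 1 ∨ l = k + 2 := by
          revert hl; clear * -
          fin_cases k <;> fin_cases l <;> simp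
        rcases this with rfl | rfl <;> assumption
      · exact hpos l hl v h1
  have hvs : (∑ k, if b k = X then vang b k else 0) = 0 := by
    apply Finset.sum_eq_zero
    intro k _
    exact if_neg (fun h => hv ⟨k, h⟩)
  by_cases hE : isE b X
  · have hE' := hE
    obtain ⟨k, h1, h2⟩ := hE
    have e2 : angOf b X = π := by
      unfold angOf
      rw [hvs, if_pos hE', if_neg]
      · simp
      · intro h; linarith [h k]
    rw [e2, ← half_vol (lin b k) (lin_ne_zero b k) hr]
    congr 1
    ext v
    simp only [mem_ofPred_eq]
    constructor
    · rintro ⟨h3, h4⟩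
      exact ⟨h3, by have := h4 k; rwa [h1, zero_add] at this⟩
    · rintro ⟨h3, h4⟩
      refine ⟨h3, fun l => ?_⟩
      by_cases hl : l = k
      · rw [hl, h1, zero_add]; exact h4
      · exact hpos l (h2 l hl).ne' v h3
  have hI : isI b X := by
    have hne : ∀ k, b.coord k X ≠ 0 := by
      intro k hk
      apply hE
      refine ⟨k, hk, fun l hl => lt_of_le_of_ne (hneg l) ?_⟩
      intro h0
      have : (∃ j, k = j + 1 ∧ l = j + 2) ∨ ∃ j, k = j + 2 ∧ l = j + 1 := by
        revert hl; clear * -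
        revert k l; decide
      rcases this with ⟨j, rfl, rfl⟩ | ⟨j, rfl, rfl⟩
      · exact hv ⟨j, eq_vert b X j hk h0.symm⟩
      · exact hv ⟨j, eq_vert b X j h0.symm hk⟩
    exact fun k => lt_of_le_of_ne (hneg k) (hne k).symm
  have e2 : angOf b X = 2 * π := by
    unfold angOf
    rw [hvs, if_neg hE, if_pos hI]; simp
  rw [e2, ← ball_vol hr]
  congr 1
  ext v
  simp only [mem_ofPred_eq, and_iff_left_iff_imp]
  intro h l
  exact hpos l (hI l).ne' v h
theorem vang_pos (b : AB) (k : Fin 3) : 0 < vang b k := by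
  rcases (EuclideanGeometry.angle_nonneg (b (k+1)) (b k) (b (k+2))).eq_or_lt with h | h
  · have := vang_sin_pos b k
    unfold vang at this
    rw [← h] at this; simp at this
  · exact h
theorem angOf_nonneg (b : AB) (X : Pt) : 0 ≤ angOf b X := by
  unfold angOf
  have : 0 ≤ ∑ k, if b k = X then vang b k else 0 := by
    apply Finset.sum_nonneg; intro k _; split_ifs
    · exact (vang_pos b k).le
    · rfl
  have := Real.pi_pos
  split_ifs <;> linarith
theorem tri_null (b : AB) (k : Fin 3) : volume {X : Pt | b.coord k X = 0} = 0 := by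
  have h1 : volume {v : Pt | lin b k v = 0} = 0 := by
    exact Measure.addHaar_submodule (volume : Measure Pt) (LinearMap.ker (lin b k))
      (fun h => lin_ne_zero b k (LinearMap.ker_eq_top.1 h))
  have h2 := measure_preimage_add (volume : Measure Pt) (-b (k+1)) {v : Pt | lin b k v = 0}
  rw [h1] at h2
  rw [← h2]
  congr 1; ext X
  simp only [mem_ofPred_eq, mem_preimage]
  rw [neg_add_eq_sub, lin_sub, coord_vert, if_neg (by fin_cases k <;> decide), sub_zero]
theorem isI_open (b : AB) : MeasurableSet {X : Pt | isI b X} := by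
  have : {X : Pt | isI b X} = ⋂ k, {X | 0 < b.coord k X} := by
    ext X; simp [isI]
  rw [this]
  refine MeasurableSet.iInter fun k => IsOpen.measurableSet ?_
  have : Continuous (b.coord k) := (b.coord k).continuous_of_finiteDimensional
  exact isOpen_lt (by fun_prop) this
theorem ae_tiles {N : ℕ} (A : AB) (B : Fin N → AB)
    (mem : ∀ X, (∀ k, 0 ≤ A.coord k X) ↔ ∃ i, ∀ k, 0 ≤ (B i).coord k X) :
    (volume : Measure Pt) ({X | isI A X} \ ⋃ i, {X | isI (B i) X}) = 0 ∧
    (volume : Measure Pt) ((⋃ i, {X | isI (B i) X}) \ {X | isI A X}) = 0 := by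
  have hb : ∀ b : AB, (volume : Measure Pt) ({X | ∃ k, b.coord k X = 0}) = 0 := by
    intro b
    have : {X | ∃ k, b.coord k X = 0} = ⋃ k, {X | b.coord k X = 0} := by ext; simp
    rw [this]
    exact measure_iUnion_null (fun k => tri_null b k)
  constructor
  · apply measure_mono_null (t := ⋃ i, {X | ∃ k, (B i).coord k X = 0})
    · rintro X ⟨h1, h2⟩
      simp only [mem_iUnion, mem_ofPred_eq] at h1 h2 ⊢
      obtain ⟨i, hi⟩ := (mem X).1 (fun k => (h1 k).le)
      refine ⟨i, ?_⟩
      by_contra hc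
      push Not at hc
      exact h2 ⟨i, fun k => lt_of_le_of_ne (hi k) (hc k).symm⟩
    · exact measure_iUnion_null (fun i => hb (B i))
  · apply measure_mono_null (t := {X | ∃ k, A.coord k X = 0}) _ (hb A)
    rintro X ⟨h1, h2⟩
    simp only [mem_iUnion, mem_ofPred_eq] at h1 h2 ⊢
    obtain ⟨i, hi⟩ := h1
    by_contra hc
    push Not at hc
    exact h2 fun k => lt_of_le_of_ne ((mem X).2 ⟨i, fun k => (hi k).le⟩ k) (hc k).symm
theorem vol_tiles {N : ℕ} (A : AB) (B : Fin N → AB)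
    (mem : ∀ X, (∀ k, 0 ≤ A.coord k X) ↔ ∃ i, ∀ k, 0 ≤ (B i).coord k X)
    (dis : ∀ i j X, isI (B i) X → isI (B j) X → i = j) (S : Set Pt) (hS : MeasurableSet S) :
    volume ({X | isI A X} ∩ S) = ∑ i, volume ({X | isI (B i) X} ∩ S) := by
  obtain ⟨h1, h2⟩ := ae_tiles A B mem
  have : (⋃ i, ({X | isI (B i) X} ∩ S) : Set Pt) =ᵐ[volume] ({X | isI A X} ∩ S : Set Pt) := by
    rw [← iUnion_inter]
    apply ae_eq_set_inter _ (ae_eq_refl _)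
    exact ae_eq_set.2 ⟨h2, h1⟩
  rw [← measure_congr this, measure_iUnion _ (fun i => (isI_open (B i)).inter hS), tsum_fintype]
  intro i j hij
  rw [Function.onFun, Set.disjoint_left]
  rintro X ⟨h, _⟩ ⟨h', _⟩
  exact hij (dis i j X h h')
theorem angle_sum {N : ℕ} (A : AB) (B : Fin N → AB)
    (mem : ∀ X, (∀ k, 0 ≤ A.coord k X) ↔ ∃ i, ∀ k, 0 ≤ (B i).coord k X)
    (dis : ∀ i j X, isI (B i) X → isI (B j) X → i = j) (X : Pt) :
    ∑ i, angOf (B i) X = angOf A X := by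
  have hall : ∀ᶠ r in 𝓝[>] (0:ℝ), ∀ i, volume {v : Pt | ‖v‖ < r ∧ ∀ k, 0 < (B i).coord k X + lin (B i) k v} =
      ENNReal.ofReal (angOf (B i) X / 2 * r ^ 2) := eventually_all.2 fun i => locvol (B i) X
  obtain ⟨r, h1, h2, hr⟩ := (hall.and ((locvol A X).and self_mem_nhdsWithin)).exists
  replace hr : 0 < r := hr
  have tr : ∀ b : AB, volume {v : Pt | ‖v‖ < r ∧ ∀ k, 0 < b.coord k X + lin b k v} =
      volume ({Y | isI b Y} ∩ Metric.ball X r) := by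
    intro b
    rw [← measure_preimage_add (volume : Measure Pt) X ({Y | isI b Y} ∩ Metric.ball X r)]
    congr 1
    ext v
    simp only [mem_ofPred_eq, mem_preimage, mem_inter_iff, isI, coord_add, Metric.mem_ball,
      dist_self_add_left]
    tauto
  have key := vol_tiles A B mem dis (Metric.ball X r) measurableSet_ball
  rw [← tr, h2] at key
  simp_rw [← tr, h1] at key
  rw [← ENNReal.ofReal_sum_of_nonneg, ← Finset.sum_mul, ← Finset.sum_div] at key
  · rw [ENNReal.ofReal_eq_ofReal_iff] at key
    · have := mul_right_cancel₀ (by positivity) key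
      linarith
    · have := angOf_nonneg A X; positivity
    · have := Finset.sum_nonneg (fun i (_ : i ∈ Finset.univ) => angOf_nonneg (B i) X); positivity
  · intro i _
    have := angOf_nonneg (B i) X; positivity
def ar (b : AB) : ℝ := sin (vang b 0) * (dist (b 1) (b 0) * dist (b 2) (b 0))
def trf (a b : AB) : Pt →ₗ[ℝ] Pt := (lin a 1).smulRight (b 1 - b 0) + (lin a 2).smulRight (b 2 - b 0)
theorem lin_trf (a b : AB) (k : Fin 3) (v : Pt) : lin b k (trf a b v) = lin a k v := by
  have := lin_sum a v
  simp only [trf, LinearMap.add_apply, LinearMap.smulRight_apply, map_add, map_smul, lin_sub,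
    coord_vert, smul_eq_mul]
  fin_cases k <;> (simp; try linarith)
theorem trf_trf (a b : AB) (v : Pt) : trf a b (trf b a v) = v := by
  apply eq_of_lin b; intro k; rw [lin_trf, lin_trf]
theorem ar_det (b : AB) : ar b = |(EuclideanSpace.basisFun (Fin 2) ℝ).toBasis.det ![b 1 - b 0, b 2 - b 0]| := by
  unfold ar vang EuclideanGeometry.angle
  have h := InnerProductGeometry.sin_angle_mul_norm_mul_norm (b 1 - b 0) (b 2 - b 0)
  simp only [vsub_eq_sub, dist_eq_norm]
  simp only [zero_add]
  rw [h, Module.Basis.det_apply, Matrix.det_fin_two]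
  rw [← Real.sqrt_sq_eq_abs]
  congr 1
  simp only [PiLp.inner_apply, Fin.sum_univ_two]
  simp [Module.Basis.toMatrix_apply]
  ring
theorem ar_trf (a b : AB) : ar b = |LinearMap.det (trf a b)| * ar a := by
  rw [ar_det, ar_det, ← abs_mul, ← Module.Basis.det_comp]
  congr 2
  ext i
  have : ∀ j, trf a b (a j - a 0) = b j - b 0 := by
    intro j
    apply eq_of_lin b; intro k; rw [lin_trf, lin_sub, lin_sub, coord_vert, coord_vert, coord_vert, coord_vert]
  fin_cases i <;> simp [this]
theorem vol_trf (a b : AB) : volume {X | isI b X} =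
    ENNReal.ofReal |LinearMap.det (trf a b)| * volume {X | isI a X} := by
  have h1 : ∀ c : AB, volume {X | isI c X} = volume {v | isI c (c 0 + v)} := by
    intro c
    rw [← measure_preimage_add (volume : Measure Pt) (c 0) {X | isI c X}]; rfl
  rw [h1, h1, ← Measure.addHaar_image_linearMap]
  congr 1
  ext v
  constructor
  · intro h
    refine ⟨trf b a v, ?_, trf_trf a b v⟩
    intro k
    have := h k
    rw [coord_add, coord_vert] at this ⊢
    rwa [lin_trf]
  · rintro ⟨w, h, rfl⟩
    intro k
    have := h k
    rw [coord_add, coord_vert] at this ⊢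
    rwa [lin_trf]
theorem vol_pos_fin (a : AB) : volume {X | isI a X} ≠ 0 ∧ volume {X | isI a X} ≠ ⊤ := by
  have h : {X | isI a X} = interior (convexHull ℝ (range a)) := by
    rw [AffineBasis.interior_convexHull]; rfl
  rw [h]
  constructor
  · apply (isOpen_interior.measure_pos _ _).ne'
    rw [interior_convexHull_nonempty_iff_affineSpan_eq_top]
    exact a.tot
  · apply ((measure_mono interior_subset).trans_lt _).ne
    exact ((Set.finite_range a).isCompact_convexHull ℝ).measure_lt_top
theorem ar_sum {N : ℕ} (A : AB) (B : Fin N → AB)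
    (mem : ∀ X, (∀ k, 0 ≤ A.coord k X) ↔ ∃ i, ∀ k, 0 ≤ (B i).coord k X)
    (dis : ∀ i j X, isI (B i) X → isI (B j) X → i = j) : ∑ i, ar (B i) = ar A := by
  have key := vol_tiles A B mem dis univ MeasurableSet.univ
  simp only [inter_univ] at key
  simp_rw [fun i => vol_trf A (B i)] at key
  rw [← Finset.sum_mul, ← ENNReal.ofReal_sum_of_nonneg (fun _ _ => abs_nonneg _)] at key
  obtain ⟨h0, h1⟩ := vol_pos_fin A
  have : ENNReal.ofReal (∑ i, |LinearMap.det (trf A (B i))|) = 1 := by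
    apply (ENNReal.mul_left_inj h0 h1).1
    rw [one_mul]; exact key.symm
  rw [ENNReal.ofReal_eq_one] at this
  rw [Finset.sum_congr rfl (fun i _ => ar_trf A (B i)), ← Finset.sum_mul, this, one_mul]
end
section
open MeasureTheory Set Filter Topology
variable {A : AB} {B : Fin 11 → AB} {θ L : Fin 3 → ℝ}
def Lex3 (c p q : ℝ) : Prop := 0 < c ∨ (c = 0 ∧ (0 < p ∨ (p = 0 ∧ 0 ≤ q)))
theorem ev_pos {c p q : ℝ} (h : 0 < c) : ∀ᶠ ε in 𝓝[>] (0:ℝ), 0 < c + ε * p + ε ^ 2 * q := by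
  apply Filter.Eventually.filter_mono nhdsWithin_le_nhds
  have : ContinuousAt (fun ε : ℝ => c + ε * p + ε ^ 2 * q) 0 := by fun_prop
  exact this.eventually (lt_mem_nhds (by simpa using h))
theorem lex_pos {c p q : ℝ} (h : Lex3 c p q) : ∀ᶠ ε in 𝓝[>] (0:ℝ), 0 ≤ c + ε * p + ε ^ 2 * q := by
  rcases h with h | ⟨rfl, h | ⟨rfl, h⟩⟩
  · exact (ev_pos h).mono fun _ h => h.le
  · filter_upwards [ev_pos (p := q) (q := 0) h, self_mem_nhdsWithin] with ε h1 h2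
    replace h2 : 0 < ε := h2
    nlinarith
  · filter_upwards with ε
    simp; positivity
theorem lex_neg {c p q : ℝ} (h : ¬ Lex3 c p q) : ∀ᶠ ε in 𝓝[>] (0:ℝ), c + ε * p + ε ^ 2 * q < 0 := by
  unfold Lex3 at h
  push Not at h
  obtain ⟨h1, h2⟩ := h
  rcases h1.lt_or_eq with h | rfl
  · filter_upwards [ev_pos (c := -c) (p := -p) (q := -q) (by linarith)] with ε h; linarith
  obtain ⟨h3, h4⟩ := h2 rfl
  rcases h3.lt_or_eq with h | rfl
  · filter_upwards [ev_pos (c := -p) (p := -q) (q := 0) (by linarith), self_mem_nhdsWithin] with ε h1 h2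
    replace h2 : 0 < ε := h2
    nlinarith
  · filter_upwards [self_mem_nhdsWithin] with ε h2
    replace h2 : 0 < ε := h2
    have := h4 rfl
    have : 0 < ε ^ 2 := by positivity
    nlinarith
def G (b : AB) (X u n : Pt) : Prop := ∀ k, Lex3 (b.coord k X) (lin b k u) (lin b k n)
theorem coord_germ (b : AB) (k : Fin 3) (X u n : Pt) (ε : ℝ) :
    b.coord k (X + (ε • u + ε ^ 2 • n)) = b.coord k X + ε * lin b k u + ε ^ 2 * lin b k n := by
  rw [coord_add, map_add, map_smul, map_smul]; simp [add_assoc]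
theorem germ {N : ℕ} {A : AB} {B : Fin N → AB}
    (mem : ∀ X, (∀ k, 0 ≤ A.coord k X) ↔ ∃ i, ∀ k, 0 ≤ (B i).coord k X) {X u n : Pt}
    (h : G A X u n) : ∃ i, G (B i) X u n := by
  by_contra hc
  push Not at hc
  have h1 : ∀ᶠ ε in 𝓝[>] (0:ℝ), ∀ k, 0 ≤ A.coord k (X + (ε • u + ε ^ 2 • n)) := by
    rw [eventually_all]
    intro k
    simp_rw [coord_germ]
    exact lex_pos (h k)
  have h2 : ∀ᶠ ε in 𝓝[>] (0:ℝ), ∀ i, ¬ ∀ k, 0 ≤ (B i).coord k (X + (ε • u + ε ^ 2 • n)) := by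
    rw [eventually_all]
    intro i
    have := hc i
    unfold G at this
    push Not at this
    obtain ⟨k, hk⟩ := this
    filter_upwards [lex_neg hk] with ε he hh
    have := hh k
    rw [coord_germ] at this
    linarith
  obtain ⟨ε, h3, h4⟩ := (h1.and h2).exists
  obtain ⟨i, hi⟩ := (mem _).1 h3
  exact h4 i hi
theorem germ_int (b : AB) (X u n : Pt)
    (h : ∀ k, 0 < b.coord k X ∨ (b.coord k X = 0 ∧ (0 < lin b k u ∨ (lin b k u = 0 ∧ 0 < lin b k n)))) :
    ∀ᶠ ε in 𝓝[>] (0:ℝ), isI b (X + (ε • u + ε ^ 2 • n)) := by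
  unfold isI
  rw [eventually_all]
  intro k
  simp_rw [coord_germ]
  rcases h k with h | ⟨h0, h | ⟨h1, h⟩⟩
  · exact ev_pos h
  · filter_upwards [ev_pos (p := lin b k n) (q := 0) h, self_mem_nhdsWithin] with ε h1 h2
    replace h2 : 0 < ε := h2
    rw [h0]
    nlinarith
  · filter_upwards [self_mem_nhdsWithin] with ε h2
    replace h2 : 0 < ε := h2
    rw [h0, h1]; simp; positivity
structure Tl (A : AB) (B : Fin 11 → AB) (θ L : Fin 3 → ℝ) : Prop where
  ang : ∀ i k, vang (B i) k = θ k
  len : ∀ i k, dist (B i (k+1)) (B i (k+2)) = L k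
  mem : ∀ X, (∀ k, 0 ≤ A.coord k X) ↔ ∃ i, ∀ k, 0 ≤ (B i).coord k X
  dis : ∀ i j X, isI (B i) X → isI (B j) X → i = j
theorem Tl.same (T : Tl A B θ L) {i j : Fin 11} {X u n : Pt}
    (hi : ∀ k, 0 < (B i).coord k X ∨ ((B i).coord k X = 0 ∧ (0 < lin (B i) k u ∨ (lin (B i) k u = 0 ∧ 0 < lin (B i) k n))))
    (hj : ∀ k, 0 < (B j).coord k X ∨ ((B j).coord k X = 0 ∧ (0 < lin (B j) k u ∨ (lin (B j) k u = 0 ∧ 0 < lin (B j) k n)))) :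
    i = j := by
  obtain ⟨ε, h1, h2⟩ := ((germ_int _ X u n hi).and (germ_int _ X u n hj)).exists
  exact T.dis i j _ h1 h2
theorem lin_indep (b : AB) (k : Fin 3) {u n : Pt} (hun : ∀ v, ∃ s t : ℝ, v = s • u + t • n)
    (hu : lin b k u = 0) (hn : lin b k n = 0) : False := by
  apply lin_ne_zero b k
  ext v
  obtain ⟨s, t, rfl⟩ := hun v
  simp [hu, hn]
def th (l m : Fin 3) : Fin 3 := -(l + m)
theorem th_ne_l {l m : Fin 3} (h : l ≠ m) : th l m ≠ l := by revert l m; decide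
theorem th_ne_m {l m : Fin 3} (h : l ≠ m) : th l m ≠ m := by revert l m; decide
theorem th_cases {l m : Fin 3} (h : l ≠ m) (j : Fin 3) : j = l ∨ j = m ∨ j = th l m := by
  revert l m j; decide
theorem th_comm (l m : Fin 3) : th l m = th m l := by revert l m; decide
theorem sum_three' (f : Fin 3 → ℝ) {l m : Fin 3} (h : l ≠ m) :
    f l + f m + f (th l m) = f 0 + f 1 + f 2 := by
  have e : (l = 0 ∧ m = 1 ∧ th l m = 2) ∨ (l = 0 ∧ m = 2 ∧ th l m = 1) ∨ (l = 1 ∧ m = 0 ∧ th l m = 2) ∨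
    (l = 1 ∧ m = 2 ∧ th l m = 0) ∨ (l = 2 ∧ m = 0 ∧ th l m = 1) ∨ (l = 2 ∧ m = 1 ∧ th l m = 0) := by
    revert l m; decide
  rcases e with ⟨h1, h2, h3⟩ | ⟨h1, h2, h3⟩ | ⟨h1, h2, h3⟩ | ⟨h1, h2, h3⟩ | ⟨h1, h2, h3⟩ | ⟨h1, h2, h3⟩ <;>
  rw [h3, h1, h2] <;> ring
theorem lin_sum' (b : AB) (v : Pt) {l m : Fin 3} (h : l ≠ m) :
    lin b l v + lin b m v + lin b (th l m) v = 0 := by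
  rw [sum_three' (fun k => lin b k v) h]; exact lin_sum b v
theorem coord_sum' (b : AB) (v : Pt) {l m : Fin 3} (h : l ≠ m) :
    b.coord l v + b.coord m v + b.coord (th l m) v = 1 := by
  rw [sum_three' (fun k => b.coord k v) h]; exact coord_sum b v
def Ed (B : Fin 11 → AB) (u n : Pt) (i : Fin 11) (l m : Fin 3) : Prop :=
  l ≠ m ∧ lin (B i) (th l m) u = 0 ∧ 0 < lin (B i) (th l m) n ∧ 0 < lin (B i) m u
def IsCh (B : Fin 11 → AB) (u n : Pt) : List (Fin 11 × Fin 3 × Fin 3) → Pt → Pt → Prop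
  | [], P, Q => P = Q
  | (i, l, m) :: w, P, Q => Ed B u n i l m ∧ B i l = P ∧ IsCh B u n w (B i m) Q
def Blk (B : Fin 11 → AB) (u n X : Pt) : Prop :=
  ∀ i k, lin (B i) k u = 0 → 0 < lin (B i) k n → (B i).coord k X = 0 → ¬ ∀ l, l ≠ k → 0 < (B i).coord l X
theorem lin_step {b : AB} {u : Pt} {l m : Fin 3} (hlm : l ≠ m)
    (_h0 : lin b (th l m) u = 0) (h1 : 0 < lin b m u) : b m = b l + (1 / lin b m u) • u := by
  have hs := lin_sum' b u hlm
  apply eq_of_coord b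
  intro j
  rw [coord_add, coord_vert, coord_vert, map_smul, smul_eq_mul]
  rcases th_cases hlm j with rfl | rfl | rfl
  · have : lin b j u = - lin b m u := by linarith
    rw [this, if_neg hlm]; field_simp; simp
  · rw [if_neg hlm.symm]; field_simp; simp
  · rw [if_neg (th_ne_m hlm), if_neg (th_ne_l hlm), _h0]; simp
theorem Ed.step {u n : Pt} {i : Fin 11} {l m : Fin 3} (h : Ed B u n i l m) :
    B i m = B i l + (1 / lin (B i) m u) • u := lin_step h.1 h.2.1 h.2.2.2
theorem germ_edge {b : AB} {X u n : Pt} (hu : u ≠ 0) (hG : G b X u n) {k : Fin 3}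
    (h0 : b.coord k X = 0) (h1 : lin b k u = 0) :
    ∃ l m, l ≠ m ∧ k = th l m ∧ 0 < lin b m u ∧ 0 < b.coord l X ∧ 0 ≤ b.coord m X := by
  have hG' : ∀ j, 0 ≤ b.coord j X := by
    intro j
    rcases hG j with h | ⟨h, _⟩
    · exact h.le
    · rw [h]
  have key : ∀ l m, l ≠ m → k = th l m → 0 < lin b m u → 0 < b.coord l X := by
    intro l m hlm hk hm
    have := lin_sum' b u hlm
    rw [← hk, h1] at this
    rcases hG l with h | ⟨_, h | ⟨h, _⟩⟩
    · exact h
    · linarith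
    · linarith
  have hk1 : k + 1 ≠ k + 2 := by clear * -; revert k; decide
  have hk2 : k = th (k+1) (k+2) := by clear * -; revert k; decide
  have hs := lin_sum' b u hk1
  rw [← hk2, h1] at hs
  rcases lt_trichotomy (lin b (k+2) u) 0 with h | h | h
  · exact ⟨k+2, k+1, hk1.symm, by rw [th_comm]; exact hk2, by linarith,
      key _ _ hk1.symm (by rw [th_comm]; exact hk2) (by linarith), hG' _⟩
  · exfalso
    apply hu
    apply eq_of_lin b
    intro j
    rw [map_zero]
    rcases th_cases hk1 j with rfl | rfl | rfl
    · linarith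
    · exact h
    · rw [← hk2]; exact h1
  · exact ⟨k+1, k+2, hk1, hk2, h, key _ _ hk1 hk2 h, hG' _⟩
theorem Tl.chain (T : Tl A B θ L) {P Q n : Pt} (hu : Q - P ≠ 0)
    (hun : ∀ v, ∃ s t : ℝ, v = s • (Q - P) + t • n)
    (H1 : ∀ k, 0 ≤ A.coord k P ∧ 0 ≤ A.coord k Q ∧ (A.coord k P = 0 → A.coord k Q = 0 → 0 ≤ lin A k n))
    (H2 : ∀ t : ℝ, 0 < t → t < 1 → ∀ i, ¬ isI (B i) (P + t • (Q - P)))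
    (HP : Blk B (Q - P) n P) (HQ : Blk B (Q - P) n Q) : ∃ w, IsCh B (Q - P) n w P Q := by
  set u := Q - P with hudef
  have hQ : Q = P + (1:ℝ) • u := by rw [hudef]; simp
  classical
  have main : ∀ N : ℕ, ∀ t : ℝ, 0 ≤ t → t ≤ 1 → Blk B u n (P + t • u) →
      (Finset.univ.filter fun q : Fin 11 × Fin 3 => ∃ s : ℝ, t < s ∧ B q.1 q.2 = P + s • u).card ≤ N →
      ∃ w, IsCh B u n w (P + t • u) Q := by
    intro N
    induction N using Nat.strong_induction_on with
    | _ N ih =>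
    intro t ht0 ht1 hB hN
    rcases ht1.eq_or_lt with rfl | ht
    · exact ⟨[], hQ.symm⟩
    have hGA : G A (P + t • u) u n := by
      intro k
      obtain ⟨a1, a2, a3⟩ := H1 k
      have e : lin A k u = A.coord k Q - A.coord k P := lin_sub A k P Q
      rw [coord_add, map_smul, smul_eq_mul, e]
      have e2 : A.coord k P + t * (A.coord k Q - A.coord k P) = (1 - t) * A.coord k P + t * A.coord k Q := by ring
      rw [e2]
      rcases a1.eq_or_lt with b1 | b1
      · rcases a2.eq_or_lt with b2 | b2
        · right; rw [← b1, ← b2]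
          exact ⟨by ring, Or.inr ⟨by ring, a3 b1.symm b2.symm⟩⟩
        · rw [← b1]
          rcases ht0.eq_or_lt with b3 | b3
          · right; rw [← b3]; exact ⟨by ring, Or.inl (by linarith)⟩
          · left; have := mul_pos b3 b2; linarith
      · left
        have := mul_pos (sub_pos.2 ht) b1
        have := mul_nonneg ht0 a2
        linarith
    obtain ⟨i, hi⟩ := germ T.mem hGA
    obtain ⟨k, hk0, hk1, hk2⟩ : ∃ k, (B i).coord k (P + t • u) = 0 ∧ lin (B i) k u = 0 ∧ 0 < lin (B i) k n := by
      by_contra hc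
      push Not at hc
      have hst : ∀ k, 0 < (B i).coord k (P + t • u) ∨ ((B i).coord k (P + t • u) = 0 ∧
          (0 < lin (B i) k u ∨ (lin (B i) k u = 0 ∧ 0 < lin (B i) k (0 : Pt)))) := by
        intro k
        rcases hi k with h | ⟨h, h' | ⟨h', h''⟩⟩
        · exact Or.inl h
        · exact Or.inr ⟨h, Or.inl h'⟩
        · exfalso
          have := hc k h h'
          exact lin_indep (B i) k hun h' (le_antisymm this h'')
      have h1 := germ_int (B i) (P + t • u) u 0 hst
      have h2 : ∀ᶠ ε in 𝓝[>] (0:ℝ), t + ε < 1 := by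
        filter_upwards [Ioo_mem_nhdsGT (show (0:ℝ) < 1 - t by linarith)] with ε he
        linarith [he.2]
      obtain ⟨ε, e1, e2, e3⟩ := (h1.and (h2.and self_mem_nhdsWithin)).exists
      replace e3 : 0 < ε := e3
      apply H2 (t + ε) (by linarith) e2 i
      convert e1 using 1
      simp [add_smul, add_assoc]
    obtain ⟨l, m, hlm, rfl, hm, hcl, hcm⟩ := germ_edge hu hi hk0 hk1
    have hEd : Ed B u n i l m := ⟨hlm, hk1, hk2, hm⟩
    have hcs := coord_sum' (B i) (P + t • u) hlm
    have hls := lin_sum' (B i) u hlm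
    rw [hk0] at hcs
    rw [hk1] at hls
    have hcm0 : (B i).coord m (P + t • u) = 0 := by
      by_contra hne
      apply hB i (th l m) hk1 hk2 hk0
      intro j hj
      rcases th_cases hlm j with rfl | rfl | rfl
      · exact hcl
      · exact lt_of_le_of_ne hcm (Ne.symm hne)
      · exact absurd rfl hj
    have hl : B i l = P + t • u := by
      apply eq_of_coord (B i)
      intro j
      rw [coord_vert]
      rcases th_cases hlm j with rfl | rfl | rfl
      · simp; linarith
      · rw [if_neg hlm.symm, hcm0]
      · rw [if_neg (th_ne_l hlm), hk0]
    set t' := t + 1 / lin (B i) m u with ht'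
    have hm' : B i m = P + t' • u := by
      rw [hEd.step, hl, ht', add_smul, add_assoc]
    have htt : t < t' := by
      have : 0 < 1 / lin (B i) m u := by positivity
      linarith
    have ht'1 : t' ≤ 1 := by
      by_contra hc
      push Not at hc
      have hQ' : Q = B i m + (1 - t') • u := by
        rw [hm', hQ, add_assoc, ← add_smul]; congr 2; ring
      have hQl : Q = B i l + (1 - t) • u := by
        rw [hl, hQ, add_assoc, ← add_smul]; congr 2; ring
      apply HQ i (th l m) hk1 hk2
      · rw [hQ', coord_add, coord_vert, map_smul, hk1, if_neg (th_ne_m hlm)]; simp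
      · intro j hj
        rcases th_cases hlm j with rfl | rfl | rfl
        · rw [hQ', coord_add, coord_vert, map_smul, if_neg hlm, smul_eq_mul]
          nlinarith
        · rw [hQl, coord_add, coord_vert, map_smul, if_neg hlm.symm, smul_eq_mul]
          nlinarith
        · exact absurd rfl hj
    have hB' : Blk B u n (P + t' • u) := by
      intro j k' a1 a2 a3 a4
      have : i = j := by
        apply T.same (X := P + t' • u) (u := -u) (n := n)
        · intro q
          rw [← hm', coord_vert]
          rcases th_cases hlm q with rfl | rfl | rfl
          · right; rw [if_neg hlm, map_neg]; exact ⟨rfl, Or.inl (by linarith)⟩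
          · left; simp
          · right; rw [if_neg (th_ne_m hlm), map_neg, hk1]; simpa using hk2
        · intro q
          by_cases hq : q = k'
          · right; subst hq; rw [a3, map_neg, a1]; simpa using a2
          · left; exact a4 q hq
      subst this
      rw [← hm'] at a3 a4
      rw [coord_vert] at a3
      have hkm : k' ≠ m := by rintro rfl; simp at a3
      have hne : (th k' m) ≠ k' := th_ne_l hkm
      have := a4 _ hne
      rw [coord_vert, if_neg (th_ne_m hkm)] at this
      exact lt_irrefl _ this
    have hcard : (Finset.univ.filter fun q : Fin 11 × Fin 3 => ∃ s : ℝ, t' < s ∧ B q.1 q.2 = P + s • u).card <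
        (Finset.univ.filter fun q : Fin 11 × Fin 3 => ∃ s : ℝ, t < s ∧ B q.1 q.2 = P + s • u).card := by
      apply Finset.card_lt_card
      rw [Finset.ssubset_iff_of_subset]
      · refine ⟨(i, m), ?_, ?_⟩
        · simp only [Finset.mem_filter, Finset.mem_univ, true_and]
          exact ⟨t', htt, hm'⟩
        · simp only [Finset.mem_filter, Finset.mem_univ, true_and]
          rintro ⟨s, hs, he⟩
          rw [hm'] at he
          have := smul_left_injective ℝ hu (add_left_cancel he)
          exact hs.ne this
      · intro q hq
        simp only [Finset.mem_filter, Finset.mem_univ, true_and] at hq ⊢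
        obtain ⟨s, hs, he⟩ := hq
        exact ⟨s, htt.trans hs, he⟩
    obtain ⟨w, hw⟩ := ih _ (hcard.trans_le hN) t' (by linarith) ht'1 hB' le_rfl
    refine ⟨(i, l, m) :: w, hEd, hl, ?_⟩
    rw [hm']; exact hw
  obtain ⟨w, hw⟩ := main _ 0 le_rfl zero_le_one (by simpa using HP) le_rfl
  exact ⟨w, by simpa using hw⟩
end
section
open MeasureTheory Set Filter Topology
open Classical
variable {A : AB} {B : Fin 11 → AB} {θ L : Fin 3 → ℝ}
theorem angOf_vert (b : AB) (k : Fin 3) : angOf b (b k) = vang b k := by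
  unfold angOf
  rw [if_neg, if_neg, Finset.sum_eq_single k]
  · simp
  · intro l _ hl
    rw [if_neg]
    exact ab_ne b hl
  · simp
  · intro h
    have := h (k+1)
    rw [coord_vert] at this
    fin_cases k <;> simp at this
  · rintro ⟨l, h1, h2⟩
    simp only [coord_vert] at h1 h2
    have a1 := h2 (k+1)
    have a2 := h2 (k+2)
    revert h1 a1 a2
    clear * -
    fin_cases k <;> fin_cases l <;> simp
theorem not_vert_of_E {b : AB} {X : Pt} (h : isE b X) (k : Fin 3) : b k ≠ X := by
  rintro rfl
  obtain ⟨l, h1, h2⟩ := h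
  simp only [coord_vert] at h1 h2
  have a1 := h2 (k+1)
  have a2 := h2 (k+2)
  revert h1 a1 a2
  clear * -
  fin_cases k <;> fin_cases l <;> simp
theorem not_vert_of_I {b : AB} {X : Pt} (h : isI b X) (k : Fin 3) : b k ≠ X := by
  rintro rfl
  have := h (k+1)
  rw [coord_vert] at this
  fin_cases k <;> simp at this
theorem not_E_of_I {b : AB} {X : Pt} (h : isI b X) : ¬ isE b X := by
  rintro ⟨k, h1, _⟩
  linarith [h k]
theorem angOf_E {b : AB} {X : Pt} (h : isE b X) : angOf b X = π := by
  unfold angOf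
  rw [Finset.sum_eq_zero (fun k _ => if_neg (not_vert_of_E h k)), if_pos h, if_neg (fun h' => not_E_of_I h' h)]
  simp
theorem angOf_I {b : AB} {X : Pt} (h : isI b X) : angOf b X = 2 * π := by
  unfold angOf
  rw [Finset.sum_eq_zero (fun k _ => if_neg (not_vert_of_I h k)), if_neg (not_E_of_I h), if_pos h]
  simp
theorem cases_mem {b : AB} {X : Pt} (h : ∀ k, 0 ≤ b.coord k X) : (∃ k, b k = X) ∨ isE b X ∨ isI b X := by
  by_cases hI : isI b X
  · exact Or.inr (Or.inr hI)
  unfold isI at hI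
  push Not at hI
  obtain ⟨k, hk⟩ := hI
  have hk0 : b.coord k X = 0 := le_antisymm hk (h k)
  by_cases h1 : b.coord (k+1) X = 0
  · left
    refine ⟨k+2, eq_vert b X (k+2) ?_ ?_⟩
    · convert hk0 using 3; clear * -; revert k; decide
    · convert h1 using 3; clear * -; revert k; decide
  by_cases h2 : b.coord (k+2) X = 0
  · left
    refine ⟨k+1, eq_vert b X (k+1) ?_ ?_⟩
    · convert h2 using 3; clear * -; revert k; decide
    · convert hk0 using 3; clear * -; revert k; decide
  right; left
  refine ⟨k, hk0, fun l hl => ?_⟩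
  have : l = k + 1 ∨ l = k + 2 := by revert hl; clear * -; revert k l; decide
  rcases this with rfl | rfl
  · exact lt_of_le_of_ne (h _) (Ne.symm h1)
  · exact lt_of_le_of_ne (h _) (Ne.symm h2)
theorem vang_lt_pi (b : AB) (k : Fin 3) : vang b k < π := by
  rcases (EuclideanGeometry.angle_le_pi (b (k+1)) (b k) (b (k+2))).eq_or_lt with h | h
  · have := vang_sin_pos b k
    unfold vang at this
    rw [h] at this; simp at this
  · exact h
theorem vang_sum (b : AB) : vang b 0 + vang b 1 + vang b 2 = π := by
  have h := EuclideanGeometry.angle_add_angle_add_angle_eq_pi (b 2) (ab_ne b (k := 1) (l := 0) (by decide))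
  unfold vang
  have e1 : ∠ (b (0+1)) (b 0) (b (0+2)) = ∠ (b 2) (b 0) (b 1) := by rw [EuclideanGeometry.angle_comm]; rfl
  have e2 : ∠ (b (1+1)) (b 1) (b (1+2)) = ∠ (b 0) (b 1) (b 2) := by rw [EuclideanGeometry.angle_comm]; rfl
  have e3 : ∠ (b (2+1)) (b 2) (b (2+2)) = ∠ (b 1) (b 2) (b 0) := by rw [EuclideanGeometry.angle_comm]; rfl
  rw [e1, e2, e3]; linarith
def nv (B : Fin 11 → AB) (X : Pt) (k : Fin 3) : ℕ := (Finset.univ.filter fun i => B i k = X).card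
def ec (B : Fin 11 → AB) (X : Pt) : ℕ := (Finset.univ.filter fun i => isE (B i) X).card
def ic (B : Fin 11 → AB) (X : Pt) : ℕ := (Finset.univ.filter fun i => isI (B i) X).card
theorem Tl.asum (T : Tl A B θ L) (X : Pt) :
    ∑ k, (nv B X k : ℝ) * θ k + ec B X * π + ic B X * (2 * π) = angOf A X := by
  rw [← angle_sum A B T.mem T.dis X]
  unfold angOf nv ec ic
  rw [Finset.sum_add_distrib, Finset.sum_add_distrib, Finset.sum_comm]
  simp only [T.ang]
  congr 1
  · congr 1
    · apply Finset.sum_congr rfl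
      intro k _
      rw [Finset.sum_ite, Finset.sum_const_zero, add_zero, Finset.sum_const, nsmul_eq_mul]
    · rw [Finset.sum_ite, Finset.sum_const_zero, add_zero, Finset.sum_const, nsmul_eq_mul]
  · rw [Finset.sum_ite, Finset.sum_const_zero, add_zero, Finset.sum_const, nsmul_eq_mul]
theorem Tl.pos (T : Tl A B θ L) (k : Fin 3) : 0 < θ k := by rw [← T.ang 0 k]; exact vang_pos _ _
theorem Tl.sum (T : Tl A B θ L) : θ 0 + θ 1 + θ 2 = π := by
  rw [← T.ang 0 0, ← T.ang 0 1, ← T.ang 0 2]; exact vang_sum _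
theorem nv_pos (i : Fin 11) (k : Fin 3) : 0 < nv B (B i k) k := by
  unfold nv
  apply Finset.card_pos.2
  exact ⟨i, by simp⟩
theorem Tl.tsum_nonneg (T : Tl A B θ L) (X : Pt) : 0 ≤ ∑ k, (nv B X k : ℝ) * θ k :=
  Finset.sum_nonneg fun k _ => mul_nonneg (Nat.cast_nonneg _) (T.pos k).le
theorem Tl.tsum_pos (T : Tl A B θ L) (i : Fin 11) (k : Fin 3) :
    0 < ∑ j, (nv B (B i k) j : ℝ) * θ j := by
  have h1 : (nv B (B i k) k : ℝ) * θ k ≤ ∑ j, (nv B (B i k) j : ℝ) * θ j :=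
    Finset.single_le_sum (f := fun j => (nv B (B i k) j : ℝ) * θ j)
      (fun k _ => mul_nonneg (Nat.cast_nonneg _) (T.pos k).le) (Finset.mem_univ k)
  have h2 : (0:ℝ) < nv B (B i k) k := by exact_mod_cast nv_pos i k
  have := mul_pos h2 (T.pos k)
  linarith
theorem Tl.vmem (T : Tl A B θ L) (i : Fin 11) (k j : Fin 3) : 0 ≤ A.coord j (B i k) := by
  apply (T.mem (B i k)).2 ⟨i, fun l => ?_⟩
  rw [coord_vert]; split_ifs <;> norm_num
theorem angOf_le (b : AB) (X : Pt) : angOf b X ≤ 2 * π := by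
  have hp := Real.pi_pos
  by_cases h : ∀ k, 0 ≤ b.coord k X
  · rcases cases_mem h with ⟨k, rfl⟩ | h | h
    · rw [angOf_vert]; linarith [vang_lt_pi b k]
    · rw [angOf_E h]; linarith
    · rw [angOf_I h]
  · unfold angOf
    rw [Finset.sum_eq_zero, if_neg, if_neg]
    · linarith
    · intro h'; exact h fun k => (h' k).le
    · rintro ⟨k, h1, h2⟩
      apply h; intro l
      by_cases hl : l = k
      · rw [hl, h1]
      · exact (h2 l hl).le
    · intro k _
      apply if_neg
      rintro rfl
      apply h; intro l
      rw [coord_vert]; split_ifs <;> norm_num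
theorem Tl.ic0 (T : Tl A B θ L) (i : Fin 11) (k : Fin 3) : ic B (B i k) = 0 := by
  by_contra h
  have h1 : (1:ℝ) ≤ ic B (B i k) := by exact_mod_cast Nat.one_le_iff_ne_zero.2 h
  have := T.asum (B i k)
  have := T.tsum_pos i k
  have := angOf_le A (B i k)
  have hp := Real.pi_pos
  have : (0:ℝ) ≤ ec B (B i k) := Nat.cast_nonneg _
  nlinarith
theorem Tl.ec1 (T : Tl A B θ L) (i : Fin 11) (k : Fin 3) : ec B (B i k) ≤ 1 := by
  by_contra h
  push Not at h
  have h1 : (2:ℝ) ≤ ec B (B i k) := by exact_mod_cast h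
  have := T.asum (B i k)
  have := T.tsum_pos i k
  have := angOf_le A (B i k)
  have hp := Real.pi_pos
  have : (0:ℝ) ≤ ic B (B i k) := Nat.cast_nonneg _
  nlinarith
theorem not_I_angOf {b : AB} {X : Pt} (h : ¬ isI b X) : angOf b X ≤ π := by
  have hp := Real.pi_pos
  by_cases h' : ∀ k, 0 ≤ b.coord k X
  · rcases cases_mem h' with ⟨k, rfl⟩ | h' | h'
    · rw [angOf_vert]; linarith [vang_lt_pi b k]
    · rw [angOf_E h']
    · exact absurd h' h
  · unfold angOf
    rw [Finset.sum_eq_zero, if_neg, if_neg]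
    · linarith
    · exact h
    · rintro ⟨k, h1, h2⟩
      apply h'; intro l
      by_cases hl : l = k
      · rw [hl, h1]
      · exact (h2 l hl).le
    · intro k _
      apply if_neg
      rintro rfl
      apply h'; intro l
      rw [coord_vert]; split_ifs <;> norm_num
theorem Tl.ec0 (T : Tl A B θ L) (i : Fin 11) (k : Fin 3) (h : ¬ isI A (B i k)) : ec B (B i k) = 0 := by
  by_contra hc
  have h1 : (1:ℝ) ≤ ec B (B i k) := by exact_mod_cast Nat.one_le_iff_ne_zero.2 hc
  have := T.asum (B i k)
  have := T.tsum_pos i k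
  have := not_I_angOf h
  have hp := Real.pi_pos
  have : (0:ℝ) ≤ ic B (B i k) := Nat.cast_nonneg _
  nlinarith
theorem Tl.noE (T : Tl A B θ L) (i j : Fin 11) (k : Fin 3) (h : ¬ isI A (B i k)) : ¬ isE (B j) (B i k) := by
  intro hE
  have := T.ec0 i k h
  unfold ec at this
  rw [Finset.card_eq_zero, Finset.filter_eq_empty_iff] at this
  exact this (Finset.mem_univ j) hE
theorem Tl.oneE (T : Tl A B θ L) {i j j' : Fin 11} {k : Fin 3} (h : isE (B j) (B i k))
    (h' : isE (B j') (B i k)) : j = j' := by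
  have := T.ec1 i k
  unfold ec at this
  rw [Finset.card_le_one] at this
  exact this j (by simpa using h) j' (by simpa using h')
theorem Tl.noI_of_E (T : Tl A B θ L) {i j : Fin 11} {X : Pt} (h : isE (B i) X) : ¬ isI (B j) X := by
  intro hI
  have h1 : (1:ℝ) ≤ ec B X := by
    have : 0 < ec B X := Finset.card_pos.2 ⟨i, by simpa using h⟩
    exact_mod_cast this
  have h2 : (1:ℝ) ≤ ic B X := by
    have : 0 < ic B X := Finset.card_pos.2 ⟨j, by simpa using hI⟩
    exact_mod_cast this
  have := T.asum X
  have := T.tsum_nonneg X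
  have := angOf_le A X
  have hp := Real.pi_pos
  nlinarith
theorem Tl.noI_of_bd (T : Tl A B θ L) {j : Fin 11} {X : Pt} (h : ¬ isI A X) : ¬ isI (B j) X := by
  intro hI
  have h2 : (1:ℝ) ≤ ic B X := by
    have : 0 < ic B X := Finset.card_pos.2 ⟨j, by simpa using hI⟩
    exact_mod_cast this
  have := T.asum X
  have := T.tsum_nonneg X
  have := not_I_angOf h
  have hp := Real.pi_pos
  have : (0:ℝ) ≤ ec B X := Nat.cast_nonneg _
  nlinarith
theorem not_I_vert (b : AB) (k : Fin 3) : ¬ isI b (b k) := fun h => not_vert_of_I h k rfl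
theorem Tl.noE_corner (T : Tl A B θ L) (j : Fin 11) (m : Fin 3) : ¬ isE (B j) (A m) := by
  intro hI
  have h2 : (1:ℝ) ≤ ec B (A m) := by
    have : 0 < ec B (A m) := Finset.card_pos.2 ⟨j, by simpa using hI⟩
    exact_mod_cast this
  have := T.asum (A m)
  have := T.tsum_nonneg (A m)
  rw [angOf_vert] at *
  have := vang_lt_pi A m
  have hp := Real.pi_pos
  have : (0:ℝ) ≤ ic B (A m) := Nat.cast_nonneg _
  nlinarith
theorem Tl.corner (T : Tl A B θ L) (m : Fin 3) : ∑ k, (nv B (A m) k : ℝ) * θ k = vang A m := by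
  have h := T.asum (A m)
  have h1 : ec B (A m) = 0 := by
    unfold ec; rw [Finset.card_eq_zero, Finset.filter_eq_empty_iff]
    exact fun j _ => T.noE_corner j m
  have h2 : ic B (A m) = 0 := by
    unfold ic; rw [Finset.card_eq_zero, Finset.filter_eq_empty_iff]
    exact fun j _ => T.noI_of_bd (not_I_vert A m)
  rw [h1, h2, angOf_vert] at h
  simpa using h
theorem Tl.straight (T : Tl A B θ L) (i : Fin 11) (k : Fin 3) (h : isE A (B i k)) :
    ∑ j, (nv B (B i k) j : ℝ) * θ j = π := by
  have h' := T.asum (B i k)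
  rw [T.ic0, T.ec0 i k (fun hI => not_E_of_I hI h), angOf_E h] at h'
  simpa using h'
theorem Tl.inner (T : Tl A B θ L) (i : Fin 11) (k : Fin 3) (h : isI A (B i k)) :
    ∑ j, (nv B (B i k) j : ℝ) * θ j = π ∨ ∑ j, (nv B (B i k) j : ℝ) * θ j = 2 * π := by
  have h' := T.asum (B i k)
  rw [T.ic0, angOf_I h] at h'
  have := T.ec1 i k
  interval_cases ec B (B i k)
  · right; simpa using h'
  · left; simp at h'; linarith
abbrev Wd := List (Fin 11 × Fin 3 × Fin 3)
theorem dist_th {b : AB} {f : Fin 3 → ℝ} (h : ∀ k, dist (b (k+1)) (b (k+2)) = f k) {l m : Fin 3} (hlm : l ≠ m) :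
    dist (b l) (b m) = f (th l m) := by
  have : (l = th l m + 1 ∧ m = th l m + 2) ∨ (l = th l m + 2 ∧ m = th l m + 1) := by
    clear h; revert l m; decide
  rw [← h]
  rcases this with ⟨h1, h2⟩ | ⟨h1, h2⟩
  · rw [← h1, ← h2]
  · rw [← h1, ← h2, dist_comm]
theorem Tl.lpos (T : Tl A B θ L) (k : Fin 3) : 0 < L k := by
  rw [← T.len 0 k]
  exact dist_pos.2 (ab_ne _ (by revert k; decide))
def wlen (L : Fin 3 → ℝ) (w : Wd) : ℝ := (w.map fun e => L (th e.2.1 e.2.2)).sum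
theorem Tl.ch_len (T : Tl A B θ L) {u n : Pt} : ∀ (w : Wd) {P Q : Pt}, IsCh B u n w P Q →
    ∃ t : ℝ, 0 ≤ t ∧ (w ≠ [] → 0 < t) ∧ Q = P + t • u ∧ t * ‖u‖ = wlen L w
  | [], P, Q, h => ⟨0, le_rfl, by simp, by simp [show P = Q from h], by simp [wlen]⟩
  | (i, l, m) :: w, P, Q, h => by
    obtain ⟨hE, rfl, h⟩ := h
    obtain ⟨t, h0, _, h2, h3⟩ := T.ch_len w h
    have hp := hE.2.2.2
    have hp' : 0 < 1 / lin (B i) m u := by positivity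
    refine ⟨1 / lin (B i) m u + t, by positivity, fun _ => by positivity, ?_, ?_⟩
    · rw [h2, hE.step, add_assoc, ← add_smul]
    · rw [add_mul, h3]
      have : dist (B i l) (B i m) = L (th l m) := dist_th (T.len i) hE.1
      rw [hE.step, dist_self_add_right, norm_smul, Real.norm_of_nonneg hp'.le] at this
      rw [this]; simp [wlen]
theorem ch_append {u n : Pt} : ∀ (w w' : Wd) {P Q R : Pt}, IsCh B u n w P Q → IsCh B u n w' Q R →
    IsCh B u n (w ++ w') P R
  | [], w', P, Q, R, h, h' => by rw [show P = Q from h]; exact h'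
  | (i, l, m) :: w, w', P, Q, R, h, h' => ⟨h.1, h.2.1, ch_append w w' h.2.2 h'⟩
theorem ch_split {u n : Pt} : ∀ (w w' : Wd) {P R : Pt}, IsCh B u n (w ++ w') P R →
    ∃ Q, IsCh B u n w P Q ∧ IsCh B u n w' Q R
  | [], w', P, R, h => ⟨P, rfl, h⟩
  | (i, l, m) :: w, w', P, R, h => by
    obtain ⟨Q, h1, h2⟩ := ch_split w w' h.2.2
    exact ⟨Q, ⟨h.1, h.2.1, h1⟩, h2⟩
def rv (w : Wd) : Wd := (w.map fun e => (e.1, e.2.2, e.2.1)).reverse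
theorem Ed.neg {u n n' : Pt} {i : Fin 11} {l m : Fin 3} (h : Ed B u n i l m)
    (hn : ∃ s : ℝ, n' = n + s • u) : Ed B (-u) n' i m l := by
  obtain ⟨h1, h2, h3, h4⟩ := h
  obtain ⟨s, rfl⟩ := hn
  have hs := lin_sum' (B i) u h1
  refine ⟨h1.symm, ?_, ?_, ?_⟩
  · rw [th_comm, map_neg, h2, neg_zero]
  · rw [th_comm, map_add, map_smul, h2]; simpa using h3
  · rw [map_neg]; linarith
theorem ch_rev {u n n' : Pt} (hn : ∃ s : ℝ, n' = n + s • u) : ∀ (w : Wd) {P Q : Pt}, IsCh B u n w P Q →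
    IsCh B (-u) n' (rv w) Q P
  | [], P, Q, h => Eq.symm h
  | (i, l, m) :: w, P, Q, h => by
    have h1 := ch_rev hn w h.2.2
    have : rv ((i, l, m) :: w) = rv w ++ [(i, m, l)] := by simp [rv]
    rw [this]
    exact ch_append _ _ h1 ⟨h.1.neg hn, rfl, h.2.1⟩
theorem Tl.ch_start (T : Tl A B θ L) {u n : Pt} (w w' : Wd) (i l m) {P Q : Pt} (h : IsCh B u n (w ++ (i, l, m) :: w') P Q) :
    ∃ s t : ℝ, 0 ≤ s ∧ s < t ∧ (w ≠ [] → 0 < s) ∧ B i l = P + s • u ∧ B i m = P + t • u ∧ ∃ t', 0 ≤ t' ∧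
    (w' ≠ [] → 0 < t') ∧ Q = P + (t + t') • u := by
  obtain ⟨R, h1, h2⟩ := ch_split _ _ h
  obtain ⟨s, a1, a2, a3, _⟩ := T.ch_len _ h1
  obtain ⟨t', b1, b2, b3, _⟩ := T.ch_len _ h2.2.2
  have hp := h2.1.2.2.2
  have hp' : 0 < 1 / lin (B i) m u := by positivity
  have e1 : B i l = P + s • u := by rw [h2.2.1, a3]
  have e2 : B i m = P + (s + 1 / lin (B i) m u) • u := by
    rw [h2.1.step, e1, add_assoc, ← add_smul]
  refine ⟨s, s + 1 / lin (B i) m u, a1, by linarith, a2, e1, e2, t', b1, b2, ?_⟩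
  rw [b3, e2, add_assoc, ← add_smul]
theorem two_zero_lin {b : AB} {u : Pt} {k k' : Fin 3} (h : k ≠ k') (h1 : lin b k u = 0) (h2 : lin b k' u = 0) :
    u = 0 := by
  apply eq_of_lin b; intro j; rw [map_zero]
  have := lin_sum' b u h
  rcases th_cases h j with rfl | rfl | rfl
  · exact h1
  · exact h2
  · linarith
theorem Tl.ch_nodup (T : Tl A B θ L) {u n : Pt} (hu : u ≠ 0) : ∀ (w : Wd) {P Q : Pt}, IsCh B u n w P Q →
    (w.map Prod.fst).Nodup
  | [], _, _, _ => by simp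
  | (i, l, m) :: w, P, Q, h => by
    simp only [List.map_cons, List.nodup_cons]
    refine ⟨?_, T.ch_nodup hu w h.2.2⟩
    intro hi
    rw [List.mem_map] at hi
    obtain ⟨⟨j, l', m'⟩, hj, hij⟩ := hi
    obtain rfl : j = i := hij
    obtain ⟨w1, w2, rfl⟩ := List.append_of_mem hj
    obtain ⟨s, t, a1, a2, a3, a4, a5, t', b1, b2, b3⟩ := T.ch_start _ _ _ _ _ h.2.2
    obtain ⟨R, c1, c2⟩ := ch_split _ _ h.2.2
    have hE' := c2.1
    have hE := h.1
    have hk : th l m = th l' m' := by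
      by_contra hne
      exact hu (two_zero_lin hne hE.2.1 hE'.2.1)
    have hs := lin_sum' (B j) u hE.1
    have hs' := lin_sum' (B j) u hE'.1
    have e1 := hE.2.1
    have e1' := hE'.2.1
    have e2 := hE.2.2.2
    have e2' := hE'.2.2.2
    have : l' = l ∨ l' = m := by
      have := hE.1; have := hE'.1
      clear * - hk this hE hE'
      have h1 := hE.1; have h2 := hE'.1
      clear hE hE' this
      revert l m l' m'; decide
    rcases this with h' | h'
    · rw [h', hE.step] at a4
      rw [add_assoc, ← add_smul] at a4
      have : (1 / lin (B j) m u + s) • u = 0 := by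
        simpa using a4.symm
      rw [smul_eq_zero] at this
      have hp' : 0 < 1 / lin (B j) m u := by positivity
      rcases this with h | h
      · linarith
      · exact hu h
    · rw [h'] at hs' e1'
      linarith
theorem Tl.ch_length (T : Tl A B θ L) {u n : Pt} (hu : u ≠ 0) (w : Wd) {P Q : Pt} (h : IsCh B u n w P Q) :
    w.length ≤ 11 := by
  have h1 := T.ch_nodup hu w h
  have := h1.length_le_card
  simpa using this
theorem blk_of_noE {u n X : Pt} (h : ∀ j, ¬ isE (B j) X) : Blk B u n X :=
  fun i k _ _ h3 h4 => h i ⟨k, h3, h4⟩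
theorem span_side (b : AB) {p q : Fin 3} (hpq : p ≠ q) (v : Pt) :
    ∃ s t : ℝ, v = s • (b q - b p) + t • (b (th p q) - b p) := by
  refine ⟨lin b q v, lin b (th p q) v, ?_⟩
  apply eq_of_lin b
  intro j
  have := lin_sum' b v hpq
  simp only [map_add, map_smul, lin_sub, coord_vert, smul_eq_mul]
  have h1 := th_ne_l hpq
  have h2 := th_ne_m hpq
  rcases th_cases hpq j with rfl | rfl | rfl
  · simp [hpq, h1.symm]; linarith
  · simp [hpq.symm, h2.symm]
  · simp [h1, h2]
theorem coord_side (b : AB) {p q : Fin 3} (hpq : p ≠ q) (s : ℝ) :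
    b.coord p (b p + s • (b q - b p)) = 1 - s ∧ b.coord q (b p + s • (b q - b p)) = s ∧
    b.coord (th p q) (b p + s • (b q - b p)) = 0 := by
  simp only [coord_add, map_smul, lin_sub, coord_vert, smul_eq_mul]
  simp [hpq, hpq.symm, th_ne_l hpq, th_ne_m hpq]; ring
theorem isE_side (b : AB) {p q : Fin 3} (hpq : p ≠ q) {s : ℝ} (h0 : 0 < s) (h1 : s < 1) :
    isE b (b p + s • (b q - b p)) := by
  obtain ⟨e1, e2, e3⟩ := coord_side b hpq s
  refine ⟨th p q, e3, fun l hl => ?_⟩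
  rcases th_cases hpq l with rfl | rfl | rfl
  · rw [e1]; linarith
  · rw [e2]; exact h0
  · exact absurd rfl hl
def IsSide (A : AB) (B : Fin 11 → AB) (p q : Fin 3) (w : Wd) : Prop :=
  p ≠ q ∧ IsCh B (A q - A p) (A (th p q) - A p) w (A p) (A q)
theorem Tl.side (T : Tl A B θ L) {p q : Fin 3} (hpq : p ≠ q) : ∃ w, IsSide A B p q w := by
  have := T.chain (P := A p) (Q := A q) (n := A (th p q) - A p) (sub_ne_zero.2 (ab_ne A hpq.symm))
    (span_side A hpq) ?_ ?_ (blk_of_noE fun j => T.noE_corner j p) (blk_of_noE fun j => T.noE_corner j q)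
  · obtain ⟨w, hw⟩ := this
    exact ⟨w, hpq, hw⟩
  · intro k
    simp only [coord_vert, lin_sub]
    refine ⟨by split_ifs <;> norm_num, by split_ifs <;> norm_num, ?_⟩
    intro h1 h2
    rw [h1]; simp; split_ifs <;> norm_num
  · intro t h0 h1 i
    apply T.noI_of_bd
    intro h
    exact not_E_of_I h (isE_side A hpq h0 h1)
theorem IsSide.rev {p q : Fin 3} {w : Wd} (h : IsSide A B p q w) : IsSide A B q p (rv w) := by
  refine ⟨h.1.symm, ?_⟩
  have := ch_rev (n' := A (th q p) - A q) ⟨-1, ?_⟩ w h.2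
  · rwa [neg_sub] at this
  · rw [th_comm]; module
theorem IsSide.ne_nil {p q : Fin 3} {w : Wd} (h : IsSide A B p q w) : w ≠ [] := by
  rintro rfl
  exact ab_ne A h.1 h.2
theorem Tl.side_len (T : Tl A B θ L) {p q : Fin 3} {w : Wd} (h : IsSide A B p q w) :
    dist (A p) (A q) = wlen L w ∧ w.length ≤ 11 := by
  have hu : A q - A p ≠ 0 := sub_ne_zero.2 (ab_ne A h.1.symm)
  obtain ⟨t, _, _, h3, h4⟩ := T.ch_len w h.2
  refine ⟨?_, T.ch_length hu w h.2⟩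
  have : t = 1 := by
    have h5 : (1:ℝ) • (A q - A p) = t • (A q - A p) := by
      rw [one_smul]; nth_rewrite 1 [h3]; abel
    exact (smul_left_injective ℝ hu h5).symm
  rw [← h4, this, one_mul, dist_comm, dist_eq_norm]
theorem Tl.side_vert (T : Tl A B θ L) {p q : Fin 3} {w w' : Wd} {i l m j l' m'}
    (h : IsSide A B p q (w ++ (i, l, m) :: (j, l', m') :: w')) :
    l ≠ m ∧ l' ≠ m' ∧ B i m = B j l' ∧ i ≠ j ∧ isE A (B i m) := by
  have hu : A q - A p ≠ 0 := sub_ne_zero.2 (ab_ne A h.1.symm)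
  have hn := T.ch_nodup hu _ h.2
  obtain ⟨s, t, a1, a2, a3, a4, a5, t', b1, b2, b3⟩ := T.ch_start _ _ _ _ _ h.2
  obtain ⟨R, c1, c2⟩ := ch_split _ _ h.2
  refine ⟨c2.1.1, c2.2.2.1.1, c2.2.2.2.1.symm, ?_, ?_⟩
  · rintro rfl
    have := (List.nodup_append.1 (by simpa using hn)).2.1
    simp at this
  · have ht : t + t' = 1 := by
      have h5 : (1:ℝ) • (A q - A p) = (t + t') • (A q - A p) := by
        rw [one_smul]; nth_rewrite 1 [b3]; abel
      exact (smul_left_injective ℝ hu h5).symm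
    have := b2 (by simp)
    rw [a5]
    exact isE_side A h.1 (by linarith) (by linarith)
theorem nv_two {X : Pt} {i j : Fin 11} {k : Fin 3} (hij : i ≠ j) (hi : B i k = X) (hj : B j k = X) :
    2 ≤ nv B X k := by
  unfold nv
  rw [Nat.succ_le_iff, Finset.one_lt_card]
  exact ⟨i, by simpa using hi, j, by simpa using hj, hij⟩
theorem nv_one {X : Pt} {i : Fin 11} {k : Fin 3} (hi : B i k = X) : 1 ≤ nv B X k := by
  rw [← hi]; exact nv_pos i k
def cnt (w : Wd) (k : Fin 3) : ℕ := w.countP fun e => th e.2.1 e.2.2 = k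
theorem wlen_cnt (L : Fin 3 → ℝ) (w : Wd) :
    wlen L w = cnt w 0 * L 0 + cnt w 1 * L 1 + cnt w 2 * L 2 := by
  induction w with
  | nil => simp [wlen, cnt]
  | cons e w ih =>
    have h1 : wlen L (e :: w) = L (th e.2.1 e.2.2) + wlen L w := by simp [wlen]
    rw [h1, ih]
    simp only [cnt, List.countP_cons]
    generalize th e.2.1 e.2.2 = k
    fin_cases k <;> simp <;> ring
theorem cnt_sum (w : Wd) : cnt w 0 + cnt w 1 + cnt w 2 = w.length := by
  induction w with
  | nil => simp [cnt]
  | cons e w ih =>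
    simp only [cnt, List.countP_cons, List.length_cons] at ih ⊢
    generalize th e.2.1 e.2.2 = k
    fin_cases k <;> simp <;> omega
theorem vang_any (b : AB) {k l m : Fin 3} (h1 : l ≠ k) (h2 : m ≠ k) (h3 : l ≠ m) :
    ∠ (b l) (b k) (b m) = vang b k := by
  have : (l = k + 1 ∧ m = k + 2) ∨ (l = k + 2 ∧ m = k + 1) := by revert k l m; decide
  rcases this with ⟨rfl, rfl⟩ | ⟨rfl, rfl⟩
  · rfl
  · rw [EuclideanGeometry.angle_comm]; rfl
def xlen (b : AB) (k : Fin 3) : ℝ := dist (b (k+1)) (b (k+2))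
theorem xlen_th (b : AB) {l m : Fin 3} (hlm : l ≠ m) : dist (b l) (b m) = xlen b (th l m) :=
  dist_th (f := xlen b) (fun _ => rfl) hlm
theorem xlen_pos (b : AB) (k : Fin 3) : 0 < xlen b k :=
  dist_pos.2 (ab_ne _ (by revert k; decide))
theorem law_sines (b : AB) : ∃ c : ℝ, 0 < c ∧ ∀ k, xlen b k = c * sin (vang b k) := by
  have key : ∀ j k, j ≠ k → sin (vang b j) * xlen b k = sin (vang b k) * xlen b j := by
    intro j k hjk
    have h := EuclideanGeometry.law_sin (b k) (b j) (b (th j k))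
    rw [vang_any b hjk.symm (th_ne_l hjk) (th_ne_m hjk).symm,
      vang_any b (th_ne_m hjk) hjk (th_ne_l hjk)] at h
    rw [xlen_th b (th_ne_l hjk).symm, xlen_th b (th_ne_m hjk)] at h
    have e1 : th j (th j k) = k := by clear * - hjk; revert j k; decide
    have e2 : th (th j k) k = j := by clear * - hjk; revert j k; decide
    rw [e1, e2] at h
    exact h
  refine ⟨xlen b 0 / sin (vang b 0), div_pos (xlen_pos b 0) (vang_sin_pos b 0), fun k => ?_⟩
  have := vang_sin_pos b 0
  by_cases hk : k = 0
  · subst hk; field_simp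
  · have := key k 0 hk
    field_simp; linarith
theorem ar_eq (b : AB) {c : ℝ} (h : ∀ k, xlen b k = c * sin (vang b k)) :
    ar b = c ^ 2 * (sin (vang b 0) * sin (vang b 1) * sin (vang b 2)) := by
  unfold ar
  rw [xlen_th b (by decide : (1 : Fin 3) ≠ 0), xlen_th b (by decide : (2 : Fin 3) ≠ 0)]
  have e1 : th 1 0 = 2 := by decide
  have e2 : th 2 0 = 1 := by decide
  rw [e1, e2, h, h]; ring
theorem Tl.bdata (T : Tl A B θ L) : ∃ c C : ℝ, 0 < c ∧ 0 < C ∧ (∀ k, L k = c * sin (θ k)) ∧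
    (∀ m, xlen A m = C * sin (vang A m)) ∧
    C ^ 2 * (sin (vang A 0) * sin (vang A 1) * sin (vang A 2)) =
      11 * (c ^ 2 * (sin (θ 0) * sin (θ 1) * sin (θ 2))) := by
  obtain ⟨c, hc, h1⟩ := law_sines (B 0)
  obtain ⟨C, hC, h2⟩ := law_sines A
  have h3 : ∀ k, L k = c * sin (θ k) := by
    intro k
    have := h1 k
    rw [T.ang] at this
    rw [← this]; exact (T.len 0 k).symm
  refine ⟨c, C, hc, hC, h3, h2, ?_⟩
  have h4 := ar_sum A B T.mem T.dis
  have h5 : ∀ i, ar (B i) = c ^ 2 * (sin (θ 0) * sin (θ 1) * sin (θ 2)) := by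
    intro i
    have : ∀ k, xlen (B i) k = c * sin (vang (B i) k) := by
      intro k
      rw [T.ang, ← h3]; exact T.len i k
    rw [ar_eq _ this, T.ang, T.ang, T.ang]
  rw [ar_eq A h2] at h4
  rw [← h4]
  simp [h5]
theorem Tl.relabel (T : Tl A B θ L) (σ : Fin 11 → Equiv.Perm (Fin 3)) {θ' L' : Fin 3 → ℝ}
    (h1 : ∀ i k, θ' k = θ ((σ i).symm k)) (h2 : ∀ i k, L' k = L ((σ i).symm k)) :
    Tl A (fun i => (B i).reindex (σ i)) θ' L' := by
  have hc : ∀ i k X, ((B i).reindex (σ i)).coord k X = (B i).coord ((σ i).symm k) X := by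
    intro i k X; simp
  have ht : ∀ (s : Equiv.Perm (Fin 3)) (k : Fin 3), th (s (k+1)) (s (k+2)) = s k := by decide
  have hi : ∀ i X, isI ((B i).reindex (σ i)) X ↔ isI (B i) X := by
    intro i X
    unfold isI
    simp only [hc]
    exact ⟨fun h k => by simpa using h (σ i k), fun h k => h _⟩
  refine ⟨?_, ?_, ?_, ?_⟩
  · intro i k
    rw [h1 i, ← T.ang i]
    unfold vang
    simp only [AffineBasis.coe_reindex, Function.comp_apply]
    rw [vang_any]
    · rfl
    all_goals
      intro h
      have := (σ i).symm.injective h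
      revert this; clear * -; revert k; decide
  · intro i k
    rw [h2 i]
    simp only [AffineBasis.coe_reindex, Function.comp_apply]
    rw [dist_th (T.len i), ht]
    intro h
    have := (σ i).symm.injective h
    revert this; clear * -; revert k; decide
  · intro X
    rw [T.mem]
    simp only [hc]
    refine exists_congr fun i => ?_
    exact ⟨fun h k => h _, fun h k => by simpa using h (σ i k)⟩
  · intro i j X a b
    exact T.dis i j X ((hi i X).1 a) ((hi j X).1 b)
theorem Tl.relabelA (T : Tl A B θ L) (σ : Equiv.Perm (Fin 3)) : Tl (A.reindex σ) B θ L := by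
  refine ⟨T.ang, T.len, ?_, T.dis⟩
  intro X
  rw [← T.mem]
  simp only [AffineBasis.coord_reindex]
  exact ⟨fun h k => by simpa using h (σ k), fun h k => h _⟩
def kap (A : AB) (B : Fin 11 → AB) (k : Fin 3) : ℕ := nv B (A 0) k + nv B (A 1) k + nv B (A 2) k
theorem Tl.kap_eq (T : Tl A B θ L) : kap A B 0 * θ 0 + kap A B 1 * θ 1 + kap A B 2 * θ 2 = π := by
  have h0 := T.corner 0
  have h1 := T.corner 1
  have h2 := T.corner 2
  have h3 := vang_sum A
  rw [Fin.sum_univ_three] at h0 h1 h2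
  unfold kap
  push_cast
  linarith
theorem nv_le (X : Pt) (k : Fin 3) : nv B X k ≤ 11 := by
  unfold nv
  exact (Finset.card_le_univ _).trans (by simp)
def VV (B : Fin 11 → AB) : Finset Pt := Finset.univ.image fun q : Fin 11 × Fin 3 => B q.1 q.2
theorem sum_VV (B : Fin 11 → AB) (k : Fin 3) : ∑ X ∈ VV B, nv B X k = 11 := by
  have := Finset.card_eq_sum_card_fiberwise (s := (Finset.univ : Finset (Fin 11))) (t := VV B)
    (f := fun i => B i k) (fun i _ => by
      simp only [VV, Finset.coe_image]
      exact ⟨(i, k), by simp, rfl⟩)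
  simp only [Finset.card_univ, Fintype.card_fin] at this
  exact this.symm
theorem Tl.corner_mem (T : Tl A B θ L) (m : Fin 3) : ∃ i k, B i k = A m := by
  by_contra hc
  push Not at hc
  have h := T.corner m
  have : ∀ k, nv B (A m) k = 0 := by
    intro k
    unfold nv
    rw [Finset.card_eq_zero, Finset.filter_eq_empty_iff]
    exact fun i _ => hc i k
  simp [this] at h
  linarith [vang_pos A m]
theorem Tl.sum_split (T : Tl A B θ L) (f : Pt → ℝ) : ∑ X ∈ VV B, f X =
    ∑ X ∈ VV B \ Finset.univ.image A, f X + (f (A 0) + f (A 1) + f (A 2)) := by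
  have hsub : Finset.univ.image A ⊆ VV B := by
    intro X hX
    simp only [Finset.mem_image, Finset.mem_univ, true_and] at hX
    obtain ⟨m, rfl⟩ := hX
    obtain ⟨i, k, h⟩ := T.corner_mem m
    simp only [VV, Finset.mem_image, Finset.mem_univ, true_and]
    exact ⟨(i, k), h⟩
  rw [← Finset.sum_sdiff hsub, Finset.sum_image (fun a _ b _ h => A.ind.injective h), Fin.sum_univ_three]
theorem kap_le (T : Tl A B θ L) (k : Fin 3) : kap A B k ≤ 11 := by
  have h1 := T.sum_split (fun X => (nv B X k : ℝ))
  have h2 : (∑ X ∈ VV B, (nv B X k : ℝ)) = 11 := by exact_mod_cast sum_VV B k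
  have h3 : 0 ≤ ∑ X ∈ VV B \ Finset.univ.image A, (nv B X k : ℝ) := Finset.sum_nonneg fun _ _ => Nat.cast_nonneg _
  have : (kap A B k : ℝ) ≤ 11 := by unfold kap; push_cast; linarith
  exact_mod_cast this
theorem Tl.surplus (T : Tl A B θ L) (hk : ¬ (kap A B 0 = 1 ∧ kap A B 1 = 1 ∧ kap A B 2 = 1)) :
    ∃ (v : Fin 3 → ℕ) (w : ℕ), (w = 1 ∨ w = 2) ∧ (∀ k, v k ≤ 11) ∧
      v 0 * θ 0 + v 1 * θ 1 + v 2 * θ 2 = w * π ∧ (w < v 2 ∨ (v 2 = w ∧ w < v 1)) := by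
  by_contra hc
  push Not at hc
  have hw : ∀ X ∈ VV B \ Finset.univ.image A, ∃ w : ℕ, (w = 1 ∨ w = 2) ∧
      nv B X 0 * θ 0 + nv B X 1 * θ 1 + nv B X 2 * θ 2 = w * π := by
    intro X hX
    simp only [VV, Finset.mem_sdiff, Finset.mem_image, Finset.mem_univ, true_and] at hX
    obtain ⟨⟨⟨i, k⟩, rfl⟩, h2⟩ := hX
    rcases cases_mem (T.vmem i k) with h | h | h
    · exact absurd h h2
    · refine ⟨1, Or.inl rfl, ?_⟩
      have := T.straight i k h
      rw [Fin.sum_univ_three] at this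
      simpa using this
    · rcases T.inner i k h with h | h
      · refine ⟨1, Or.inl rfl, ?_⟩
        rw [Fin.sum_univ_three] at h
        simpa using h
      · refine ⟨2, Or.inr rfl, ?_⟩
        rw [Fin.sum_univ_three] at h
        simpa using h
  have hpi := Real.pi_pos
  let w : Pt → ℝ := fun X => (nv B X 0 * θ 0 + nv B X 1 * θ 1 + nv B X 2 * θ 2) / π
  set D := VV B \ Finset.univ.image A
  have hκ := T.kap_eq
  have s : ∀ k, ∑ X ∈ D, (nv B X k : ℝ) = 11 - kap A B k := by
    intro k
    have h1 := T.sum_split (fun X => (nv B X k : ℝ))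
    have h2 : (∑ X ∈ VV B, (nv B X k : ℝ)) = 11 := by exact_mod_cast sum_VV B k
    unfold kap; push_cast; linarith
  have sw : ∑ X ∈ D, w X = 10 := by
    have : ∑ X ∈ D, w X = ((∑ X ∈ D, (nv B X 0 : ℝ)) * θ 0 + (∑ X ∈ D, (nv B X 1 : ℝ)) * θ 1 +
        (∑ X ∈ D, (nv B X 2 : ℝ)) * θ 2) / π := by
      simp only [w]
      rw [Finset.sum_mul, Finset.sum_mul, Finset.sum_mul, ← Finset.sum_add_distrib,
        ← Finset.sum_add_distrib, Finset.sum_div]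
    rw [this, s, s, s, div_eq_iff hpi.ne']
    have := T.sum
    linear_combination 11 * this - hκ
  have hwX : ∀ X ∈ D, ∃ w' : ℕ, (w' = 1 ∨ w' = 2) ∧ w X = w' ∧
      nv B X 0 * θ 0 + nv B X 1 * θ 1 + nv B X 2 * θ 2 = w' * π := by
    intro X hX
    obtain ⟨w', h1, h2⟩ := hw X hX
    refine ⟨w', h1, ?_, h2⟩
    simp only [w]; rw [h2]; field_simp
  have kk := hc (fun k => kap A B k) 1 (Or.inl rfl) (fun k => kap_le T k) (by simpa using hκ)
  have hX2 : ∀ X ∈ D, (nv B X 2 : ℝ) ≤ w X := by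
    intro X hX
    obtain ⟨w', h1, h2, h3⟩ := hwX X hX
    rw [h2]
    exact_mod_cast (hc (fun k => nv B X k) w' h1 (fun k => nv_le X k) h3).1
  have k2 : (kap A B 2 : ℝ) ≤ 1 := by exact_mod_cast kk.1
  have e2 : ∑ X ∈ D, (nv B X 2 : ℝ) = ∑ X ∈ D, w X := by
    apply le_antisymm (Finset.sum_le_sum hX2)
    rw [s, sw]; linarith
  have hX2' := (Finset.sum_eq_sum_iff_of_le hX2).1 e2
  have k2' : (kap A B 2 : ℝ) = 1 := by rw [s, sw] at e2; linarith
  have k2n : kap A B 2 = 1 := by exact_mod_cast k2'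
  have hX1 : ∀ X ∈ D, (nv B X 1 : ℝ) ≤ w X := by
    intro X hX
    obtain ⟨w', h1, h2, h3⟩ := hwX X hX
    have := hX2' X hX
    rw [h2] at this ⊢
    exact_mod_cast (hc (fun k => nv B X k) w' h1 (fun k => nv_le X k) h3).2 (by exact_mod_cast this)
  have k1 : (kap A B 1 : ℝ) ≤ 1 := by exact_mod_cast kk.2 k2n
  have e1 : ∑ X ∈ D, (nv B X 1 : ℝ) = ∑ X ∈ D, w X := by
    apply le_antisymm (Finset.sum_le_sum hX1)
    rw [s, sw]; linarith
  have k1' : (kap A B 1 : ℝ) = 1 := by rw [s, sw] at e1; linarith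
  have k0' : (kap A B 0 : ℝ) = 1 := by
    have := T.sum
    rw [k1', k2'] at hκ
    have h0 := T.pos 0
    apply mul_right_cancel₀ h0.ne'
    linarith
  exact hk ⟨by exact_mod_cast k0', by exact_mod_cast k1', k2n⟩
end
section
open Filter Topology
variable {A : AB} {B : Fin 11 → AB} {θ L : Fin 3 → ℝ}
theorem nv_uniq {X : Pt} {i j : Fin 11} {k : Fin 3} (h : nv B X k ≤ 1) (hi : B i k = X) (hj : B j k = X) : i = j := by
  by_contra hc
  have := nv_two hc hi hj
  omega
theorem side_first {p q : Fin 3} {i l m w} (h : IsSide A B p q ((i,l,m)::w)) :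
    l ≠ m ∧ B i l = A p ∧ ∃ s : ℝ, 0 < s ∧ B i m = A p + s • (A q - A p) := by
  obtain ⟨hpq, hE, e, h⟩ := h
  refine ⟨hE.1, e, _, ?_, e ▸ hE.step⟩
  have := hE.2.2.2
  positivity
theorem side_last {p q : Fin 3} {i l m w} (h : IsSide A B p q (w ++ [(i,l,m)])) : l ≠ m ∧ B i m = A q := by
  obtain ⟨hpq, h⟩ := h
  obtain ⟨Q, _, h2⟩ := ch_split _ _ h
  exact ⟨h2.1.1, h2.2.2⟩
theorem Tl.corner1 {p q r : Fin 3} (hqr : q ≠ r) {i l m w j l' m' w'}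
    (h : IsSide A B p q ((i,l,m)::w)) (h' : IsSide A B p r ((j,l',m')::w'))
    {k : Fin 3} (hk : nv B (A p) k = 1) (hk' : ∀ k', k' ≠ k → nv B (A p) k' = 0) :
    i = j ∧ l = k ∧ l' = k ∧ m ≠ k ∧ m' ≠ k ∧ m ≠ m' := by
  obtain ⟨a1, a2, s, a3, a4⟩ := side_first h
  obtain ⟨b1, b2, t, b3, b4⟩ := side_first h'
  have e1 : l = k := by
    by_contra hc
    have := nv_one a2; have := hk' l hc; omega
  have e2 : l' = k := by
    by_contra hc
    have := nv_one b2; have := hk' l' hc; omega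
  subst e1; subst e2
  have e3 := nv_uniq hk.le a2 b2
  subst e3
  refine ⟨rfl, rfl, rfl, a1.symm, b1.symm, ?_⟩
  rintro rfl
  have c1 := (coord_side A h.1 s).2.1
  have c2 := (coord_side A h'.1 t).2.2
  have c3 := (coord_side A h'.1 t).1
  rw [← a4] at c1
  have hq : th p r = q := by
    have := h.1; have := h'.1; clear * - hqr this h; 
    have h1 := h.1
    clear h
    revert p q r; decide
  rw [← b4, hq] at c2
  linarith
theorem Tl.pig (T : Tl A B θ L) {k : Fin 3} (hs : ∀ i j, isE A (B i j) → nv B (B i j) k ≤ 1) {p q : Fin 3} {w : Wd}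
    (h : IsSide A B p q w) (hp : nv B (A p) k = 0) (hq : nv B (A q) k = 0) : 1 ≤ cnt w k := by
  by_contra hc
  have hc : cnt w k = 0 := by omega
  have ht : ∀ e ∈ w, th e.2.1 e.2.2 ≠ k := by
    intro e he hk
    have : 0 < cnt w k := List.countP_pos_iff.2 ⟨e, he, by simpa using hk⟩
    omega
  have key : ∀ (w2 w1 : Wd) (i l m), w = w1 ++ (i,l,m) :: w2 → l ≠ k → False := by
    intro w2
    induction w2 with
    | nil =>
      intro w1 i l m e hl
      have h0 := ht (i,l,m) (by simp [e])
      rw [e] at h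
      obtain ⟨hlm, h2⟩ := side_last h
      have hm : m = k := by rcases th_cases hlm k with r | r | r <;> simp_all
      rw [hm] at h2
      have := nv_one h2; omega
    | cons e' w2 ih =>
      intro w1 i l m e hl
      obtain ⟨j, l', m'⟩ := e'
      have h0 := ht (i,l,m) (by simp [e])
      have h' := h
      rw [e] at h'
      obtain ⟨hlm, -, h2, hij, hE⟩ := T.side_vert h'
      have hm : m = k := by rcases th_cases hlm k with r | r | r <;> simp_all
      refine ih (w1 ++ [(i,l,m)]) j l' m' (by simp [e]) ?_
      rintro rfl
      rw [hm] at h2 hE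
      have := nv_two hij rfl h2.symm
      have := hs _ _ hE
      omega
  rcases w with _ | ⟨⟨i, l, m⟩, w⟩
  · exact h.ne_nil rfl
  · refine key w [] i l m rfl ?_
    rintro rfl
    have := nv_one (side_first h).2.1
    omega
def Sgl (L : Fin 3 → ℝ) (k : Fin 3) : Prop := ∀ f : Fin 3 → ℕ, f 0 * L 0 + f 1 * L 1 + f 2 * L 2 = L k → f k ≠ 0
theorem wlen_nonneg (T : Tl A B θ L) (w : Wd) : 0 ≤ wlen L w := by
  rw [wlen_cnt]
  have := T.lpos 0; have := T.lpos 1; have := T.lpos 2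
  positivity
theorem wlen_zero (T : Tl A B θ L) {w : Wd} (h : wlen L w ≤ 0) : w = [] := by
  rcases w with _ | ⟨e, w⟩
  · rfl
  · have h1 := wlen_nonneg T w
    have h2 := T.lpos (th e.2.1 e.2.2)
    simp only [wlen, List.map_cons, List.sum_cons] at *
    linarith
theorem sgl_word (T : Tl A B θ L) {k : Fin 3} (hk : Sgl L k) {w : Wd} (h : wlen L w = L k) :
    ∃ i l m, w = [(i,l,m)] ∧ th l m = k := by
  have h1 := hk (cnt w) (by rw [← wlen_cnt, h])
  have h2 : 0 < cnt w k := Nat.pos_of_ne_zero h1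
  obtain ⟨⟨i, l, m⟩, he, hek⟩ := List.countP_pos_iff.1 h2
  have hek : th l m = k := by simpa using hek
  obtain ⟨w1, w2, rfl⟩ := List.append_of_mem he
  have e1 : wlen L (w1 ++ (i,l,m) :: w2) = wlen L w1 + (L (th l m) + wlen L w2) := by simp [wlen]
  rw [e1, hek] at h
  have := wlen_nonneg T w1
  have := wlen_nonneg T w2
  rw [wlen_zero T (w := w1) (by linarith), wlen_zero T (w := w2) (by linarith)]
  exact ⟨i, l, m, rfl, hek⟩
theorem lin_on (b : AB) {l m : Fin 3} (hlm : l ≠ m) : lin b (th l m) (b l - b (th l m)) = -1 := by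
  rw [lin_sub, coord_vert, coord_vert, if_neg (th_ne_l hlm), if_pos rfl]; ring
theorem Tl.opp (T : Tl A B θ L) (i : Fin 11) {l m : Fin 3} (hlm : l ≠ m)
    (hb : ∀ k, 0 < A.coord k (B i l) ∨ 0 < A.coord k (B i m))
    (HV : Blk B (B i m - B i l) (B i l - B i (th l m)) (B i l))
    (HW : Blk B (B i m - B i l) (B i l - B i (th l m)) (B i m)) :
    ∃ w, IsCh B (B i m - B i l) (B i l - B i (th l m)) w (B i l) (B i m) ∧ wlen L w = L (th l m) := by
  have hu : B i m - B i l ≠ 0 := sub_ne_zero.2 (ab_ne _ hlm.symm)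
  obtain ⟨w, hw⟩ := T.chain (n := B i l - B i (th l m)) hu (fun v => by
      obtain ⟨s, t, e⟩ := span_side (B i) hlm v
      refine ⟨s, -t, ?_⟩
      rw [e]; module)
    (fun k => ⟨T.vmem _ _ _, T.vmem _ _ _, fun h1 h2 => by
      rcases hb k with h | h <;> linarith⟩)
    (fun t h0 h1 j => T.noI_of_E (i := i) (isE_side (B i) hlm h0 h1)) HV HW
  refine ⟨w, hw, ?_⟩
  obtain ⟨t, _, _, e1, e2⟩ := T.ch_len w hw
  have ht : t = 1 := by
    have : (t - 1) • (B i m - B i l) = 0 := by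
      have : B i m - B i l = t • (B i m - B i l) := by
        nth_rewrite 1 [e1]; abel
      rw [sub_smul, ← this, one_smul, sub_self]
    rcases smul_eq_zero.1 this with h | h
    · linarith
    · exact absurd h hu
  rw [← e2, ht, one_mul, ← dist_eq_norm, dist_comm]
  exact dist_th (T.len i) hlm
theorem Tl.opp1 (T : Tl A B θ L) (i : Fin 11) {l m : Fin 3} (hlm : l ≠ m)
    (hb : ∀ k, 0 < A.coord k (B i l) ∨ 0 < A.coord k (B i m))
    (HV : Blk B (B i m - B i l) (B i l - B i (th l m)) (B i l))
    (HW : Blk B (B i m - B i l) (B i l - B i (th l m)) (B i m)) (hS : Sgl L (th l m)) :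
    ∃ j, j ≠ i ∧ 0 < lin (B j) (th l m) (B i l - B i (th l m)) ∧ ((B j l = B i l ∧ B j m = B i m) ∨ (B j m = B i l ∧ B j l = B i m)) := by
  obtain ⟨w, hw, e⟩ := T.opp i hlm hb HV HW
  obtain ⟨j, l', m', rfl, e2⟩ := sgl_word T hS e
  obtain ⟨⟨h1, h2, h3, h4⟩, h5, h6⟩ := hw
  rw [e2] at h3
  have h6 : B j m' = B i m := h6
  refine ⟨j, ?_, h3, ?_⟩
  · rintro rfl
    rw [lin_on _ hlm] at h3
    linarith
  · have : (l' = l ∧ m' = m) ∨ (l' = m ∧ m' = l) := by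
      clear * - h1 hlm e2; revert l m l' m'; decide
    rcases this with ⟨rfl, rfl⟩ | ⟨rfl, rfl⟩
    · exact Or.inl ⟨h5, h6⟩
    · exact Or.inr ⟨h5, h6⟩
theorem Tl.blk_bd (T : Tl A B θ L) {i : Fin 11} {k : Fin 3} {u n : Pt} (h : ¬ isI A (B i k)) : Blk B u n (B i k) :=
  blk_of_noE fun j => T.noE i j k h
theorem Tl.blk_E (T : Tl A B θ L) {i j : Fin 11} {k c : Fin 3} {u n : Pt} (h0 : (B j).coord c (B i k) = 0)
    (h1 : ∀ l, l ≠ c → 0 < (B j).coord l (B i k)) (hu : lin (B j) c u ≠ 0) : Blk B u n (B i k) := by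
  intro i' k' e1 _ e2 e3
  have : j = i' := T.oneE ⟨c, h0, h1⟩ ⟨k', e2, e3⟩
  subst this
  have : k' = c := by
    by_contra hc
    have := h1 k' hc
    linarith
  subst this
  exact hu e1
theorem not_I_of_E {b : AB} {X : Pt} (h : isE b X) : ¬ isI b X := fun h' => not_E_of_I h' h
theorem not_all_zero (b : AB) (f : Pt →ₗ[ℝ] ℝ) (hf : f ≠ 0) (k : Fin 3) (h1 : f (b (k+1) - b k) = 0) (h2 : f (b (k+2) - b k) = 0) :
    False := by
  apply hf
  ext v
  rw [dec_lin b k v]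
  simp [h1, h2]
theorem Tl.side_edge (T : Tl A B θ L) {p q : Fin 3} {w w' : Wd} {i l m}
    (h : IsSide A B p q (w ++ (i, l, m) :: w')) : l ≠ m ∧ A.coord (th p q) (B i l) = 0 ∧ A.coord (th p q) (B i m) = 0 ∧
      0 < A.coord (th p q) (B i (th l m)) ∧ ∃ s t : ℝ, s < t ∧ B i l = A p + s • (A q - A p) ∧ B i m = A p + t • (A q - A p) := by
  obtain ⟨hpq, h⟩ := h
  obtain ⟨Q, h1, h2⟩ := ch_split _ _ h
  have hlm := h2.1.1
  obtain ⟨s, t, s0, st, _, e1, e2, _⟩ := T.ch_start _ _ _ _ _ h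
  have c1 := (coord_side A hpq s).2.2
  have c2 := (coord_side A hpq t).2.2
  rw [← e1] at c1
  rw [← e2] at c2
  refine ⟨hlm, c1, c2, lt_of_le_of_ne (T.vmem _ _ _) fun h0 => ?_, s, t, st, e1, e2⟩
  have : ∀ k, A.coord (th p q) (B i k) = 0 := by
    intro k
    rcases th_cases hlm k with rfl | rfl | rfl
    · exact c1
    · exact c2
    · exact h0.symm
  refine not_all_zero (B i) (lin A (th p q)) (fun hf => ?_) 0 ?_ ?_
  · have := lin_sub A (th p q) (A p) (A (th p q))
    rw [hf, coord_vert, coord_vert, if_pos rfl, if_neg (th_ne_l hpq)] at this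
    simp at this
  · rw [lin_sub, this, this, sub_self]
  · rw [lin_sub, this, this, sub_self]
theorem Tl.next (T : Tl A B θ L) {p q : Fin 3} {w w' : Wd} {i k l j l' m'}
    (h : IsSide A B p q (w ++ (i, k, l) :: (j, l', m') :: w')) (hS : Sgl L k)
    (HW : ∀ n, Blk B (B i (th k l) - B i l) n (B i (th k l)))
    (hD : ¬ (2 ≤ nv B (B i l) l ∧ 2 ≤ nv B (B i (th k l)) (th k l)))
    (h1 : 1 ≤ nv B (B i l) l → 1 ≤ nv B (B i l) (th k l) → ∀ c, nv B (B i l) c = 1) : l' = k := by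
  obtain ⟨hkl, hl'm', hV, hij, hE⟩ := T.side_vert h
  obtain ⟨-, c1, c2, c3, s, t, hst, e1, e2⟩ := T.side_edge h
  have h' : IsSide A B p q ((w ++ [(i, k, l)]) ++ (j, l', m') :: w') := by simpa using h
  obtain ⟨-, d1, d2, d3, s', t', hst', f1, f2⟩ := T.side_edge h'
  set m := th k l with hm
  have hlm : l ≠ m := (th_ne_m hkl).symm
  have hmk : m ≠ k := th_ne_l hkl
  have hk : th l m = k := by rw [hm]; clear * - hkl; revert k l; decide
  obtain ⟨r, hri, hrn, hr⟩ := T.opp1 i hlm (fun c => by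
      obtain ⟨c0, g0, g1⟩ := hE
      by_cases hc : c = c0
      · have : th p q = c0 := by
          by_contra hne; have := g1 _ hne; linarith
        rw [hc, ← this]; exact Or.inr c3
      · exact Or.inl (g1 c hc)) (T.blk_bd (not_I_of_E hE)) (HW _) (hk.symm ▸ hS)
  have hr : B r m = B i l ∧ B r l = B i m := by
    rcases hr with ⟨r1, r2⟩ | hr
    · exact absurd ⟨nv_two hri.symm rfl r1, nv_two hri.symm rfl r2⟩ hD
    · exact hr
  have hn := h1 (nv_one rfl) (nv_one hr.1)
  rcases th_cases hkl l' with hc | hc | hc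
  · exact hc
  · rw [hc] at hV
    exact absurd (nv_uniq (hn l).le rfl hV.symm) hij
  · exfalso
    rw [← hm] at hc
    clear_value m
    have hrj : r = j := nv_uniq (hn m).le hr.1 (hc ▸ hV.symm)
    subst hrj; subst l'
    have hm'l : l ≠ m' := by
      rintro rfl
      rw [hr.2] at d2; linarith
    have a1 : ∠ (B i k) (B i l) (B r m') = π := by
      have hs' : B i l = B i k + ((t - s) / (t' - s)) • (B r m' - B i k) := by
        rw [f2, e1, e2]
        have : s' = t := by
          have h3 : A p + s' • (A q - A p) = A p + t • (A q - A p) := by rw [← f1, ← e2, hV]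
          have h4 : (s' - t) • (A q - A p) = 0 := by
            have := add_left_cancel h3
            rw [sub_smul, this, sub_self]
          rcases smul_eq_zero.1 h4 with h | h
          · linarith
          · exact absurd (sub_eq_zero.1 h) (ab_ne _ h'.1.symm)
        have hne : t' - s ≠ 0 := by linarith
        have : A p + t • (A q - A p) = A p + s • (A q - A p) + ((t - s) / (t' - s) * (t' - s)) • (A q - A p) := by
          rw [div_mul_cancel₀ _ hne]; module
        rw [this]; module
      have : s' = t := by
        have h3 : A p + s' • (A q - A p) = A p + t • (A q - A p) := by rw [← f1, ← e2, hV]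
        have h4 : (s' - t) • (A q - A p) = 0 := by
          have := add_left_cancel h3
          rw [sub_smul, this, sub_self]
        rcases smul_eq_zero.1 h4 with h | h
        · linarith
        · exact absurd (sub_eq_zero.1 h) (ab_ne _ h'.1.symm)
      have hsb : Sbtw ℝ (B i k) (B i l) (B r m') := by
        refine ⟨⟨(t - s) / (t' - s), ⟨by apply div_nonneg <;> linarith, by rw [div_le_one] <;> linarith⟩, ?_⟩, ab_ne _ hkl.symm, ?_⟩
        · rw [hs', AffineMap.lineMap_apply]; simp [add_comm]
        · rw [hV]; exact ab_ne _ hl'm'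
      exact hsb.angle₁₂₃_eq_pi
    have a2 := angle_add_angle_eq_pi_of_angle_eq_pi (B i m) a1
    have a3 : ∠ (B i m) (B i l) (B i k) = θ l := by
      rw [vang_any _ hlm.symm hkl hmk, T.ang]
    have a4 : ∠ (B i m) (B i l) (B r m') = θ m := by
      rw [← hr.1, ← hr.2, vang_any _ hlm hl'm'.symm hm'l, T.ang]
    rw [a3, a4] at a2
    have := T.pos k
    have s3 := sum_three' θ hkl
    rw [T.sum, ← hm] at s3
    linarith
end
section
def frc {α : Type} (n : ℕ) (f : ℕ → α) : α := Nat.rec (f 0) (fun m _ => f (Nat.succ m)) n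
theorem frc_eq {α : Type} (n : ℕ) (f : ℕ → α) : frc n f = f n := by cases n <;> rfl
abbrev Iv := ℕ × ℕ
def SC : ℕ := 1073741824
def Iv.has (I : Iv) (x : ℝ) : Prop := (I.1 : ℝ) ≤ SC * x ∧ SC * x ≤ I.2
def mk2 (x y : ℕ) : Iv := frc x fun l => frc y fun h => (l, h)
theorem mk2_eq (x y : ℕ) : mk2 x y = (x, y) := by simp [mk2, frc_eq]
def iA (a b : Iv) : Iv := mk2 (Nat.add a.1 b.1) (Nat.add a.2 b.2)
def iM (a b : Iv) : Iv := mk2 (Nat.div (Nat.mul a.1 b.1) SC) (Nat.succ (Nat.div (Nat.mul a.2 b.2) SC))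
def iS (a b : Iv) : Iv := mk2 (Nat.sub a.1 b.2) (Nat.sub a.2 b.1)
def iK (k : ℕ) : Iv := frc (Nat.mul k SC) fun l => (l, l)
theorem iA_eq (a b : Iv) : iA a b = (a.1 + b.1, a.2 + b.2) := mk2_eq _ _
theorem iM_eq (a b : Iv) : iM a b = (a.1 * b.1 / SC, a.2 * b.2 / SC + 1) := mk2_eq _ _
theorem iS_eq (a b : Iv) : iS a b = (a.1 - b.2, a.2 - b.1) := mk2_eq _ _
theorem iK_eq (k : ℕ) : iK k = (k * SC, k * SC) := frc_eq _ _
theorem SC_pos : (0:ℝ) < SC := by norm_num [SC]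
theorem Iv.has.nn {I : Iv} {x : ℝ} (h : I.has x) : 0 ≤ x := by
  have h1 := h.1
  have : (0:ℝ) ≤ I.1 := Nat.cast_nonneg _
  have := SC_pos
  by_contra hc
  push Not at hc
  nlinarith
theorem has_A {a b : Iv} {x y : ℝ} (hx : a.has x) (hy : b.has y) : (iA a b).has (x + y) := by
  simp only [iA_eq, Iv.has] at *
  push_cast; constructor <;> linarith [hx.1, hx.2, hy.1, hy.2]
theorem has_S {a b : Iv} {x y : ℝ} (hx : a.has x) (hy : b.has y) (h : y ≤ x) : (iS a b).has (x - y) := by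
  simp only [iS_eq, Iv.has] at *
  have := SC_pos
  constructor
  · rcases le_total a.1 b.2 with h' | h'
    · rw [Nat.sub_eq_zero_of_le h']; push_cast; nlinarith
    · rw [Nat.cast_sub h']; linarith [hx.1, hy.2]
  · have : (a.2 : ℝ) - b.1 ≤ (a.2 - b.1 : ℕ) := by
      have : a.2 ≤ (a.2 - b.1) + b.1 := by omega
      have : (a.2 : ℝ) ≤ ((a.2 - b.1 : ℕ) : ℝ) + b.1 := by exact_mod_cast this
      linarith
    linarith [hx.2, hy.1]
theorem has_M {a b : Iv} {x y : ℝ} (hx : a.has x) (hy : b.has y) : (iM a b).has (x * y) := by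
  have nx := hx.nn
  have ny := hy.nn
  simp only [iM_eq, Iv.has] at *
  have hs := SC_pos
  obtain ⟨x1, x2⟩ := hx
  obtain ⟨y1, y2⟩ := hy
  have a0 : (0:ℝ) ≤ a.1 := Nat.cast_nonneg _
  have b0 : (0:ℝ) ≤ b.1 := Nat.cast_nonneg _
  have p1 := mul_le_mul x1 y1 b0 (by positivity)
  have p2 := mul_le_mul x2 y2 (by positivity) (Nat.cast_nonneg _)
  constructor
  · have h1 : (a.1 * b.1 / SC) * SC ≤ a.1 * b.1 := Nat.div_mul_le_self _ _
    have h2 : ((a.1 * b.1 / SC : ℕ) : ℝ) * SC ≤ a.1 * b.1 := by exact_mod_cast h1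
    have : ((a.1 * b.1 / SC : ℕ) : ℝ) * SC ≤ (SC * (x * y)) * SC := by linarith
    exact le_of_mul_le_mul_right this hs
  · have h1 : a.2 * b.2 ≤ (a.2 * b.2 / SC + 1) * SC := by
      have := Nat.lt_div_mul_add (a := a.2 * b.2) (b := SC) (by norm_num [SC])
      rw [add_mul, one_mul]; omega
    have h2 : (a.2 : ℝ) * b.2 ≤ (a.2 * b.2 / SC + 1 : ℕ) * SC := by exact_mod_cast h1
    have : (SC * (x * y)) * SC ≤ (a.2 * b.2 / SC + 1 : ℕ) * (SC : ℝ) := by linarith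
    exact le_of_mul_le_mul_right this hs
theorem has_K (k : ℕ) : (iK k).has k := by
  simp only [iK_eq, Iv.has]; push_cast; constructor <;> linarith
theorem le_sq' {x y : ℝ} (h : x ^ 2 ≤ y ^ 2) (_ : 0 ≤ x) (hy : 0 ≤ y) : x ≤ y := (abs_le.1 (abs_le_of_sq_le_sq h hy)).2
def nw (V x : ℕ) (f : ℕ) : ℕ := Nat.rec x
  (fun _ ih => frc ih fun y => Nat.div (Nat.add y (Nat.div V y)) 2) f
def isq (V : ℕ) : ℕ := Nat.succ (nw V (Nat.pow 2 (Nat.succ (Nat.div (Nat.log2 V) 2))) 5)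
def sqI (l h : ℕ) : Iv :=
  frc (isq h) fun t => cond (Nat.ble h (Nat.mul t t)) (mk2 (Nat.div l t) t) (0, h)
theorem sqI_eq (l h : ℕ) : sqI l h = if h ≤ isq h * isq h then (l / isq h, isq h) else (0, h) := by
  simp only [sqI, frc_eq, mk2_eq, Bool.cond_eq_ite, Nat.ble_eq, Nat.mul_eq]; rfl
theorem sqI_has {l h : ℕ} {X : ℝ} (hX : 0 ≤ X) (h1 : (l : ℝ) ≤ (SC * X) ^ 2) (h2 : (SC * X) ^ 2 ≤ h) :
    (sqI l h).has X := by
  have hs := SC_pos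
  rw [sqI_eq]
  have hY : 0 ≤ SC * X := by positivity
  split_ifs with c
  · have c' : (h : ℝ) ≤ ((isq h : ℕ) : ℝ) * (isq h : ℕ) := by exact_mod_cast c
    have hle : SC * X ≤ (isq h : ℕ) := le_sq' (by nlinarith) (by positivity) (by positivity)
    refine ⟨?_, hle⟩
    have e : ((l / isq h : ℕ) : ℝ) * (isq h : ℕ) ≤ l := by exact_mod_cast Nat.div_mul_le_self _ _
    show ((l / isq h : ℕ) : ℝ) ≤ SC * X
    by_contra hc
    push Not at hc
    have t0 : (0:ℝ) < (isq h : ℕ) := by exact_mod_cast Nat.succ_pos _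
    have := mul_lt_mul_of_pos_right hc t0
    have := mul_le_mul_of_nonneg_left hle hY
    nlinarith
  · refine ⟨by simpa using hY, ?_⟩
    show SC * X ≤ (h : ℝ)
    rcases Nat.eq_zero_or_pos h with rfl | hp
    · simp at c
    · have h3 : (1:ℝ) ≤ h := by exact_mod_cast hp
      exact le_sq' (by nlinarith) (by positivity) (by positivity)
def sdI (N D : Iv) : Iv :=
  cond (Nat.beq D.1 0) (0, 100 * SC)
  (frc (Nat.div (Nat.mul (Nat.mul (Nat.mul 11 N.1) SC) SC) D.2) fun l =>
   frc (Nat.succ (Nat.div (Nat.mul (Nat.mul (Nat.mul 11 N.2) SC) SC) D.1)) fun h => sqI l h)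
theorem sdI_eq (N D : Iv) : sdI N D = if D.1 = 0 then (0, 100 * SC) else
    sqI (11 * N.1 * SC * SC / D.2) (11 * N.2 * SC * SC / D.1 + 1) := by
  simp only [sdI, frc_eq, Bool.cond_eq_ite, Nat.beq_eq]; rfl
theorem sdI_has {N D : Iv} {ν δ X : ℝ} (hN : N.has ν) (hD : D.has δ) (hX : 0 ≤ X) (hX' : X ≤ 100)
    (h : X ^ 2 * δ = 11 * ν) : (sdI N D).has X := by
  have hs := SC_pos
  rw [sdI_eq]
  split_ifs with c
  · constructor
    · simp; positivity
    · push_cast; nlinarith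
  · have nN := hN.nn
    have nD := hD.nn
    obtain ⟨n1, n2⟩ := hN
    obtain ⟨d1, d2⟩ := hD
    have d0 : (0:ℝ) < D.1 := by exact_mod_cast Nat.pos_of_ne_zero c
    have dp : 0 < δ := by
      rcases nD.eq_or_lt with h | h
      · rw [← h] at d1; linarith
      · exact h
    have d20 : (0:ℝ) < D.2 := by nlinarith
    have d2n : 0 < D.2 := by exact_mod_cast d20
    have d1n : 0 < D.1 := Nat.pos_of_ne_zero c
    have key : (SC * X) ^ 2 * (SC * δ) = 11 * (SC * ν) * SC * SC := by
      linear_combination (SC:ℝ) ^ 3 * h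
    apply sqI_has hX
    · have h1 : (11 * N.1 * SC * SC / D.2) * D.2 ≤ 11 * N.1 * SC * SC := Nat.div_mul_le_self _ _
      have h2 : ((11 * N.1 * SC * SC / D.2 : ℕ) : ℝ) * D.2 ≤ 11 * N.1 * SC * SC := by exact_mod_cast h1
      have h3 : (11:ℝ) * N.1 * SC * SC ≤ (SC * X) ^ 2 * (SC * δ) := by rw [key]; gcongr
      have h4 : (SC * X) ^ 2 * (SC * δ) ≤ (SC * X) ^ 2 * D.2 := by gcongr
      exact le_of_mul_le_mul_right (by linarith) d20
    · have h1 : 11 * N.2 * SC * SC ≤ (11 * N.2 * SC * SC / D.1 + 1) * D.1 := by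
        have := Nat.lt_div_mul_add (a := 11 * N.2 * SC * SC) d1n
        rw [add_mul, one_mul]; omega
      have h2 : (11:ℝ) * N.2 * SC * SC ≤ (11 * N.2 * SC * SC / D.1 + 1 : ℕ) * D.1 := by exact_mod_cast h1
      have h3 : (SC * X) ^ 2 * (SC * δ) ≤ (11:ℝ) * N.2 * SC * SC := by rw [key]; gcongr
      have h4 : (SC * X) ^ 2 * D.1 ≤ (SC * X) ^ 2 * (SC * δ) := by gcongr
      exact le_of_mul_le_mul_right (by linarith) d0
def aF (g : ℕ → Bool) (lo n : ℕ) : Bool := Nat.rec true (fun k ih => cond (g (Nat.add lo k)) ih false) n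
theorem aF_sound {g : ℕ → Bool} {lo p : ℕ} : ∀ n, aF g lo n = true → lo ≤ p → p < lo + n → g p = true
  | 0, _, _, _ => by omega
  | n+1, h, h1, h2 => by
    have h' : cond (g (lo + n)) (aF g lo n) false = true := h
    rw [Bool.cond_false_right, Bool.and_eq_true] at h'
    rcases Nat.lt_or_ge p (lo + n) with c | c
    · exact aF_sound n h'.2 h1 c
    · rw [show p = lo + n by omega]; exact h'.1
def cP (a : Iv) (X : Iv) (g : ℕ → Bool) (m ql qh : ℕ) : Bool :=
  frc (Nat.div (Nat.sub (Nat.add (Nat.sub X.1 qh) a.2) 1) a.2) fun lo =>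
  frc (cond (Nat.beq a.1 0) m (frc (Nat.div (Nat.sub X.2 ql) a.1) fun z => cond (Nat.ble m z) m z)) fun hi =>
    aF g lo (Nat.sub (Nat.succ hi) lo)
theorem cP_eq (a : Iv) (X : Iv) (g : ℕ → Bool) (m ql qh : ℕ) : cP a X g m ql qh =
    aF g ((X.1 - qh + a.2 - 1) / a.2) ((if a.1 = 0 then m else min m ((X.2 - ql) / a.1)) + 1 -
      ((X.1 - qh + a.2 - 1) / a.2)) := by
  simp only [cP, frc_eq, Bool.cond_eq_ite, Nat.beq_eq, Nat.ble_eq, min_def]; rfl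
def cQ (a b X : Iv) (g : ℕ → ℕ → Bool) (rl rh : ℕ) (f : ℕ) : ℕ → Bool := Nat.rec (fun _ => true)
  (fun f ih q => frc (Nat.add rl (Nat.mul q b.1)) fun ql => cond (Nat.ble ql X.2)
      (frc (Nat.add rh (Nat.mul q b.2)) fun qh => cond (cP a X (fun p => g p q) f ql qh) (ih (Nat.succ q)) false) true) f
theorem cQ_succ (a b X : Iv) (g : ℕ → ℕ → Bool) (rl rh f q : ℕ) : cQ a b X g rl rh (f+1) q =
   if rl + q * b.1 ≤ X.2 then (cP a X (fun p => g p q) f (rl + q * b.1) (rh + q * b.2) && cQ a b X g rl rh f (q+1)) else true := by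
  have h : cQ a b X g rl rh (f+1) q = cond (Nat.ble (rl + q * b.1) X.2)
     (cond (cP a X (fun p => g p q) f (rl + q * b.1) (rh + q * b.2)) (cQ a b X g rl rh f (q+1)) false) true := by
    simp only [cQ, frc_eq]; rfl
  rw [h, Bool.cond_false_right, Bool.cond_eq_ite]; simp only [Nat.ble_eq]
def cR (a b c X : Iv) (g : ℕ → ℕ → ℕ → Bool) (f : ℕ) : ℕ → Bool := Nat.rec (fun _ => true)
  (fun f ih r => frc (Nat.mul r c.1) fun rl => cond (Nat.ble rl X.2)
      (frc (Nat.mul r c.2) fun rh => cond (cQ a b X (fun p q => g p q r) rl rh (Nat.succ f) 0) (ih (Nat.succ r)) false) true) f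
theorem cR_succ (a b c X : Iv) (g : ℕ → ℕ → ℕ → Bool) (f r : ℕ) : cR a b c X g (f+1) r =
   if r * c.1 ≤ X.2 then (cQ a b X (fun p q => g p q r) (r * c.1) (r * c.2) (f+1) 0 && cR a b c X g f (r+1)) else true := by
  have h : cR a b c X g (f+1) r = cond (Nat.ble (r * c.1) X.2)
     (cond (cQ a b X (fun p q => g p q r) (r * c.1) (r * c.2) (f+1) 0) (cR a b c X g f (r+1)) false) true := by
    simp only [cR, frc_eq]; rfl
  rw [h, Bool.cond_false_right, Bool.cond_eq_ite]; simp only [Nat.ble_eq]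
theorem cP_mem {a X : Iv} {α x : ℝ} (ha : a.has α) (hX : X.has x) {g : ℕ → Bool} {m ql qh p : ℕ} {y : ℝ}
    (h1 : (ql : ℝ) ≤ SC * y) (h2 : SC * y ≤ qh) (hp : p ≤ m) (hx : x = p * α + y) (hα : 0 < α)
    (H : cP a X g m ql qh = true) : g p = true := by
  have hs := SC_pos
  rw [cP_eq] at H
  obtain ⟨a1, a2⟩ := ha
  obtain ⟨x1, x2⟩ := hX
  have a20 : (0:ℝ) < a.2 := by nlinarith
  have a2n : 0 < a.2 := by exact_mod_cast a20
  have p0 : (0:ℝ) ≤ p := Nat.cast_nonneg _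
  have L1 : X.1 ≤ p * a.2 + qh := by
    have : (X.1 : ℝ) ≤ p * a.2 + qh := by
      calc (X.1 : ℝ) ≤ SC * x := x1
        _ = p * (SC * α) + SC * y := by rw [hx]; ring
        _ ≤ _ := by gcongr
    exact_mod_cast this
  have L2 : p * a.1 + ql ≤ X.2 := by
    have : (p * a.1 + ql : ℝ) ≤ X.2 := by
      calc (p * a.1 + ql : ℝ) ≤ p * (SC * α) + SC * y := by gcongr
        _ = SC * x := by rw [hx]; ring
        _ ≤ _ := x2
    exact_mod_cast this
  have L3 : (X.1 - qh + a.2 - 1) / a.2 ≤ p := by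
    apply Nat.le_of_lt_succ
    rw [Nat.div_lt_iff_lt_mul a2n, Nat.succ_eq_add_one, add_mul]
    omega
  have L4 : p ≤ if a.1 = 0 then m else min m ((X.2 - ql) / a.1) := by
    split_ifs with c
    · exact hp
    · refine le_min hp ?_
      rw [Nat.le_div_iff_mul_le (Nat.pos_of_ne_zero c)]; omega
  exact aF_sound _ H L3 (by omega)
theorem cQ_mem {a b X : Iv} {α β x : ℝ} (ha : a.has α) (hb : b.has β) (hX : X.has x) (hα : 0 < α)
    {g : ℕ → ℕ → Bool} {rl rh p q : ℕ} {y : ℝ} (h1 : (rl : ℝ) ≤ SC * y) (h2 : SC * y ≤ rh)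
    (hx : x = p * α + q * β + y) :
    ∀ (f q0 : ℕ), q0 ≤ q → p + q < f + q0 → cQ a b X g rl rh f q0 = true → g p q = true
  | 0, q0, h, h', _ => by omega
  | f+1, q0, h, h', H => by
    have hs := SC_pos
    have p0 : (0:ℝ) ≤ p := Nat.cast_nonneg _
    rw [cQ_succ, if_pos, Bool.and_eq_true] at H
    · rcases h.eq_or_lt with rfl | h
      · apply cP_mem ha hX (y := q0 * β + y) ?_ ?_ (by omega) (by rw [hx]; ring) hα H.1
        · have := mul_le_mul_of_nonneg_left hb.1 (Nat.cast_nonneg q0)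
          push_cast; linarith
        · have := mul_le_mul_of_nonneg_left hb.2 (Nat.cast_nonneg q0)
          push_cast; linarith
      · exact cQ_mem ha hb hX hα h1 h2 hx f (q0+1) h (by omega) H.2
    · have e1 := mul_le_mul_of_nonneg_left hb.1 (Nat.cast_nonneg q0)
      have e2 : (q0:ℝ) ≤ q := by exact_mod_cast h
      have e3 := mul_le_mul_of_nonneg_right e2 (mul_nonneg hs.le hb.nn)
      have e4 : 0 ≤ p * (SC * α) := by positivity
      have e5 : SC * x = p * (SC * α) + q * (SC * β) + SC * y := by rw [hx]; ring
      have : ((rl + q0 * b.1 : ℕ) : ℝ) ≤ X.2 := by push_cast; linarith [hX.2]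
      exact_mod_cast this
theorem cR_mem {a b c X : Iv} {α β γ x : ℝ} (ha : a.has α) (hb : b.has β) (hc : c.has γ) (hX : X.has x) (hα : 0 < α)
    {g : ℕ → ℕ → ℕ → Bool} {p q r : ℕ} (hx : x = p * α + q * β + r * γ) :
    ∀ (f r0 : ℕ), r0 ≤ r → p + q + r < f + r0 → cR a b c X g f r0 = true → g p q r = true
  | 0, r0, h, h', _ => by omega
  | f+1, r0, h, h', H => by
    have hs := SC_pos
    rw [cR_succ, if_pos, Bool.and_eq_true] at H
    · rcases h.eq_or_lt with rfl | h
      · apply cQ_mem ha hb hX hα (g := fun p q => g p q r0) (y := r0 * γ) ?_ ?_ hx _ _ (Nat.zero_le _) (by omega) H.1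
        · have := mul_le_mul_of_nonneg_left hc.1 (Nat.cast_nonneg r0)
          push_cast; linarith
        · have := mul_le_mul_of_nonneg_left hc.2 (Nat.cast_nonneg r0)
          push_cast; linarith
      · exact cR_mem ha hb hc hX hα hx f (r0+1) h (by omega) H.2
    · have e1 := mul_le_mul_of_nonneg_left hc.1 (Nat.cast_nonneg r0)
      have e2 : (r0:ℝ) ≤ r := by exact_mod_cast h
      have e3 := mul_le_mul_of_nonneg_right e2 (mul_nonneg hs.le hc.nn)
      have nb := hb.nn
      have e4 : 0 ≤ p * (SC * α) + q * (SC * β) := by positivity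
      have e5 : SC * x = p * (SC * α) + q * (SC * β) + r * (SC * γ) := by rw [hx]; ring
      have : ((r0 * c.1 : ℕ) : ℝ) ≤ X.2 := by push_cast; linarith [hX.2]
      exact_mod_cast this
def bis (f : Iv → Bool) (d : ℕ) : ℕ → ℕ → Bool := Nat.rec (fun l h => f (l, h))
  (fun _ ih l h => cond (f (l, h)) true (frc (Nat.div (Nat.add l h) 2) fun m => cond (ih l m) (ih m h) false)) d
theorem bis_succ (f : Iv → Bool) (d l h : ℕ) : bis f (d+1) l h =
    (f (l, h) || (bis f d l ((l + h) / 2) && bis f d ((l + h) / 2) h)) := by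
  rw [← Bool.cond_false_right, ← Bool.cond_true_left]
  simp only [bis, frc_eq]; rfl
theorem bis_sound {f : Iv → Bool} {x : ℝ} : ∀ (d l h : ℕ), bis f d l h = true → Iv.has (l, h) x →
    ∃ I : Iv, I.has x ∧ f I = true
  | 0, l, h, H, hx => ⟨_, hx, H⟩
  | d+1, l, h, H, hx => by
    simp only [bis_succ, Bool.or_eq_true, Bool.and_eq_true] at H
    rcases H with H | ⟨H1, H2⟩
    · exact ⟨_, hx, H⟩
    · rcases le_total (SC * x) ((l + h) / 2 : ℕ) with c | c
      · exact bis_sound d _ _ H1 ⟨hx.1, c⟩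
      · exact bis_sound d _ _ H2 ⟨c, hx.2⟩
def cd (a b c N D : Iv) (r0 : ℕ) (g : ℕ → ℕ → ℕ → Bool) : Bool := cR a b c (sdI N D) g (Nat.sub 12 r0) r0
theorem cd_mem {a b c N D : Iv} {α β γ ν δ : ℝ} (ha : a.has α) (hb : b.has β) (hc : c.has γ) (hN : N.has ν)
    (hD : D.has δ) (hα : 0 < α) {p q r r0 : ℕ} {g : ℕ → ℕ → ℕ → Bool} (H : cd a b c N D r0 g = true)
    (hr : r0 ≤ r) (hs : p + q + r ≤ 11)
    (hX : (p * α + q * β + r * γ : ℝ) ^ 2 * δ = 11 * ν) (h100 : (p * α + q * β + r * γ : ℝ) ≤ 100) :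
    g p q r = true := by
  have nb := hb.nn
  have nc := hc.nn
  exact cR_mem ha hb hc (sdI_has hN hD (by positivity) h100 hX) hα rfl _ _ hr
    (by show p + q + r < (12 - r0) + r0; omega) H
def c2 (a b c N1 D1 N2 D2 : Iv) (r0 : ℕ) (ok : ℕ → ℕ → ℕ → ℕ → ℕ → ℕ → Bool) : Bool :=
  cd a b c N1 D1 r0 fun p q r => cd a b c N2 D2 r0 fun p' q' r' => ok p q r p' q' r'
def no3 (_ _ _ : ℕ) : Bool := false
def c3 (a b c N1 D1 N2 D2 N3 D3 : Iv) (r0 : ℕ) : Bool :=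
  cond (cd a b c N1 D1 r0 no3) true (cond (cd a b c N2 D2 r0 no3) true (cd a b c N3 D3 r0 no3))
def fR1 (t : Iv) : Bool :=
  let q := iM t t
  let b := iS q (iK 1)
  c2 (iK 1) b t b (iK 1) (iM b q) (iK 1) 1 fun p q r p' q' r' => decide (((p,q,r),(p',q',r')) ∈
    [((1,0,1),(1,1,1)), ((2,0,1),(1,1,2)), ((1,0,2),(2,2,1)), ((3,0,1),(1,1,3))])
theorem fR1_ok : bis fR1 12 SC (2 * SC) = true := by decide +kernel
def fR2 (t : Iv) : Bool :=
  let q := iM t t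
  let a := iS (iK 1) q
  let c := iA (iK 1) q
  c2 a (iA t t) c (iM c c) (iK 2) (iM (iK 2) (iM a a)) (iK 1) 0 fun p q r p' q' r' => decide ((p,q,r) = (11,0,0) ∧ (p',q',r') = (0,0,1))
theorem fR2_ok : bis fR2 16 0 SC = true := by decide +kernel
def fR30 (s : Iv) : Bool :=
  let q := iM s s
  let a := iS (iK 1) q
  let d2 := iS (iK 2) q
  c2 a s (iK 1) a d2 (iM a d2) (iK 1) 1 fun p q r p' q' r' => decide (((p,q,r),(p',q',r')) ∈ [((0,0,1),(1,0,1)),((0,0,2),(2,0,2))])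
theorem fR30_ok : bis fR30 18 0 SC = true := by decide +kernel
def fR31 (s : Iv) : Bool :=
  let q := iM s s
  let a := iS (iK 1) q
  let d2 := iS (iK 2) q
  let d3 := iS (iK 3) q
  c3 a s (iK 1) (iK 1) (iM d2 d3) d2 d3 (iM (iM a a) d3) d2 1
theorem fR31_ok : bis fR31 16 0 SC = true := by decide +kernel
def fR32 (s : Iv) : Bool :=
  let q := iM s s
  let a := iS (iK 1) q
  c2 a s (iK 1) (iM a q) (iK 1) a (iK 1) 1 fun _ _ _ _ _ _ => false
theorem fR32_ok : bis fR32 16 0 SC = true := by decide +kernel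
def fR33 (s : Iv) : Bool :=
  let q := iM s s
  let a := iS (iK 1) q
  let d2 := iS (iK 2) q
  c3 a s (iK 1) (iM q d2) (iK 1) (iM a a) d2 (iK 1) d2 1
theorem fR33_ok : bis fR33 16 0 SC = true := by decide +kernel
def fR34 (s : Iv) : Bool :=
  let q := iM s s
  let a := iS (iK 1) q
  let d3 := iS (iK 3) q
  c2 a s (iK 1) (iM q d3) (iK 1) (iK 1) d3 1 fun p q r p' q' r' =>
    decide (((p,q,r) = (1,2,1) ∨ (p,q,r) = (1,0,2)) ∧ ((p',q',r') = (0,2,1) ∨ (p',q',r') = (0,0,2)))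
theorem fR34_ok : bis fR34 18 0 SC = true := by decide +kernel
def fR4 (k : ℕ) (t : Iv) : Bool :=
  let q := iM t t
  let a := iS (iK 1) q
  let b := iA (iA t t) q
  let c := iA (iA (iK 1) t) q
  let s := iA a b
  let A := iA a s
  let B := iA s b
  let cc := iM c c
  match k with
  | 0 => c2 a b c (iM a cc) A (iM a A) (iK 1) 1 fun _ _ _ _ _ _ => false
  | 1 => c3 a b c (iM cc cc) (iM (iK 3) (iM A s)) (iM cc A) (iM (iK 3) s) (iM (iK 3) (iM (iM a a) s)) A 1
  | 2 => c3 a b c (iM a (iM b b)) s (iM a cc) s (iM a s) (iK 1) 1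
  | 3 => c3 a b c (iM (iM b b) cc) (iM s B) (iM s cc) B (iM (iM a a) B) s 1
  | _ => c3 a b c (iM (iM b b) A) B (iM cc cc) (iM A B) (iM (iM a a) B) A 1
theorem fR40_ok : bis (fR4 0) 18 0 SC = true := by decide +kernel
theorem fR41_ok : bis (fR4 1) 18 0 SC = true := by decide +kernel
theorem fR42_ok : bis (fR4 2) 18 0 SC = true := by decide +kernel
theorem fR43_ok : bis (fR4 3) 18 0 SC = true := by decide +kernel
theorem fR44_ok : bis (fR4 4) 18 0 SC = true := by decide +kernel
def tab : List (ℕ × List ℕ) := [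
  (3, [101]),
  (4, [101]),
  (5, [101, 102]),
  (6, [101, 102]),
  (7, [101, 102, 103, 202]),
  (8, [101, 102, 103, 203]),
  (9, [101, 102, 103, 104, 203]),
  (10, [101, 102, 103, 104, 203, 303]),
  (11, [101, 102, 103, 104, 105, 203, 204]),
  (12, [101, 102, 103, 104, 105, 203, 205, 304]),
  (13, [101, 102, 104, 105, 106, 203, 205]),
  (14, [101, 102, 104, 105, 106, 205]),
  (15, [101, 102, 104, 105, 106, 107, 203, 205, 206, 304, 305, 405]),
  (16, [101, 102, 105, 106, 107, 205, 207, 405]),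
  (17, [101, 102, 105, 106, 107, 108, 205, 207]),
  (18, [101, 102, 105, 106, 107, 108, 207, 304, 305, 307]),
  (19, [101, 102, 106, 107, 108, 109, 205, 207, 208]),
  (20, [101, 102, 106, 107, 108, 109, 207, 209, 407, 507]),
  (21, [101, 102, 106, 107, 108, 109, 110, 205, 207, 209, 304, 305, 307, 308]),
  (22, [101, 102, 107, 108, 109, 110, 209]),
  (23, [102, 107, 108, 109, 110, 207, 209, 210]),
  (24, [102, 107, 108, 109, 110, 305, 307, 308, 310, 409]),
  (25, [102, 108, 109, 110, 111, 207, 209, 211]),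
  (26, [102, 108, 109, 110, 111]),
  (27, [102, 108, 109, 110, 111, 207, 209, 211, 212, 307, 308, 310, 311]),
  (28, [102, 109, 110, 111, 112, 411]),
  (29, [102, 109, 110, 111, 112, 209, 211, 213]),
  (30, [102, 109, 110, 111, 112, 307, 308, 310, 311, 313]),
  (31, [102, 110, 111, 112, 113, 209, 211, 213, 214]),
  (32, [102, 110, 111, 112, 113, 413]),
  (33, [102, 110, 111, 112, 113, 211, 213, 215, 308, 310, 311, 313, 314]),
  (34, [112, 113, 114]),
  (35, [112, 113, 114, 213, 215, 216]),
  (36, [113, 114, 415]),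
  (37, [113, 114, 115, 215, 217]),
  (38, [114, 115]),
  (39, [114, 115, 217, 218]),
  (40, [115, 116, 417]),
  (41, [115, 116, 219]),
  (42, [116]),
  (43, [116, 117, 220]),
  (44, [117, 419]),
  (45, [117]),
  (46, [118]),
  (47, [118]),
  (49, [119])]
def tiles : List (ℕ × List (ℕ × ℕ)) := tab.map fun s => (s.1, s.2.map fun x => (x / 100, x % 100))
def iD (a : Iv) (k : ℕ) : Iv := mk2 (Nat.div a.1 k) (Nat.succ (Nat.div a.2 k))
theorem iD_eq (a : Iv) (k : ℕ) : iD a k = (a.1 / k, a.2 / k + 1) := mk2_eq _ _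
def piN : ℕ := 314159265358979
def piD : ℕ := 100000000000000
def snx (x : Iv) : Iv :=
  let q := iM x x
  let x3 := iD (iM x q) 6
  let x5 := iD (iM x3 q) 20
  let x7 := iD (iM x5 q) 42
  let x9 := iD (iM x7 q) 72
  let x11 := iD (iM x9 q) 110
  let x13 := iD (iM x11 q) 156
  let x15 := iD (iM x13 q) 210
  let r := iS (iA (iA x x5) (iA x9 x13)) (iA (iA x3 x7) (iA x11 x15))
  mk2 (Nat.sub r.1 1) (Nat.succ r.2)
def sn (n j : ℕ) : Iv :=
  frc (cond (Nat.ble j (Nat.sub n j)) j (Nat.sub n j)) fun j =>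
  frc (Nat.div (Nat.mul (Nat.mul SC piN) j) (Nat.mul piD n)) fun l => snx (l, Nat.add l 2)
def ded (a b c x y z : Iv) : Bool :=
  cond (Nat.ble 1 (Nat.mul y.1 z.1))
  (frc (Nat.div (Nat.mul (Nat.mul (Nat.mul (Nat.mul 11 a.1) b.1) c.1) x.1) (Nat.mul y.2 z.2)) fun l =>
  frc (Nat.succ (Nat.div (Nat.mul (Nat.mul (Nat.mul (Nat.mul 11 a.2) b.2) c.2) x.2) (Nat.mul y.1 z.1))) fun h =>
    cR a b c (sqI l h) no3 12 0) false
def num (n i j : ℕ) : Bool :=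
  aF (fun A => aF (fun B => cond (Nat.ble B (Nat.sub (Nat.sub n A) B))
     (ded (sn n i) (sn n j) (sn n (Nat.sub (Nat.sub n i) j)) (sn n A) (sn n B) (sn n (Nat.sub (Nat.sub n A) B))) true)
     A (Nat.div n 2)) 1 (Nat.div n 3)
theorem num_ok : tiles.all (fun s => s.2.all fun t => num s.1 t.1 t.2) = true := by decide +kernel
theorem has_D {a : Iv} {x : ℝ} (hx : a.has x) (k : ℕ) (hk : 0 < k) : (iD a k).has (x / k) := by
  have hs := SC_pos
  have k0 : (0:ℝ) < k := by exact_mod_cast hk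
  rw [iD_eq]
  obtain ⟨h1, h2⟩ := hx
  constructor
  · show ((a.1 / k : ℕ) : ℝ) ≤ _
    rw [← mul_div_assoc, le_div_iff₀ k0]
    have : ((a.1 / k : ℕ) : ℝ) * k ≤ a.1 := by exact_mod_cast Nat.div_mul_le_self _ _
    linarith
  · show _ ≤ ((a.2 / k + 1 : ℕ) : ℝ)
    rw [← mul_div_assoc, div_le_iff₀ k0]
    have : a.2 ≤ (a.2 / k + 1) * k := by
      have := Nat.lt_div_mul_add (a := a.2) hk
      rw [add_mul, one_mul]; omega
    have : (a.2 : ℝ) ≤ (a.2 / k + 1 : ℕ) * k := by exact_mod_cast this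
    linarith
def P15 (x : ℝ) : ℝ := x - x^3/6 + x^5/120 - x^7/5040 + x^9/362880 - x^11/39916800 + x^13/6227020800 - x^15/1307674368000
theorem sin_P15 {x : ℝ} (h0 : 0 ≤ x) (h1 : x ≤ 1.6) : |sin x - P15 x| ≤ 1 / 10 ^ 10 := by
  have hb := Complex.exp_bound' (x := (x : ℂ) * Complex.I) (n := 17) (by
    rw [norm_mul, Complex.norm_I, Complex.norm_real, Real.norm_of_nonneg h0]; norm_num; linarith)
  rw [norm_mul, Complex.norm_I, Complex.norm_real, Real.norm_of_nonneg h0, mul_one] at hb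
  have him := (Complex.abs_im_le_norm _).trans hb
  have e : (Complex.exp ((x:ℂ) * Complex.I) - ∑ m ∈ Finset.range 17, ((x:ℂ) * Complex.I)^m / (m.factorial : ℂ)).im = sin x - P15 x := by
    rw [Complex.sub_im, Complex.exp_ofReal_mul_I_im]
    congr 1
    have i2 : Complex.I ^ 2 = -1 := Complex.I_sq
    have : ∑ m ∈ Finset.range 17, ((x:ℂ) * Complex.I)^m / (m.factorial : ℂ) =
      ((1 - x^2/2 + x^4/24 - x^6/720+x^8/40320 - x^10/3628800+x^12/479001600-x^14/87178291200+x^16/20922789888000 : ℝ) : ℂ) + (P15 x : ℂ) * Complex.I := by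
      have i3 : Complex.I ^ 3 = -Complex.I := by rw [pow_succ, i2]; ring
      have i4 : Complex.I ^ 4 = 1 := Complex.I_pow_four
      have i5 : Complex.I ^ 5 = Complex.I := by rw [pow_succ, i4, one_mul]
      have i6 : Complex.I ^ 6 = -1 := by rw [pow_succ, i5, ← sq, i2]
      have i7 : Complex.I ^ 7 = -Complex.I := by rw [pow_succ, i6]; ring
      have i8 : Complex.I ^ 8 = 1 := by rw [pow_succ, i7, neg_mul, ← sq, i2]; ring
      have i9 : Complex.I ^ 9 = Complex.I := by rw [pow_succ, i8, one_mul]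
      have i10 : Complex.I ^ 10 = -1 := by rw [pow_succ, i9, ← sq, i2]
      have i11 : Complex.I ^ 11 = -Complex.I := by rw [pow_succ, i10]; ring
      have i12 : Complex.I ^ 12 = 1 := by rw [pow_succ, i11, neg_mul, ← sq, i2]; ring
      have i13 : Complex.I ^ 13 = Complex.I := by rw [pow_succ, i12, one_mul]
      have i14 : Complex.I ^ 14 = -1 := by rw [pow_succ, i13, ← sq, i2]
      have i15 : Complex.I ^ 15 = -Complex.I := by rw [pow_succ, i14]; ring
      have i16 : Complex.I ^ 16 = 1 := by rw [pow_succ, i15, neg_mul, ← sq, i2]; ring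
      simp only [Finset.sum_range_succ, Finset.sum_range_zero, mul_pow, i2, i3, i4, i5, i6, i7, i8, i9, i10, i11, i12, i13, i14, i15, i16, Nat.factorial]
      simp only [P15]
      push_cast
      ring
    rw [this]; simp [-Complex.ofReal_add, -Complex.ofReal_sub, Complex.ofReal_im]
  rw [e] at him
  refine him.trans ?_
  have : x ^ 17 ≤ 1.6 ^ 17 := by gcongr
  have : ((17:ℕ).factorial : ℝ) = 355687428096000 := by norm_num [Nat.factorial]
  rw [this, div_mul_eq_mul_div, div_le_iff₀ (by norm_num)]
  norm_num at *
  linarith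
theorem wid {J : Iv} {y s : ℝ} (r : J.has y) (e : |SC * s - SC * y| ≤ 1) (h : 0 ≤ s) :
    (mk2 (Nat.sub J.1 1) (Nat.succ J.2)).has s := by
  have e' := abs_le.1 e
  have sn0 : 0 ≤ SC * s := mul_nonneg SC_pos.le h
  obtain ⟨r1, r2⟩ := r
  rw [mk2_eq]
  constructor
  · show ((J.1 - 1 : ℕ) : ℝ) ≤ _
    rcases Nat.eq_zero_or_pos J.1 with h | h
    · rw [h]; simpa using sn0
    · rw [Nat.cast_sub h]; push_cast; linarith
  · show _ ≤ ((J.2 + 1 : ℕ) : ℝ)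
    push_cast
    linarith
theorem snx_has {I : Iv} {x : ℝ} (h : I.has x) (h1 : x ≤ 1.6) : (snx I).has (sin x) := by
  have h0 := h.nn
  have hq := has_M h h
  have q3 := has_D (has_M h hq) 6 (by norm_num)
  have q5 := has_D (has_M q3 hq) 20 (by norm_num)
  have q7 := has_D (has_M q5 hq) 42 (by norm_num)
  have q9 := has_D (has_M q7 hq) 72 (by norm_num)
  have q11 := has_D (has_M q9 hq) 110 (by norm_num)
  have q13 := has_D (has_M q11 hq) 156 (by norm_num)
  have q15 := has_D (has_M q13 hq) 210 (by norm_num)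
  have hxx : x * x ≤ 6 := by nlinarith
  have mono : ∀ y : ℝ, 0 ≤ y → ∀ k : ℕ, 6 ≤ k → y * (x * x) / k ≤ y := by
    intro y hy k hk
    have : (6:ℝ) ≤ k := by exact_mod_cast hk
    rw [div_le_iff₀ (by linarith)]
    exact mul_le_mul_of_nonneg_left (by linarith) hy
  have m1 := mono _ h0 6 (by norm_num)
  have m2 := mono _ q5.nn 42 (by norm_num)
  have m3 := mono _ q9.nn 110 (by norm_num)
  have m4 := mono _ q13.nn 210 (by norm_num)
  have r := has_S (has_A (has_A h q5) (has_A q9 q13)) (has_A (has_A q3 q7) (has_A q11 q15)) (by linarith)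
  have hs := SC_pos
  have hp := sin_P15 h0 h1
  rw [abs_le] at hp
  have e : ∀ y : ℝ, y = P15 x → |SC * sin x - SC * y| ≤ 1 := by
    rintro y rfl
    rw [← mul_sub, abs_mul, abs_of_pos hs]
    have := sin_P15 h0 h1
    have hsc : (SC:ℝ) = 1073741824 := by norm_num [SC]
    rw [hsc]; linarith
  refine wid r (e _ ?_) (sin_nonneg_of_nonneg_of_le_pi h0 (by linarith [pi_gt_three]))
  simp only [P15]; push_cast; ring
theorem sn_has {n j : ℕ} (hj : 0 < j) (hn : j < n) : (sn n j).has (sin (π * j / n)) := by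
  have hs := SC_pos
  have key : ∀ i : ℕ, 2 * i ≤ n → (snx (SC * piN * i / (piD * n), SC * piN * i / (piD * n) + 2)).has (sin (π * i / n)) := by
    intro i hi
    have n0 : (0:ℝ) < n := by exact_mod_cast (by omega : 0 < n)
    have hi' : (2 * i : ℝ) ≤ n := by exact_mod_cast hi
    have i0 : (0:ℝ) ≤ i := Nat.cast_nonneg _
    have d0 : (0:ℝ) < piD := by norm_num [piD]
    have pl : (piN : ℝ) / piD ≤ π := by have := pi_gt_d20; norm_num [piN, piD]; linarith
    have pu : π ≤ (piN : ℝ) / piD + 1 / 10^13 := by have := pi_lt_d20; norm_num [piN, piD]; linarith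
    have r1 : (i:ℝ) / n ≤ 1 := by rw [div_le_one n0]; linarith
    have r0 : 0 ≤ (i:ℝ) / n := by positivity
    apply snx_has
    · constructor
      · show ((SC * piN * i / (piD * n) : ℕ) : ℝ) ≤ _
        have : ((SC * piN * i / (piD * n) : ℕ) : ℝ) ≤ (SC * piN * i : ℕ) / (piD * n : ℕ) := Nat.cast_div_le
        refine this.trans ?_
        push_cast
        calc (SC * piN * i / (piD * n) : ℝ) = SC * ((piN:ℝ) / piD * (i / n)) := by field_simp
          _ ≤ SC * (π * (i / n)) := by gcongr
          _ = _ := by ring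
      · show _ ≤ ((SC * piN * i / (piD * n) + 2 : ℕ) : ℝ)
        have : (SC * piN * i : ℕ) / (piD * n : ℕ) ≤ ((SC * piN * i / (piD * n) : ℕ) : ℝ) + 1 := (Nat.lt_floor_add_one (_ : ℝ)).le.trans (by rw [Nat.floor_div_eq_div])
        have e : SC * (π * i / n) ≤ ((SC * piN * i : ℕ) : ℝ) / (piD * n : ℕ) + 1 := by
          push_cast
          calc SC * (π * i / n) = SC * (π * (i / n)) := by ring
            _ ≤ SC * (((piN : ℝ) / piD + 1 / 10^13) * (i / n)) := by gcongr
            _ = SC * piN * i / (piD * n) + SC * (1 / 10^13) * (i/n) := by field_simp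
            _ ≤ SC * piN * i / (piD * n) + 1 * 1 := by gcongr; norm_num [SC]
            _ = _ := by ring
        push_cast at *
        linarith
    · rw [mul_div_assoc]
      have : (i:ℝ) / n ≤ 1 / 2 := by rw [div_le_div_iff₀ n0 (by norm_num)]; linarith
      nlinarith [pi_lt_d2, pi_pos]
  have e : sn n j = if j ≤ n - j then snx (SC * piN * j / (piD * n), SC * piN * j / (piD * n) + 2) else
      snx (SC * piN * (n - j) / (piD * n), SC * piN * (n - j) / (piD * n) + 2) := by
    simp only [sn, frc_eq, Bool.cond_eq_ite, Nat.ble_eq, Nat.sub_eq]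
    split_ifs <;> rfl
  rw [e]
  split_ifs with c
  · exact key j (by omega)
  · have := key (n - j) (by omega)
    rw [Nat.cast_sub hn.le] at this
    have n0 : (n:ℝ) ≠ 0 := by exact_mod_cast (by omega : n ≠ 0)
    rwa [show π * ((n:ℝ) - j) / n = π - π * j / n by field_simp, sin_pi_sub] at this
theorem ded_sound {a b c x y z : Iv} {α β γ ξ η ζ : ℝ} (ha : a.has α) (hb : b.has β) (hc : c.has γ) (hx : x.has ξ)
    (hy : y.has η) (hz : z.has ζ) (h0 : 0 < α) (H : ded a b c x y z = true) {p q r : ℕ} (hp : p + q + r ≤ 11)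
    (h : (p * α + q * β + r * γ) ^ 2 * (η * ζ) = 11 * (α * β * γ * ξ)) : False := by
  have hs := SC_pos
  have nb := hb.nn
  have nc := hc.nn
  have nx := hx.nn
  have ny := hy.nn
  have nz := hz.nn
  simp only [ded, frc_eq, Bool.cond_eq_ite] at H
  split_ifs at H with c1
  rw [Nat.ble_eq] at c1
  have c1' : 0 < y.1 * z.1 := c1
  obtain ⟨y1, y2⟩ := hy
  obtain ⟨z1, z2⟩ := hz
  have yz : (0:ℝ) < (y.1 : ℝ) * z.1 := by exact_mod_cast c1'
  have yz1 : (y.1 : ℝ) * z.1 ≤ (SC * η) * (SC * ζ) := by gcongr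
  have yz2 : (SC * η) * (SC * ζ) ≤ (y.2 : ℝ) * z.2 := by gcongr
  have yzp : (0:ℝ) < (y.2 : ℝ) * z.2 := by linarith
  set X := p * α + q * β + r * γ with hX
  have X0 : 0 ≤ X := by positivity
  have key : (SC * X) ^ 2 * ((SC * η) * (SC * ζ)) = 11 * (SC * α) * (SC * β) * (SC * γ) * (SC * ξ) := by
    linear_combination (SC:ℝ)^4 * h
  have hXI : (sqI (11 * a.1 * b.1 * c.1 * x.1 / (y.2 * z.2)) (11 * a.2 * b.2 * c.2 * x.2 / (y.1 * z.1) + 1)).has X := by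
    apply sqI_has X0
    · have h2 : ((11 * a.1 * b.1 * c.1 * x.1 / (y.2 * z.2) : ℕ) : ℝ) * (y.2 * z.2) ≤ 11 * a.1 * b.1 * c.1 * x.1 := by
        exact_mod_cast Nat.div_mul_le_self _ _
      have h3 : (11 * a.1 * b.1 * c.1 * x.1 : ℝ) ≤ 11 * (SC * α) * (SC * β) * (SC * γ) * (SC * ξ) := by
        have := ha.1; have := hb.1; have := hc.1; have := hx.1
        gcongr
      have h4 : (SC * X) ^ 2 * ((SC * η) * (SC * ζ)) ≤ (SC * X) ^ 2 * (y.2 * z.2) := by gcongr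
      exact le_of_mul_le_mul_right (by linarith) yzp
    · have h1 : 11 * a.2 * b.2 * c.2 * x.2 ≤ (11 * a.2 * b.2 * c.2 * x.2 / (y.1 * z.1) + 1) * (y.1 * z.1) := by
        have := Nat.lt_div_mul_add (a := 11 * a.2 * b.2 * c.2 * x.2) c1'
        rw [add_mul, one_mul]; omega
      have h2 : (11 * a.2 * b.2 * c.2 * x.2 : ℝ) ≤ ((11 * a.2 * b.2 * c.2 * x.2 / (y.1 * z.1) + 1 : ℕ) : ℝ) * (y.1 * z.1) := by exact_mod_cast h1
      have h3 : 11 * (SC * α) * (SC * β) * (SC * γ) * (SC * ξ) ≤ (11 * a.2 * b.2 * c.2 * x.2 : ℝ) := by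
        have := ha.2; have := hb.2; have := hc.2; have := hx.2
        gcongr
      have h4 : (SC * X) ^ 2 * (y.1 * z.1) ≤ (SC * X) ^ 2 * ((SC * η) * (SC * ζ)) := by gcongr
      exact le_of_mul_le_mul_right (by linarith) yz
  have := cR_mem ha hb hc hXI h0 hX 12 0 (Nat.zero_le r) (by omega) H
  exact absurd this (by simp [no3])
def inT (n i j : ℕ) : Bool := tiles.any fun s => s.1 == n && s.2.any fun t => t.1 == i && t.2 == j
theorem num_sound {n i j k A B C : ℕ} (hT : inT n i j = true) (hi : 0 < i) (hj : 0 < j) (hk : 0 < k) (hn : i + j + k = n)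
    (hA : 0 < A) (hAB : A ≤ B) (hBC : B ≤ C) (hABC : A + B + C = n) {p q r : ℕ} (hp : p + q + r ≤ 11)
    (h : (p * sin (π * i / n) + q * sin (π * j / n) + r * sin (π * k / n)) ^ 2 * (sin (π * B / n) * sin (π * C / n))
     = 11 * (sin (π * i / n) * sin (π * j / n) * sin (π * k / n) * sin (π * A / n))) : False := by
  simp only [inT, List.any_eq_true, Bool.and_eq_true, beq_iff_eq] at hT
  obtain ⟨s, hs, rfl, t, ht, rfl, rfl⟩ := hT
  have H := num_ok
  simp only [List.all_eq_true] at H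
  have H := H s hs t ht
  unfold num at H
  have H := aF_sound (p := A) _ H (by omega) (by show A < 1 + s.1 / 3; omega)
  have H := aF_sound (p := B) _ H (by omega) (by show B < A + s.1 / 2; omega)
  have e1 : Nat.sub (Nat.sub s.1 A) B = C := by show s.1 - A - B = C; omega
  have e2 : Nat.sub (Nat.sub s.1 t.1) t.2 = k := by show s.1 - t.1 - t.2 = k; omega
  rw [e1, e2, Bool.cond_eq_ite, if_pos ((by rw [Nat.ble_eq]; exact hBC))] at H
  have h0 : 0 < sin (π * t.1 / s.1) := by
    have n0 : (0:ℝ) < s.1 := by exact_mod_cast (by omega : 0 < s.1)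
    have i0 : (0:ℝ) < t.1 := by exact_mod_cast hi
    have : (t.1 : ℝ) < s.1 := by exact_mod_cast (by omega : t.1 < s.1)
    apply sin_pos_of_pos_of_lt_pi (by positivity)
    rw [div_lt_iff₀ n0]; exact mul_lt_mul_of_pos_left this pi_pos
  exact ded_sound (sn_has hi (by omega)) (sn_has hj (by omega)) (sn_has hk (by omega)) (sn_has hA (by omega))
    (sn_has (by omega) (by omega)) (sn_has (by omega) (by omega)) h0 H hp h
structure SE (α β γ δ ν : ℝ) (r0 : ℕ) (n : Fin 3 → ℕ) : Prop where
  eq : (n 0 * α + n 1 * β + n 2 * γ) ^ 2 * δ = 11 * ν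
  le : n 0 + n 1 + n 2 ≤ 11
  r : r0 ≤ n 2
theorem has1 : (iK 1).has 1 := by simpa using has_K 1
theorem has2 : (iK 2).has 2 := by simpa using has_K 2
theorem has3 : (iK 3).has 3 := by simpa using has_K 3
theorem cd_SE {a b c N D : Iv} {α β γ ν δ : ℝ} (ha : a.has α) (hb : b.has β) (hc : c.has γ) (hN : N.has ν)
    (hD : D.has δ) (hα : 0 < α) (h9 : α ≤ 9 ∧ β ≤ 9 ∧ γ ≤ 9) {r0 : ℕ} {g : ℕ → ℕ → ℕ → Bool} (H : cd a b c N D r0 g = true)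
    {n : Fin 3 → ℕ} (h : SE α β γ δ ν r0 n) : g (n 0) (n 1) (n 2) = true := by
  refine cd_mem ha hb hc hN hD hα H h.r h.le h.eq ?_
  have h1 : (n 0 : ℝ) * α ≤ n 0 * 9 := by gcongr; exact h9.1
  have h2 : (n 1 : ℝ) * β ≤ n 1 * 9 := by gcongr; exact h9.2.1
  have h3 : (n 2 : ℝ) * γ ≤ n 2 * 9 := by gcongr; exact h9.2.2
  have h4 : (n 0 + n 1 + n 2 : ℝ) ≤ 11 := by exact_mod_cast h.le
  linarith
theorem c2_SE {a b c N1 D1 N2 D2 : Iv} {α β γ ν1 δ1 ν2 δ2 : ℝ} (ha : a.has α) (hb : b.has β) (hc : c.has γ) (hN1 : N1.has ν1)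
    (hD1 : D1.has δ1) (hN2 : N2.has ν2) (hD2 : D2.has δ2) (hα : 0 < α) (h9 : α ≤ 9 ∧ β ≤ 9 ∧ γ ≤ 9) {r0 : ℕ}
    {ok : ℕ → ℕ → ℕ → ℕ → ℕ → ℕ → Bool} (H : c2 a b c N1 D1 N2 D2 r0 ok = true)
    {n n' : Fin 3 → ℕ} (h : SE α β γ δ1 ν1 r0 n) (h' : SE α β γ δ2 ν2 r0 n') :
    ok (n 0) (n 1) (n 2) (n' 0) (n' 1) (n' 2) = true := by
  have h1 := cd_SE ha hb hc hN1 hD1 hα h9 H h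
  exact cd_SE ha hb hc hN2 hD2 hα h9 (g := fun p' q' r' => ok (n 0) (n 1) (n 2) p' q' r') h1 h'
theorem c3_SE {a b c N1 D1 N2 D2 N3 D3 : Iv} {α β γ ν1 δ1 ν2 δ2 ν3 δ3 : ℝ} (ha : a.has α) (hb : b.has β) (hc : c.has γ) (hN1 : N1.has ν1)
    (hD1 : D1.has δ1) (hN2 : N2.has ν2) (hD2 : D2.has δ2) (hN3 : N3.has ν3) (hD3 : D3.has δ3)
    (hα : 0 < α) (h9 : α ≤ 9 ∧ β ≤ 9 ∧ γ ≤ 9) {r0 : ℕ} (H : c3 a b c N1 D1 N2 D2 N3 D3 r0 = true)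
    {n n' n'' : Fin 3 → ℕ} (h : SE α β γ δ1 ν1 r0 n) (h' : SE α β γ δ2 ν2 r0 n') (h'' : SE α β γ δ3 ν3 r0 n'') : False := by
  have z : ∀ p q r, no3 p q r = true → False := fun p q r h => by simp [no3] at h
  rcases h1 : cd a b c N1 D1 r0 no3 with _ | _
  · rcases h2 : cd a b c N2 D2 r0 no3 with _ | _
    · have : cd a b c N3 D3 r0 no3 = true := by rw [c3, h1, h2] at H; exact H
      exact z _ _ _ (cd_SE ha hb hc hN3 hD3 hα h9 this h'')
    · exact z _ _ _ (cd_SE ha hb hc hN2 hD2 hα h9 h2 h')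
  · exact z _ _ _ (cd_SE ha hb hc hN1 hD1 hα h9 h1 h)
theorem has_param {x : ℝ} (h0 : 0 ≤ x) (h1 : x ≤ 1) : Iv.has (0, SC) x := by
  have := SC_pos
  constructor
  · simpa using mul_nonneg this.le h0
  · show SC * x ≤ SC
    nlinarith
theorem numR1 {t : ℝ} (h1 : 1 < t) (h2 : t < 2) {n n' : Fin 3 → ℕ} (h : SE 1 (t*t-1) t 1 (t*t-1) 1 n)
    (h' : SE 1 (t*t-1) t 1 ((t*t-1)*(t*t)) 1 n') :
    ((n 0, n 1, n 2), (n' 0, n' 1, n' 2)) ∈ [((1,0,1),(1,1,1)), ((2,0,1),(1,1,2)), ((1,0,2),(2,2,1)), ((3,0,1),(1,1,3))] := by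
  have hs := SC_pos
  obtain ⟨I, hI, H⟩ := bis_sound _ _ _ fR1_ok (x := t) ⟨by show (SC:ℝ) ≤ _; nlinarith, by show _ ≤ ((2 * SC : ℕ) : ℝ); push_cast; nlinarith⟩
  have hq := has_M hI hI
  have hb := has_S hq has1 (by nlinarith)
  exact of_decide_eq_true (c2_SE has1 hb hI hb has1 (has_M hb hq) has1 one_pos ⟨by norm_num, by nlinarith, by linarith⟩ H h h')
theorem numR2 {t : ℝ} (h1 : 0 < t) (h2 : t < 1) {n n' : Fin 3 → ℕ} (h : SE (1-t*t) (t+t) (1+t*t) 2 ((1+t*t)*(1+t*t)) 0 n)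
    (h' : SE (1-t*t) (t+t) (1+t*t) 1 (2*((1-t*t)*(1-t*t))) 0 n') :
    (n 0, n 1, n 2) = (11,0,0) ∧ (n' 0, n' 1, n' 2) = (0,0,1) := by
  obtain ⟨I, hI, H⟩ := bis_sound _ _ _ fR2_ok (has_param h1.le h2.le)
  have hq := has_M hI hI
  have ha := has_S has1 hq (by nlinarith)
  have hc := has_A has1 hq
  exact of_decide_eq_true (c2_SE ha (has_A hI hI) hc (has_M hc hc) has2 (has_M has2 (has_M ha ha)) has1 (by nlinarith) ⟨by nlinarith, by nlinarith, by nlinarith⟩ H h h')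
section R3
variable {s : ℝ} (h1 : 0 < s) (h2 : s < 1) {n n' n'' : Fin 3 → ℕ}
theorem numR30 (h1 : 0 < s) (h2 : s < 1) (h : SE (1-s*s) s 1 (2-s*s) (1-s*s) 1 n) (h' : SE (1-s*s) s 1 1 ((1-s*s)*(2-s*s)) 1 n') :
    ((n 0, n 1, n 2), (n' 0, n' 1, n' 2)) ∈ [((0,0,1),(1,0,1)),((0,0,2),(2,0,2))] := by
  obtain ⟨I, hI, H⟩ := bis_sound _ _ _ fR30_ok (has_param h1.le h2.le)
  have hq := has_M hI hI
  have ha := has_S has1 hq (by nlinarith)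
  have hd := has_S has2 hq (by nlinarith)
  exact of_decide_eq_true (c2_SE ha hI has1 ha hd (has_M ha hd) has1 (by nlinarith) ⟨by nlinarith, by nlinarith, by nlinarith⟩ H h h')
theorem numR31 (h1 : 0 < s) (h2 : s < 1) (h : SE (1-s*s) s 1 ((2-s*s)*(3-s*s)) 1 1 n) (h' : SE (1-s*s) s 1 (3-s*s) (2-s*s) 1 n')
     (h'' : SE (1-s*s) s 1 (2-s*s) ((1-s*s)*(1-s*s)*(3-s*s)) 1 n'') : False := by
  obtain ⟨I, hI, H⟩ := bis_sound _ _ _ fR31_ok (has_param h1.le h2.le)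
  have hq := has_M hI hI
  have ha := has_S has1 hq (by nlinarith)
  have hd := has_S has2 hq (by nlinarith)
  have hd3 := has_S has3 hq (by nlinarith)
  exact c3_SE ha hI has1 has1 (has_M hd hd3) hd hd3 (has_M (has_M ha ha) hd3) hd (by nlinarith) ⟨by nlinarith, by nlinarith, by nlinarith⟩ H h h' h''
theorem numR32 (h1 : 0 < s) (h2 : s < 1) (h : SE (1-s*s) s 1 1 ((1-s*s)*(s*s)) 1 n) (h' : SE (1-s*s) s 1 1 (1-s*s) 1 n') : False := by
  obtain ⟨I, hI, H⟩ := bis_sound _ _ _ fR32_ok (has_param h1.le h2.le)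
  have hq := has_M hI hI
  have ha := has_S has1 hq (by nlinarith)
  exact Bool.false_ne_true (c2_SE ha hI has1 (has_M ha hq) has1 ha has1 (by nlinarith) ⟨by nlinarith, by nlinarith, by nlinarith⟩ H h h')
theorem numR33 (h1 : 0 < s) (h2 : s < 1) (h : SE (1-s*s) s 1 1 (s*s*(2-s*s)) 1 n) (h' : SE (1-s*s) s 1 (2-s*s) ((1-s*s)*(1-s*s)) 1 n')
     (h'' : SE (1-s*s) s 1 (2-s*s) 1 1 n'') : False := by
  obtain ⟨I, hI, H⟩ := bis_sound _ _ _ fR33_ok (has_param h1.le h2.le)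
  have hq := has_M hI hI
  have ha := has_S has1 hq (by nlinarith)
  have hd := has_S has2 hq (by nlinarith)
  exact c3_SE ha hI has1 (has_M hq hd) has1 (has_M ha ha) hd has1 hd (by nlinarith) ⟨by nlinarith, by nlinarith, by nlinarith⟩ H h h' h''
theorem numR34 (h1 : 0 < s) (h2 : s < 1) (h : SE (1-s*s) s 1 1 (s*s*(3-s*s)) 1 n) (h' : SE (1-s*s) s 1 (3-s*s) 1 1 n') :
    ((n 0, n 1, n 2) = (1,2,1) ∨ (n 0, n 1, n 2) = (1,0,2)) ∧ ((n' 0, n' 1, n' 2) = (0,2,1) ∨ (n' 0, n' 1, n' 2) = (0,0,2)) := by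
  obtain ⟨I, hI, H⟩ := bis_sound _ _ _ fR34_ok (has_param h1.le h2.le)
  have hq := has_M hI hI
  have ha := has_S has1 hq (by nlinarith)
  have hd := has_S has3 hq (by nlinarith)
  exact of_decide_eq_true (c2_SE ha hI has1 (has_M hq hd) has1 has1 hd (by nlinarith) ⟨by nlinarith, by nlinarith, by nlinarith⟩ H h h')
end R3
section R4
variable {t a b c : ℝ} {n n' n'' : Fin 3 → ℕ}
theorem numR4 (h1 : 0 < t) (h2 : t < 1) (ea : a = 1 - t*t) (eb : b = t+t+t*t) (ec : c = 1+t+t*t)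
  {f : ℕ} {d : ℕ} (H : bis (fR4 f) d 0 SC = true) : ∃ x y z I : Iv, x.has a ∧ y.has b ∧ z.has c ∧ fR4 f I = true ∧ 
    x = iS (iK 1) (iM I I) ∧ y = iA (iA I I) (iM I I) ∧ z = iA (iA (iK 1) I) (iM I I) ∧ 0 < a ∧ (a ≤ 9 ∧ b ≤ 9 ∧ c ≤ 9) := by
  obtain ⟨I, hI, H⟩ := bis_sound _ _ _ H (has_param h1.le h2.le)
  have hq := has_M hI hI
  exact ⟨_, _, _, I, ea ▸ has_S has1 hq (by nlinarith), eb ▸ has_A (has_A hI hI) hq, ec ▸ has_A (has_A has1 hI) hq, H, rfl, rfl, rfl, by nlinarith, 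
    by nlinarith, by nlinarith, by nlinarith⟩
variable (h1 : 0 < t) (h2 : t < 1) (ea : a = 1 - t*t) (eb : b = t+t+t*t) (ec : c = 1+t+t*t)
theorem numR40 (h1 : 0 < t) (h2 : t < 1) (ea : a = 1 - t*t) (eb : b = t+t+t*t) (ec : c = 1+t+t*t)
    (h : SE a b c (a+(a+b)) (a*(c*c)) 1 n) (h' : SE a b c 1 (a*(a+(a+b))) 1 n') : False := by
  obtain ⟨x, y, z, I, hx, hy, hz, H, rfl, rfl, rfl, h0, h9⟩ := numR4 h1 h2 ea eb ec fR40_ok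
  have hA := has_A hx (has_A hx hy)
  exact Bool.false_ne_true (c2_SE hx hy hz (has_M hx (has_M hz hz)) hA (has_M hx hA) has1 h0 h9 H h h')
theorem numR41 (h1 : 0 < t) (h2 : t < 1) (ea : a = 1 - t*t) (eb : b = t+t+t*t) (ec : c = 1+t+t*t)
    (h : SE a b c (3*((a+(a+b))*(a+b))) ((c*c)*(c*c)) 1 n) (h' : SE a b c (3*(a+b)) (c*c*(a+(a+b))) 1 n')
    (h'' : SE a b c (a+(a+b)) (3*(a*a*(a+b))) 1 n'') : False := by
  obtain ⟨x, y, z, I, hx, hy, hz, H, rfl, rfl, rfl, h0, h9⟩ := numR4 h1 h2 ea eb ec fR41_ok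
  have hs := has_A hx hy
  have hA := has_A hx hs
  have hcc := has_M hz hz
  exact c3_SE hx hy hz (has_M hcc hcc) (has_M has3 (has_M hA hs)) (has_M hcc hA) (has_M has3 hs) (has_M has3 (has_M (has_M hx hx) hs)) hA h0 h9 H h h' h''
theorem numR42 (h1 : 0 < t) (h2 : t < 1) (ea : a = 1 - t*t) (eb : b = t+t+t*t) (ec : c = 1+t+t*t)
    (h : SE a b c (a+b) (a*(b*b)) 1 n) (h' : SE a b c (a+b) (a*(c*c)) 1 n')
    (h'' : SE a b c 1 (a*(a+b)) 1 n'') : False := by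
  obtain ⟨x, y, z, I, hx, hy, hz, H, rfl, rfl, rfl, h0, h9⟩ := numR4 h1 h2 ea eb ec fR42_ok
  have hs := has_A hx hy
  have hcc := has_M hz hz
  exact c3_SE hx hy hz (has_M hx (has_M hy hy)) hs (has_M hx hcc) hs (has_M hx hs) has1 h0 h9 H h h' h''
theorem numR43 (h1 : 0 < t) (h2 : t < 1) (ea : a = 1 - t*t) (eb : b = t+t+t*t) (ec : c = 1+t+t*t)
    (h : SE a b c ((a+b)*(a+b+b)) (b*b*(c*c)) 1 n) (h' : SE a b c (a+b+b) ((a+b)*(c*c)) 1 n')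
    (h'' : SE a b c (a+b) (a*a*(a+b+b)) 1 n'') : False := by
  obtain ⟨x, y, z, I, hx, hy, hz, H, rfl, rfl, rfl, h0, h9⟩ := numR4 h1 h2 ea eb ec fR43_ok
  have hs := has_A hx hy
  have hB := has_A hs hy
  have hcc := has_M hz hz
  exact c3_SE hx hy hz (has_M (has_M hy hy) hcc) (has_M hs hB) (has_M hs hcc) hB (has_M (has_M hx hx) hB) hs h0 h9 H h h' h''
theorem numR44 (h1 : 0 < t) (h2 : t < 1) (ea : a = 1 - t*t) (eb : b = t+t+t*t) (ec : c = 1+t+t*t)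
    (h : SE a b c (a+b+b) (b*b*(a+(a+b))) 1 n) (h' : SE a b c ((a+(a+b))*(a+b+b)) (c*c*(c*c)) 1 n')
    (h'' : SE a b c (a+(a+b)) (a*a*(a+b+b)) 1 n'') : False := by
  obtain ⟨x, y, z, I, hx, hy, hz, H, rfl, rfl, rfl, h0, h9⟩ := numR4 h1 h2 ea eb ec fR44_ok
  have hs := has_A hx hy
  have hA := has_A hx hs
  have hB := has_A hs hy
  have hcc := has_M hz hz
  exact c3_SE hx hy hz (has_M (has_M hy hy) hA) hB (has_M hcc hcc) (has_M hA hB) (has_M (has_M hx hx) hB) hA h0 h9 H h h' h''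
end R4
end
section
variable {A : AB} {B : Fin 11 → AB} {θ L : Fin 3 → ℝ}
theorem irr11 : Irrational (√11) := by
  have := Nat.Prime.irrational_sqrt (p := 11) (by norm_num)
  exact_mod_cast this
theorem irr_lin {s : ℝ} (hs : Irrational s) {a b : ℤ} (h : (a : ℝ) * s = b) : a = 0 ∧ b = 0 := by
  have ha : a = 0 := by
    by_contra hne
    have h' : (a : ℝ) ≠ 0 := by exact_mod_cast hne
    apply hs
    refine ⟨(b : ℚ) / a, ?_⟩
    push_cast
    rw [← h]; field_simp
  subst ha
  refine ⟨rfl, ?_⟩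
  have : (b : ℝ) = 0 := by rw [← h]; simp
  exact_mod_cast this
theorem perron0 (D : Fin 3 → Fin 3 → ℕ) (v : Fin 3 → ℝ) (hv : ∀ i, 0 < v i) (hD : ∀ i, ∑ j, (D i j : ℝ) * v j = √11 * v i) :
    ∃ w : Fin 3 → ℝ, w ≠ 0 ∧ ∀ i, ∑ j, (D i j : ℝ) * w j = -√11 * w i := by
  have hs : √11 * √11 = (11:ℝ) := Real.mul_self_sqrt (by norm_num)
  set s := √11 with hsd
  let M : ℝ → Matrix (Fin 3) (Fin 3) ℝ := fun t => Matrix.of (fun i j => (D i j : ℝ)) - t • (1 : Matrix (Fin 3) (Fin 3) ℝ)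
  have hM : ∀ t w, (M t).mulVec w = 0 ↔ ∀ i, ∑ j, (D i j : ℝ) * w j = t * w i := by
    intro t w
    rw [funext_iff]
    refine forall_congr' fun i => ?_
    simp only [M, Matrix.sub_mulVec, Matrix.smul_mulVec, Matrix.one_mulVec, Pi.sub_apply, Pi.smul_apply, Pi.zero_apply, smul_eq_mul, sub_eq_zero]
    rfl
  have h1 : (M s).det = 0 := by
    rw [← Matrix.exists_mulVec_eq_zero_iff]
    refine ⟨v, fun h => ?_, (hM _ _).2 hD⟩
    have := hv 0; rw [h] at this; simp at this
  have h2 : (M (-s)).det = 0 := by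
    rw [Matrix.det_fin_three] at h1 ⊢
    simp only [M, Matrix.sub_apply, Matrix.of_apply, Matrix.smul_apply, smul_eq_mul, Matrix.one_apply] at h1 ⊢
    simp at h1 ⊢
    have h3 := irr_lin irr11 (a := 11 + (D 0 0 * D 1 1 + D 0 0 * D 2 2 + D 1 1 * D 2 2 - D 0 1 * D 1 0 - D 0 2 * D 2 0 - D 1 2 * D 2 1))
      (b := 11 * (D 0 0 + D 1 1 + D 2 2) + (D 0 0 * D 1 1 * D 2 2 - D 0 0 * D 1 2 * D 2 1 - D 0 1 * D 1 0 * D 2 2 + D 0 1 * D 1 2 * D 2 0 + D 0 2 * D 1 0 * D 2 1 - D 0 2 * D 1 1 * D 2 0)) (by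
        push_cast
        rw [← hsd]
        linear_combination (-1) * h1 + (- s + (D 0 0 + D 1 1 + D 2 2)) * hs)
    obtain ⟨ha, hb⟩ := h3
    have ha' := congrArg (Int.cast : ℤ → ℝ) ha
    have hb' := congrArg (Int.cast : ℤ → ℝ) hb
    push_cast at ha' hb'
    linear_combination s * ha' + hb' + (s - -(D 0 0 + D 1 1 + D 2 2)) * hs
  obtain ⟨w, hw, h⟩ := Matrix.exists_mulVec_eq_zero_iff.2 h2
  exact ⟨w, hw, (hM _ _).1 h⟩
theorem perron (D : Fin 3 → Fin 3 → ℕ) (v : Fin 3 → ℝ) (hv : ∀ i, 0 < v i) (hD : ∀ i, ∑ j, (D i j : ℝ) * v j = √11 * v i) :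
    ∃ k, (∀ i, i ≠ k → ∀ j, j ≠ k → D i j = 0) ∨ ∃ i, i ≠ k ∧ (∀ j, j ≠ k → D i j = 0) ∧ (∀ j, j ≠ i → D k j = 0) := by
  obtain ⟨w, hw, h⟩ := perron0 D v hv hD
  have hs : 0 < √11 := by positivity
  obtain ⟨i0, -, hi0⟩ := Finset.exists_max_image (Finset.univ : Finset (Fin 3)) (fun i => |w i| / v i) ⟨0, by simp⟩
  set ρ := |w i0| / v i0 with hρ
  have hle : ∀ j, |w j| ≤ ρ * v j := fun j => by
    have := hi0 j (by simp)
    rwa [div_le_iff₀ (hv j)] at this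
  have hρ0 : 0 < ρ := by
    by_contra hn
    apply hw
    ext j
    have := hle j
    have h2 := hv j
    have h3 : |w j| ≤ 0 := this.trans (mul_nonpos_of_nonpos_of_nonneg (not_lt.1 hn) h2.le)
    simpa using h3
  have key : ∀ (e : ℝ), (e = 1 ∨ e = -1) → ∀ i, e * w i = ρ * v i → ∀ j, D i j ≠ 0 → e * w j = - (ρ * v j) := by
    intro e he i hi j hj
    have h1 : ∑ j, (D i j : ℝ) * (e * w j + ρ * v j) = 0 := by
      have : ∑ j, (D i j : ℝ) * (e * w j + ρ * v j) = e * ∑ j, (D i j : ℝ) * w j + ρ * ∑ j, (D i j : ℝ) * v j := by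
        rw [Finset.mul_sum, Finset.mul_sum, ← Finset.sum_add_distrib]
        refine Finset.sum_congr rfl fun _ _ => by ring
      rw [this, h, hD]
      linear_combination (-√11) * hi
    rw [Finset.sum_eq_zero_iff_of_nonneg] at h1
    · have := h1 j (by simp)
      rcases mul_eq_zero.1 this with h2 | h2
      · exact absurd (by exact_mod_cast h2) hj
      · linarith
    · intro j _
      refine mul_nonneg (by positivity) ?_
      have := abs_le.1 (hle j)
      rcases he with rfl | rfl <;> linarith
  have row : ∀ i, ∃ j, D i j ≠ 0 := by
    intro i
    by_contra hn
    push Not at hn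
    have h1 := hD i
    simp only [hn] at h1
    have := mul_pos hs (hv i)
    simp at h1
    exact (hv i).ne' h1
  have main : ∀ e : ℝ, (e = 1 ∨ e = -1) → ∀ i, e * w i = ρ * v i → ∃ j, i ≠ j ∧ e * w j = -(ρ * v j) := by
    intro e he i hi
    obtain ⟨j, hj⟩ := row i
    have := key e he i hi j hj
    refine ⟨j, ?_, this⟩
    rintro rfl
    have := mul_pos hρ0 (hv i)
    linarith
  obtain ⟨e, he, hi⟩ : ∃ e : ℝ, (e = 1 ∨ e = -1) ∧ e * w i0 = ρ * v i0 := by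
    have : ρ * v i0 = |w i0| := by rw [hρ, div_mul_cancel₀ _ (hv i0).ne']
    rw [this]
    rcases abs_choice (w i0) with h | h
    · exact ⟨1, Or.inl rfl, by rw [h]; ring⟩
    · exact ⟨-1, Or.inr rfl, by rw [h]; ring⟩
  obtain ⟨j, hij, hj⟩ := main e he i0 hi
  have he' : -e = 1 ∨ -e = -1 := by rcases he with rfl | rfl <;> simp
  have kP := key e he
  have kN : ∀ i, e * w i = -(ρ * v i) → ∀ j, D i j ≠ 0 → e * w j = ρ * v j := fun i hi j hj => by
    have := key (-e) he' i (by linarith) j hj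
    linarith
  have hpp : ∀ i, e * w i = ρ * v i → e * w i = -(ρ * v i) → False := fun i h1 h2 => by
    have := mul_pos hρ0 (hv i)
    linarith
  have P : ∀ i k, e * w i = ρ * v i → e * w k ≠ -(ρ * v k) → D i k = 0 := fun i k h1 h2 => by
    by_contra h3; exact h2 (kP i h1 k h3)
  have N : ∀ i k, e * w i = -(ρ * v i) → e * w k ≠ ρ * v k → D i k = 0 := fun i k h1 h2 => by
    by_contra h3; exact h2 (kN i h1 k h3)
  have hi' : e * w i0 ≠ -(ρ * v i0) := fun h => hpp _ hi h
  have hj' : e * w j ≠ ρ * v j := fun h => hpp _ h hj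
  by_cases c1 : e * w (th i0 j) = ρ * v (th i0 j)
  · have c1' : e * w (th i0 j) ≠ -(ρ * v (th i0 j)) := fun h => hpp _ c1 h
    refine ⟨j, Or.inl fun a ha b hb => P a b ?_ ?_⟩
    · rcases th_cases hij a with rfl | rfl | rfl <;> first | assumption | exact absurd rfl ha
    · rcases th_cases hij b with rfl | rfl | rfl <;> first | assumption | exact absurd rfl hb
  by_cases c2 : e * w (th i0 j) = -(ρ * v (th i0 j))
  · refine ⟨i0, Or.inl fun a ha b hb => N a b ?_ ?_⟩
    · rcases th_cases hij a with rfl | rfl | rfl <;> first | assumption | exact absurd rfl ha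
    · rcases th_cases hij b with rfl | rfl | rfl <;> first | assumption | exact absurd rfl hb
  · refine ⟨j, Or.inr ⟨i0, hij, fun b hb => P _ _ hi ?_, fun b hb => N _ _ hj ?_⟩⟩
    · rcases th_cases hij b with rfl | rfl | rfl <;> first | assumption | exact absurd rfl hb
    · rcases th_cases hij b with rfl | rfl | rfl <;> first | assumption | exact absurd rfl hb
theorem row_corner {p q k : Fin 3} {w : Wd} (h : IsSide A B p q w) (hc : ∀ c, c ≠ k → nv B (A p) c = 0) :
    ∃ j, j ≠ k ∧ cnt w j ≠ 0 := by
  rcases w with _ | ⟨⟨i, l, m⟩, w⟩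
  · exact absurd rfl h.ne_nil
  · obtain ⟨h1, h2, -⟩ := side_first h
    have hl : l = k := by
      by_contra hne
      have := nv_one h2
      rw [hc l hne] at this; omega
    subst hl
    refine ⟨th l m, th_ne_l h1, ?_⟩
    simp [cnt]
theorem Tl.words (T : Tl A B θ L) : ∃ W : Fin 3 → Wd, ∀ m, IsSide A B (m+1) (m+2) (W m) := by
  have : ∀ m : Fin 3, ∃ w, IsSide A B (m+1) (m+2) w := fun m => T.side (by revert m; decide)
  choose W h using this
  exact ⟨W, h⟩
theorem Tl.sim (T : Tl A B θ L) (hv : ∀ m, vang A m = θ m) {W : Fin 3 → Wd} (hW : ∀ m, IsSide A B (m+1) (m+2) (W m)) :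
    (∀ m, ∑ j, (cnt (W m) j : ℝ) * L j = √11 * L m) ∧ 
    ∃ k, (∀ i, i ≠ k → ∀ j, j ≠ k → cnt (W i) j = 0) ∨ ∃ i, i ≠ k ∧ (∀ j, j ≠ k → cnt (W i) j = 0) ∧ (∀ j, j ≠ i → cnt (W k) j = 0) := by
  have h1 : ∀ m, ∑ j, (cnt (W m) j : ℝ) * L j = √11 * L m := by
    intro m
    have := (T.side_len (hW m)).1
    rw [wlen_cnt, xlen_th _ (hW m).1, show th (m+1) (m+2) = m by clear * -; revert m; decide] at this
    rw [Fin.sum_univ_three, ← this]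
    obtain ⟨c, C, hc, hC, e1, e2, e3⟩ := T.bdata
    rw [e1, e2, hv]
    simp only [hv] at e3
    have hs : ∀ k, 0 < sin (θ k) := fun k => pos_of_mul_pos_right (e1 k ▸ T.lpos k) hc.le
    have : C ^ 2 = 11 * c ^ 2 := by
      have h := mul_pos (mul_pos (hs 0) (hs 1)) (hs 2)
      apply mul_right_cancel₀ h.ne'
      linear_combination e3
    have : C = √11 * c := by
      rw [← Real.sqrt_sq hC.le, this, Real.sqrt_mul (by norm_num), Real.sqrt_sq hc.le]
    rw [this]; ring
  exact ⟨h1, perron _ L T.lpos h1⟩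
theorem cnt_rv (w : Wd) (j : Fin 3) : cnt (rv w) j = cnt w j := by
  simp only [cnt, rv, List.countP_reverse, List.countP_map]
  congr 1
  ext e
  simp [th_comm e.2.1 e.2.2]
theorem row_contra {W : Fin 3 → Wd} (hW : ∀ m, IsSide A B (m+1) (m+2) (W m)) {i k : Fin 3} (hik : i ≠ k)
    (hc : ∀ c, c ≠ k → nv B (A k) c = 0) (h : ∀ j, j ≠ k → cnt (W i) j = 0) : False := by
  have h1 : k = i + 1 ∨ k = i + 2 := by clear * - hik; revert i k; decide
  have h2 := hW i
  rcases h1 with h1 | h1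
  · rw [← h1] at h2
    obtain ⟨j, hj, hj'⟩ := row_corner h2 hc
    exact hj' (h j hj)
  · rw [← h1] at h2
    obtain ⟨j, hj, hj'⟩ := row_corner h2.rev hc
    apply hj'
    rw [cnt_rv]; exact h j hj
theorem Tl.caseI (T : Tl A B θ L) (h : ∀ m c, c ≠ m → nv B (A m) c = 0) (hv : ∀ m, vang A m = θ m) : False := by
  obtain ⟨W, hW⟩ := T.words
  obtain ⟨-, k, h1 | ⟨i, hi, h1, -⟩⟩ := T.sim hv hW
  · have : k + 1 ≠ k := by clear * -; revert k; decide
    exact row_contra hW this (h k) (h1 _ this)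
  · exact row_contra hW hi (h k) h1
theorem Tl.nv_single (T : Tl A B θ L) {X : Pt} {k : Fin 3} (h1 : 1 ≤ nv B X k) (h : ∑ c, (nv B X c : ℝ) * θ c = θ k) :
    nv B X k = 1 ∧ ∀ c, c ≠ k → nv B X c = 0 := by
  have h0 : 0 ≤ ((nv B X k : ℝ) - 1) * θ k :=
    mul_nonneg (by have : (1:ℝ) ≤ nv B X k := by exact_mod_cast h1
                   linarith) (T.pos k).le
  have e : ∑ c, (nv B X c : ℝ) * θ c = (nv B X k : ℝ) * θ k + ∑ c ∈ Finset.univ.erase k, (nv B X c : ℝ) * θ c := by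
    exact (Finset.add_sum_erase _ (fun c => (nv B X c : ℝ) * θ c) (Finset.mem_univ k)).symm
  have hn : ∀ c ∈ Finset.univ.erase k, 0 ≤ (nv B X c : ℝ) * θ c := fun c _ => mul_nonneg (by positivity) (T.pos c).le
  have h2 := Finset.sum_nonneg hn
  constructor
  · have : ((nv B X k : ℝ) - 1) * θ k = 0 := by linarith
    rcases mul_eq_zero.1 this with h | h
    · have : (nv B X k : ℝ) = 1 := by linarith
      exact_mod_cast this
    · exact absurd h (T.pos k).ne'
  · intro c hc
    have h3 := (Finset.sum_eq_zero_iff_of_nonneg hn).1 (by linarith) c (by simp [hc])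
    rcases mul_eq_zero.1 h3 with h | h
    · exact_mod_cast h
    · exact absurd h (T.pos c).ne'
theorem Tl.caseP (T : Tl A B θ L) (p : Equiv.Perm (Fin 3)) (h : ∀ m, 1 ≤ nv B (A m) (p m)) (hv : ∀ m, vang A m = θ (p m)) : False := by
  have T' := T.relabelA p
  have e : ∀ m, (A.reindex p) m = A (p.symm m) := fun m => by simp
  have hv' : ∀ m, vang (A.reindex p) m = θ m := by
    intro m
    have h1 : 1 ≤ nv B (A.reindex p m) m := by rw [e]; simpa using h (p.symm m)
    have h2 := T'.corner m
    have h3 := T.corner (p.symm m)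
    rw [e] at h2
    rw [← h2, h3, hv]; simp
  refine T'.caseI (fun m c hc => ?_) hv'
  refine (T'.nv_single ?_ ?_).2 c hc
  · rw [e]; simpa using h (p.symm m)
  · rw [T'.corner, hv']
theorem perm_of (f : Fin 3 → Fin 3) (h : Function.Injective f) : ∃ p : Equiv.Perm (Fin 3), ∀ m, p m = f m :=
  ⟨Equiv.ofBijective f (Finite.injective_iff_bijective.1 h), fun _ => rfl⟩
theorem Tl.caseR0 (T : Tl A B θ L) {a b : Fin 3} (hab : a ≠ b) (hθ : θ a = θ b) (f : Fin 3 → Fin 3)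
    (h : ∀ m, 1 ≤ nv B (A m) (f m)) (hv : ∀ m, vang A m = θ (f m)) {m0 : Fin 3} (h0 : f m0 = a) (h1 : ∀ m, f m ≠ b)
    (h2 : ∀ m m', m ≠ m' → m ≠ m0 → m' ≠ m0 → f m ≠ f m') : False := by
  have hmem : ∀ m, ∃ i, B i (f m) = A m := fun m => by
    have := h m
    rw [nv, Nat.succ_le_iff, Finset.card_pos] at this
    obtain ⟨i, hi⟩ := this
    exact ⟨i, by simpa using hi⟩
  choose τ hτ using hmem
  have hL : L a = L b := by
    obtain ⟨c, C, hc, hC, e1, e2, e3⟩ := T.bdata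
    rw [e1, e1, hθ]
  let σ : Fin 11 → Equiv.Perm (Fin 3) := fun i => if i = τ m0 then Equiv.swap a b else 1
  have hσ : ∀ (F : Fin 3 → ℝ), F a = F b → ∀ i k, F k = F ((σ i).symm k) := by
    intro F hF i k
    by_cases hi : i = τ m0
    · simp only [σ, if_pos hi, Equiv.symm_swap]
      rcases eq_or_ne k a with rfl | ha
      · simp [hF]
      · rcases eq_or_ne k b with rfl | hb
        · simp [hF]
        · rw [Equiv.swap_apply_of_ne_of_ne ha hb]
    · simp only [σ, if_neg hi]; rfl
  have T' := T.relabel σ (hσ θ hθ) (hσ L hL)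
  obtain ⟨p, hp⟩ := perm_of (fun m => if m = m0 then b else f m) (by
    intro m m' e
    by_contra hne
    by_cases c1 : m = m0
    · have c2 : m' ≠ m0 := fun h => hne (c1.trans h.symm)
      simp only [if_pos c1, if_neg c2] at e
      exact h1 _ e.symm
    · by_cases c2 : m' = m0
      · simp only [if_neg c1, if_pos c2] at e
        exact h1 _ e
      · simp only [if_neg c1, if_neg c2] at e
        exact h2 m m' hne c1 c2 e)
  refine T'.caseP p (fun m => ?_) fun m => ?_
  · rw [hp]
    by_cases c1 : m = m0
    · refine nv_one (i := τ m0) ?_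
      simp only [if_pos c1, σ, AffineBasis.reindex_apply, Equiv.symm_swap, if_true]
      rw [Equiv.swap_apply_right, ← h0, hτ, c1]
    · refine nv_one (i := τ m) ?_
      simp only [if_neg c1, σ, AffineBasis.reindex_apply]
      by_cases c2 : τ m = τ m0
      · rw [if_pos c2, Equiv.symm_swap, Equiv.swap_apply_of_ne_of_ne, hτ]
        · intro c3
          have e1 := hτ m
          have e2 := hτ m0
          rw [c3, c2] at e1
          rw [h0, e1] at e2
          exact ab_ne A c1 e2
        · exact h1 m
      · rw [if_neg c2]; exact hτ m
  · rw [hp, hv]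
    by_cases c1 : m = m0
    · rw [if_pos c1, c1, h0, hθ]
    · rw [if_neg c1]
theorem Tl.beq (T : Tl A B θ L) {j l : Fin 3} {w : Wd} (h : IsSide A B j l w) :
    (cnt w 0 * sin (θ 0) + cnt w 1 * sin (θ 1) + cnt w 2 * sin (θ 2)) ^ 2 * (sin (vang A j) * sin (vang A l)) =
      11 * (sin (θ 0) * sin (θ 1) * sin (θ 2) * sin (vang A (th j l))) := by
  have h1 := (T.side_len h).1
  rw [wlen_cnt, xlen_th _ h.1] at h1
  obtain ⟨c, C, hc, hC, e1, e2, e3⟩ := T.bdata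
  simp only [e1, e2] at h1
  have hs := vang_sin_pos A (th j l)
  have e4 : sin (vang A 0) * sin (vang A 1) * sin (vang A 2) =
      sin (vang A j) * sin (vang A l) * sin (vang A (th j l)) := by
    have hjl := h.1
    clear * - hjl
    have : ∀ (f : Fin 3 → ℝ) (j l : Fin 3), j ≠ l → f 0 * f 1 * f 2 = f j * f l * f (th j l) := by
      intro f j l hjl
      have : (j = 0 ∧ l = 1 ∧ th j l = 2) ∨ (j = 0 ∧ l = 2 ∧ th j l = 1) ∨ (j = 1 ∧ l = 0 ∧ th j l = 2) ∨
        (j = 1 ∧ l = 2 ∧ th j l = 0) ∨ (j = 2 ∧ l = 0 ∧ th j l = 1) ∨ (j = 2 ∧ l = 1 ∧ th j l = 0) := by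
        clear * - hjl; revert j l; decide
      rcases this with ⟨h1, h2, h3⟩ | ⟨h1, h2, h3⟩ | ⟨h1, h2, h3⟩ | ⟨h1, h2, h3⟩ | ⟨h1, h2, h3⟩ | ⟨h1, h2, h3⟩ <;>
        rw [h3, h1, h2] <;> ring
    exact this (fun k => sin (vang A k)) j l hjl
  rw [e4] at e3
  have h2 : c * (cnt w 0 * sin (θ 0) + cnt w 1 * sin (θ 1) + cnt w 2 * sin (θ 2)) = C * sin (vang A (th j l)) := by
    rw [h1]; ring
  apply mul_left_cancel₀ (pow_pos hc 2).ne'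
  have h3 := congrArg (· ^ 2) h2
  beta_reduce at h3
  linear_combination (sin (vang A j) * sin (vang A l)) * h3 + sin (vang A (th j l)) * e3
theorem Tl.pick (T : Tl A B θ L) {i j k : Fin 3} (hij : i ≠ j) (hjk : j ≠ k) (hik : i ≠ k) :
    ∃ A' : AB, Tl A' B θ L ∧ A' 0 = A i ∧ A' 1 = A j ∧ A' 2 = A k ∧ ∀ X, isE A' X → isE A X := by
  obtain ⟨p, hp⟩ := perm_of ![i, j, k] (by
    clear * - hij hjk hik
    revert i j k; decide)
  refine ⟨A.reindex p.symm, T.relabelA p.symm, ?_, ?_, ?_, ?_⟩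
  · simp [hp]
  · simp [hp]
  · simp [hp]
  · rintro X ⟨c, h0, h1⟩
    refine ⟨p c, by simpa using h0, fun l hl => ?_⟩
    have := h1 (p.symm l) (by intro h; apply hl; rw [← h]; simp)
    simpa using this
theorem not_I_zero {b : AB} {X : Pt} {k : Fin 3} (h : b.coord k X = 0) : ¬ isI b X := fun h' => by
  have := h' k; linarith
theorem Tl.bd_cases (T : Tl A B θ L) {i : Fin 11} {c k : Fin 3} (h : A.coord k (B i c) = 0) :
    isE A (B i c) ∨ ∃ p, A p = B i c := by
  rcases cases_mem (b := A) (X := B i c) (fun j => T.vmem i c j) with h1 | h1 | h1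
  · exact Or.inr h1
  · exact Or.inl h1
  · exact absurd h1 (not_I_zero h)
def Gd (A : AB) (B : Fin 11 → AB) (e : Fin 3) : Prop :=
  (∀ i c, isE A (B i c) → nv B (B i c) e ≤ 1 ∧ (1 ≤ nv B (B i c) e → ∀ d, nv B (B i c) d = 1)) ∧ ∀ p, nv B (A p) e ≤ 1
theorem Tl.cnext (T : Tl A B θ L) {e k p q r : Fin 3} (hG : Gd A B e) (hek : e ≠ k) (hqr : q ≠ r) (hS : Sgl L k)
    {i l m j l' m'} {w w' : Wd}
    (h : IsSide A B p q ((i,l,m)::(j,l',m')::w)) (h' : IsSide A B p r w')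
    (hk : nv B (A p) k = 1) (hk' : ∀ k', k' ≠ k → nv B (A p) k' = 0) : l' = k := by
  rcases w' with _ | ⟨⟨i2, l2, m2⟩, w'⟩
  · exact absurd rfl h'.ne_nil
  obtain ⟨hi, hl, hl2, e1, e2, e3⟩ := Tl.corner1 hqr h h' hk hk'
  subst hi; subst l; subst l2
  obtain ⟨-, -, hz, -⟩ := T.side_edge (w := []) h'
  have hm2 : m2 = th k m := by
    clear * - e1 e2 e3; revert k m m2; decide
  rw [hm2] at hz
  obtain ⟨-, -, -, -, hE⟩ := T.side_vert (w := []) h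
  have hWe : nv B (B i (th k m)) e ≤ 1 := by
    rcases T.bd_cases hz with hb | ⟨p, hp⟩
    · exact (hG.1 _ _ hb).1
    · rw [← hp]; exact hG.2 p
  have hem : e = m ∨ e = th k m := by
    clear * - hek e1; revert e k m; decide
  refine T.next (w := []) h hS (fun n => T.blk_bd (not_I_zero hz)) ?_ ?_
  · rintro ⟨f1, f2⟩
    rcases hem with h3 | h3
    · have := (hG.1 _ _ hE).1
      rw [h3] at this; omega
    · have := hWe; rw [h3] at this; omega
  · intro f1 f2
    apply (hG.1 _ _ hE).2
    rcases hem with h3 | h3 <;> rw [h3] <;> assumption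
theorem Tl.cang (T : Tl A B θ L) (m : Fin 3) {a b c : ℕ} (h0 : nv B (A m) 0 = a) (h1 : nv B (A m) 1 = b) (h2 : nv B (A m) 2 = c) :
    vang A m = a * θ 0 + b * θ 1 + c * θ 2 := by
  rw [← T.corner m, Fin.sum_univ_three, h0, h1, h2]
theorem Tl.corner_ne (T : Tl A B θ L) (m : Fin 3) : 1 ≤ nv B (A m) 0 + nv B (A m) 1 + nv B (A m) 2 := by
  obtain ⟨i, k, h⟩ := T.corner_mem m
  have := nv_one h
  fin_cases k <;> simp at this <;> omega
theorem Tl.SE (T : Tl A B θ L) {j l : Fin 3} {w : Wd} (h : IsSide A B j l w) {K α β γ x y z δ ν : ℝ} {r0 : ℕ}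
    (h0 : sin (θ 0) = K * α) (h1 : sin (θ 1) = K * β) (h2 : sin (θ 2) = K * γ)
    (hj : sin (vang A j) = K * x) (hl : sin (vang A l) = K * y) (hm : sin (vang A (th j l)) = K * z)
    (hK : 0 < K) (hr : r0 ≤ cnt w 2) {g : ℝ} (hg : g ≠ 0) (e1 : x * y = g * δ) (e2 : α * β * γ * z = g * ν) :
    SE α β γ δ ν r0 (cnt w) := by
  refine ⟨?_, by rw [cnt_sum]; exact (T.side_len h).2, hr⟩
  have := T.beq h
  rw [h0, h1, h2, hj, hl, hm] at this
  apply mul_left_cancel₀ (mul_ne_zero hg (pow_pos hK 4).ne')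
  linear_combination this - K ^ 4 * (cnt w 0 * α + cnt w 1 * β + cnt w 2 * γ) ^ 2 * e1 + 11 * K ^ 4 * e2
theorem Tl.Lsin (T : Tl A B θ L) {K α β γ : ℝ} (hK : 0 < K)
    (h0 : sin (θ 0) = K * α) (h1 : sin (θ 1) = K * β) (h2 : sin (θ 2) = K * γ) :
    ∃ c, 0 < c ∧ L 0 = c * α ∧ L 1 = c * β ∧ L 2 = c * γ := by
  obtain ⟨c, C, hc, -, h, -⟩ := T.bdata
  exact ⟨c * K, mul_pos hc hK, by rw [h, h0, mul_assoc], by rw [h, h1, mul_assoc], by rw [h, h2, mul_assoc]⟩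
def chk (a b : ℕ) (lst : List (List (ℕ × ℕ))) : Bool :=
  (List.range (a+1)).all fun a0 => (List.range (a+1)).all fun a1 => (List.range (b+1)).all fun b0 => (List.range (b+1)).all fun b1 =>
    let u := (a0, b0)
    let v := (a1, b1)
    let w := (a - a0 - a1, b - b0 - b1)
    decide (a < a0 + a1) || decide (b < b0 + b1) || u == (0,0) || v == (0,0) || w == (0,0) || lst.contains [u,v,w] || lst.contains [u,w,v] || lst.contains [v,u,w]
      || lst.contains [v,w,u] || lst.contains [w,u,v] || lst.contains [w,v,u]
theorem Tl.split (T : Tl A B θ L) {a b : ℕ} {lst : List (List (ℕ × ℕ))} (hc : chk a b lst = true) (h0 : kap A B 0 = a)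
    (h1 : kap A B 1 = b) (h2 : kap A B 2 = 0) : ∃ A' : AB, Tl A' B θ L ∧ (∀ X, isE A' X → isE A X) ∧ (∀ m, nv B (A' m) 2 = 0) ∧
      [(nv B (A' 0) 0, nv B (A' 0) 1), (nv B (A' 1) 0, nv B (A' 1) 1), (nv B (A' 2) 0, nv B (A' 2) 1)] ∈ lst := by
  have z : ∀ m, nv B (A m) 2 = 0 := by
    intro m
    rw [kap] at h2
    have : m = 0 ∨ m = 1 ∨ m = 2 := by clear * -; revert m; decide
    rcases this with rfl | rfl | rfl <;> omega
  have key : ∀ {i j k : Fin 3}, i ≠ j → j ≠ k → i ≠ k → [(nv B (A i) 0, nv B (A i) 1), (nv B (A j) 0, nv B (A j) 1), (nv B (A k) 0, nv B (A k) 1)] ∈ lst →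
      ∃ A' : AB, Tl A' B θ L ∧ (∀ X, isE A' X → isE A X) ∧ (∀ m, nv B (A' m) 2 = 0) ∧
      [(nv B (A' 0) 0, nv B (A' 0) 1), (nv B (A' 1) 0, nv B (A' 1) 1), (nv B (A' 2) 0, nv B (A' 2) 1)] ∈ lst := by
    intro i j k hij hjk hik hm
    obtain ⟨A', T', e0, e1, e2, hE⟩ := T.pick hij hjk hik
    refine ⟨A', T', hE, fun m => ?_, by rw [e0, e1, e2]; exact hm⟩
    have : m = 0 ∨ m = 1 ∨ m = 2 := by clear * -; revert m; decide
    rcases this with rfl | rfl | rfl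
    · rw [e0]; exact z _
    · rw [e1]; exact z _
    · rw [e2]; exact z _
  have n0 := T.corner_ne 0
  have n1 := T.corner_ne 1
  have n2 := T.corner_ne 2
  rw [z] at n0 n1 n2
  simp only [kap] at h0 h1
  simp only [chk, List.all_eq_true, List.mem_range] at hc
  have hc := hc (nv B (A 0) 0) (by omega) (nv B (A 1) 0) (by omega) (nv B (A 0) 1) (by omega) (nv B (A 1) 1) (by omega)
  rw [show a - nv B (A 0) 0 - nv B (A 1) 0 = nv B (A 2) 0 by omega, show b - nv B (A 0) 1 - nv B (A 1) 1 = nv B (A 2) 1 by omega] at hc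
  have q0 : ¬ ((nv B (A 0) 0, nv B (A 0) 1) = (0,0)) := by rw [Prod.mk.injEq]; omega
  have q1 : ¬ ((nv B (A 1) 0, nv B (A 1) 1) = (0,0)) := by rw [Prod.mk.injEq]; omega
  have q2 : ¬ ((nv B (A 2) 0, nv B (A 2) 1) = (0,0)) := by rw [Prod.mk.injEq]; omega
  simp only [Bool.or_eq_true, decide_eq_true_eq, beq_iff_eq, q0, q1, q2, or_false, List.contains_iff_mem] at hc
  rcases hc with ((((((h | h) | h) | h) | h) | h) | h) | h
  · omega
  · omega
  · exact key (by decide) (by decide) (by decide) h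
  · exact key (by decide) (by decide) (by decide) h
  · exact key (by decide) (by decide) (by decide) h
  · exact key (by decide) (by decide) (by decide) h
  · exact key (by decide) (by decide) (by decide) h
  · exact key (by decide) (by decide) (by decide) h
theorem fin3 {P : Fin 3 → Prop} (h0 : P 0) (h1 : P 1) (h2 : P 2) (m : Fin 3) : P m := by
  have : m = 0 ∨ m = 1 ∨ m = 2 := by clear * -; revert m; decide
  rcases this with rfl | rfl | rfl <;> assumption
theorem Tl.simfam (T : Tl A B θ L) (c0 : ∀ c, c ≠ 0 → nv B (A 0) c = 0) (c1 : ∀ c, c ≠ 1 → nv B (A 1) c = 0)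
    (v0 : vang A 0 = θ 0) (v1 : vang A 1 = θ 1) (v2 : vang A 2 = θ 2) : ∃ X Y : ℕ, X * L 2 = √11 * L 0 ∧ Y * L 2 = √11 * L 1 := by
  obtain ⟨W, hW⟩ := T.words
  obtain ⟨hs, k, h⟩ := T.sim (fin3 v0 v1 v2) hW
  have hk : k = 0 ∨ k = 1 ∨ k = 2 := by clear * -; revert k; decide
  rcases h with h | ⟨i, hi, h, h'⟩
  · rcases hk with rfl | rfl | rfl
    · exact (row_contra hW (by decide : (1 : Fin 3) ≠ 0) c0 (h 1 (by decide))).elim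
    · exact (row_contra hW (by decide : (0 : Fin 3) ≠ 1) c1 (h 0 (by decide))).elim
    · refine ⟨cnt (W 0) 2, cnt (W 1) 2, ?_, ?_⟩
      · rw [← hs 0, Fin.sum_univ_three, h 0 (by decide) 0 (by decide), h 0 (by decide) 1 (by decide)]; simp
      · rw [← hs 1, Fin.sum_univ_three, h 1 (by decide) 0 (by decide), h 1 (by decide) 1 (by decide)]; simp
  · rcases hk with rfl | rfl | rfl
    · exact (row_contra hW hi c0 h).elim
    · exact (row_contra hW hi c1 h).elim
    · have : i = 0 ∨ i = 1 := by clear * - hi; revert i; decide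
      rcases this with rfl | rfl
      · exact (row_contra hW hi.symm c0 h').elim
      · exact (row_contra hW hi.symm c1 h').elim
theorem nv_oth0 {X : Pt} (h1 : nv B X 1 = 0) (h2 : nv B X 2 = 0) : ∀ c, c ≠ 0 → nv B X c = 0 :=
  fin3 (fun h => absurd rfl h) (fun _ => h1) (fun _ => h2)
theorem nv_oth1 {X : Pt} (h1 : nv B X 0 = 0) (h2 : nv B X 2 = 0) : ∀ c, c ≠ 1 → nv B X c = 0 :=
  fin3 (fun _ => h1) (fun h => absurd rfl h) (fun _ => h2)
theorem nv_oth2 {X : Pt} (h1 : nv B X 0 = 0) (h2 : nv B X 1 = 0) : ∀ c, c ≠ 2 → nv B X c = 0 :=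
  fin3 (fun _ => h1) (fun _ => h2) (fun h => absurd rfl h)
theorem cnt_cons (e : Fin 11 × Fin 3 × Fin 3) (w : Wd) (k : Fin 3) : cnt (e :: w) k = cnt w k + if th e.2.1 e.2.2 = k then 1 else 0 := by
  simp [cnt, List.countP_cons]
theorem cnt_nil (k : Fin 3) : cnt [] k = 0 := rfl
theorem cnt_app (w w' : Wd) (k : Fin 3) : cnt (w ++ w') k = cnt w k + cnt w' k := by simp [cnt]
theorem rv_cons (e : Fin 11 × Fin 3 × Fin 3) (w : Wd) : rv (e :: w) = rv w ++ [(e.1, e.2.2, e.2.1)] := by simp [rv]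
theorem rv_app (w w' : Wd) : rv (w ++ w') = rv w' ++ rv w := by simp [rv]
theorem rv_rv (w : Wd) : rv (rv w) = w := by
  simp only [rv, List.map_reverse, List.reverse_reverse, List.map_map]
  conv_rhs => rw [← List.map_id w]
  rfl
theorem trigR1 {x y z : ℝ} (hx : 0 < x) (hy : 0 < y) (h : x + y + z = π) (h' : 3 * x + y = π) :
    ∃ t, 1 < t ∧ t < 2 ∧ 0 < sin x ∧ sin y = sin x * (t*t-1) ∧ sin z = sin x * t ∧ sin (x + y) = sin x * t := by
  have hz : z = 2 * x := by linarith
  refine ⟨2 * cos x, ?_, ?_, sin_pos_of_pos_of_lt_pi hx (by linarith), ?_, ?_, ?_⟩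
  · have : cos (π/3) < cos x := Real.cos_lt_cos_of_nonneg_of_le_pi (by linarith) (by linarith [pi_pos]) (by linarith)
    rw [cos_pi_div_three] at this; linarith
  · have : cos x < cos 0 := Real.cos_lt_cos_of_nonneg_of_le_pi le_rfl (by linarith) hx
    rw [cos_zero] at this; linarith
  · rw [show y = π - 3 * x by linarith, sin_pi_sub, sin_three_mul]
    have := sin_sq_add_cos_sq x
    linear_combination (-4 * sin x) * this
  · rw [hz, sin_two_mul]; ring
  · rw [show x + y = π - 2 * x by linarith, sin_pi_sub, sin_two_mul]; ring
set_option maxHeartbeats 1000000 in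
theorem famR1 (T : Tl A B θ L) (k0 : kap A B 0 = 3) (k1 : kap A B 1 = 1) (k2 : kap A B 2 = 0)
    (HS : ∀ i c, isE A (B i c) → (∀ d, nv B (B i c) d = 1) ∨ nv B (B i c) 2 = 0) : False := by
  have hke := T.kap_eq
  rw [k0, k1, k2] at hke
  have hsum := T.sum
  have hx := T.pos 0
  have hy := T.pos 1
  push_cast at hke
  obtain ⟨t, t1, t2, hK, s1, s2, s3⟩ := trigR1 hx hy hsum (by linarith)
  have s0 : sin (θ 0) = sin (θ 0) * 1 := by ring
  obtain ⟨c, hc, L0, L1, L2⟩ := T.Lsin hK s0 s1 s2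
  obtain ⟨A', T', hE, hz, hl⟩ := T.split (lst := [[(1,0),(1,0),(1,1)], [(1,0),(0,1),(2,0)]]) (by decide +kernel) k0 k1 k2
  clear k0 k1 k2 T
  replace HS : ∀ i c, isE A' (B i c) → (∀ d, nv B (B i c) d = 1) ∨ nv B (B i c) 2 = 0 := fun i c h => HS i c (hE _ h)
  clear hE
  simp only [List.mem_cons, List.cons.injEq, Prod.mk.injEq, List.not_mem_nil, and_true, or_false] at hl
  rcases hl with hl | hl <;> obtain ⟨⟨a0, a1⟩, ⟨b0, b1⟩, c0, c1⟩ := hl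
  · have v0 := T'.cang 0 a0 a1 (hz 0)
    have v1 := T'.cang 1 b0 b1 (hz 1)
    have v2 := T'.cang 2 c0 c1 (hz 2)
    push_cast at v0 v1 v2
    have S0 : sin (vang A' 0) = sin (θ 0) * 1 := by rw [v0]; ring_nf
    have S1 : sin (vang A' 1) = sin (θ 0) * 1 := by rw [v1]; ring_nf
    have S2 : sin (vang A' 2) = sin (θ 0) * t := by rw [v2, ← s3]; ring_nf
    have hG : Gd A' B 2 := ⟨fun i c h => by
      rcases HS i c h with h | h
      · exact ⟨(h 2).le, fun _ => h⟩
      · exact ⟨by omega, fun h' => by omega⟩, fun p => by rw [hz]; omega⟩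
    have hpig : ∀ {p q w}, IsSide A' B p q w → 1 ≤ cnt w 2 := fun h => T'.pig (fun i j h => (hG.1 i j h).1) h (hz _) (hz _)
    obtain ⟨wl, hwl⟩ := T'.side (show (0 : Fin 3) ≠ 2 by decide)
    obtain ⟨wr, hwr⟩ := T'.side (show (1 : Fin 3) ≠ 2 by decide)
    obtain ⟨wb, hwb⟩ := T'.side (show (0 : Fin 3) ≠ 1 by decide)
    have eb := T'.SE hwb s0 s1 s2 S0 S1 S2 (δ := 1) (ν := (t*t-1)*(t*t)) hK (hpig hwb) one_ne_zero (by ring) (by ring)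
    have el := T'.SE hwl s0 s1 s2 S0 S2 S1 (δ := 1) (ν := t*t-1) hK (hpig hwl) (g := t) (by linarith) (by ring) (by ring)
    have er := T'.SE hwr s0 s1 s2 S1 S2 S0 (δ := 1) (ν := t*t-1) hK (hpig hwr) (g := t) (by linarith) (by ring) (by ring)
    have fl := numR1 t1 t2 el eb
    have fr := numR1 t1 t2 er eb
    have l1 : cnt wl 1 = 0 := by
      simp only [List.mem_cons, Prod.mk.injEq, List.not_mem_nil, or_false] at fl; omega
    have r1 : cnt wr 1 = 0 := by
      simp only [List.mem_cons, Prod.mk.injEq, List.not_mem_nil, or_false] at fr; omega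
    have key : ∀ {p q : Fin 3} {w w' : Wd}, q ≠ 2 → IsSide A' B p q w → IsSide A' B p 2 w' → nv B (A' p) 0 = 1 →
      nv B (A' p) 1 = 0 → cnt w' 1 = 0 → ∃ i w'', w = (i,0,2) :: w'' := by
      intro p q w w' hq h h' n0 n1 hc
      rcases w with _ | ⟨⟨i, l, m⟩, w⟩
      · exact absurd rfl h.ne_nil
      rcases w' with _ | ⟨⟨i', l', m'⟩, w'⟩
      · exact absurd rfl h'.ne_nil
      obtain ⟨-, e1, e2, e3, e4, e5⟩ := Tl.corner1 hq h h' n0 (nv_oth0 n1 (hz _))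
      refine ⟨i, w, ?_⟩
      rw [cnt_cons] at hc
      have h6 : th l' m' ≠ 1 := fun h => by rw [if_pos h] at hc; omega
      have : l = 0 ∧ m = 2 := by clear * - e1 e2 e3 e4 e5 h6; revert l m l' m'; decide
      rw [this.1, this.2]
    obtain ⟨i, u, hu⟩ := key (by decide) hwb hwl a0 a1 l1
    obtain ⟨j, u', hu'⟩ := key (by decide) hwb.rev hwr b0 b1 r1
    have hwb2 : wb = rv u' ++ [(j, 2, 0)] := by rw [← rv_rv wb, hu', rv_cons]
    simp only [List.mem_cons, Prod.mk.injEq, List.not_mem_nil, or_false] at fl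
    have hq2 : 2 ≤ cnt wb 1 := by
      rcases u with _ | ⟨e, u⟩
      · rw [hwb2] at hu
        rcases h : rv u' with _ | ⟨e, u''⟩
        · rw [h] at hu; simp at hu
        · rw [h] at hu; simp at hu
      · rcases h : rv u' with _ | ⟨e', u''⟩
        · rw [h, hu] at hwb2; simp at hwb2
        · rw [h, hu] at hwb2
          simp only [List.cons_append, List.cons.injEq] at hwb2
          rw [hu, hwb2.2, cnt_cons, cnt_app, cnt_cons, cnt_nil]
          simp only [show th 2 0 = 1 by decide, show th 0 2 = 1 by decide, if_true]
          omega
    have hlen := cnt_sum wb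
    have hb : cnt wb 0 = 2 ∧ cnt wb 1 = 2 ∧ cnt wb 2 = 1 ∧ cnt wl 0 = 1 ∧ cnt wl 2 = 2 := by omega
    obtain ⟨hb0, hb1, hb2, hl0, hl2⟩ := hb
    have hS : Sgl L 0 := by
      intro f hf h0
      rw [L0, L1, L2, h0] at hf
      have el := el.eq
      have eb := eb.eq
      rw [hl0, l1, hl2] at el
      rw [hb0, hb1, hb2] at eb
      push_cast at el eb
      have h1 : (f 1 : ℝ) * (t*t-1) + f 2 * t = 1 := by
        apply mul_left_cancel₀ hc.ne'
        push_cast at hf; linear_combination hf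
      have ht : t * t - 1 > 1 := by clear * - el eb t1; nlinarith
      have f2 : f 2 = 0 := by
        by_contra h
        have : (1:ℝ) ≤ f 2 := by exact_mod_cast Nat.one_le_iff_ne_zero.2 h
        have h3 : (0:ℝ) ≤ f 1 := by positivity
        clear * - h1 ht t1 this h3
        nlinarith
      have f1 : f 1 = 0 := by
        by_contra h
        have : (1:ℝ) ≤ f 1 := by exact_mod_cast Nat.one_le_iff_ne_zero.2 h
        have h3 : (0:ℝ) ≤ f 2 := by positivity
        clear * - h1 ht t1 this h3
        nlinarith
      rw [f1, f2] at h1; simp at h1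
    have nx : ∀ {p q : Fin 3} {w w' : Wd} {i e}, q ≠ 2 → IsSide A' B p q ((i,0,2)::e::w) → IsSide A' B p 2 w' → nv B (A' p) 0 = 1 →
      nv B (A' p) 1 = 0 → e.2.1 = 0 := by
      intro p q w w' i e hq h h' n0 n1
      exact T'.cnext hG (by decide) hq hS h h' n0 (nv_oth0 n1 (hz _))
    rw [hb0, hb1, hb2] at hlen
    have hlen' : wb.length = 5 := by omega
    rw [hu] at hlen' hwb hb0
    match u, hlen' with
    | [e1, e2, e3, e4], _ =>
      have g1 := nx (by decide) hwb hwl a0 a1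
      have g2 := hwb.rev
      simp only [rv, List.map_cons, List.map_nil, List.reverse_cons, List.reverse_nil, List.nil_append, List.cons_append] at g2
      have hu4 : e4 = (j, 2, 0) := by
        rw [hu] at hwb2
        have := congrArg List.getLast? hwb2
        simpa using this
      rw [hu4] at g2
      have g3 := nx (by decide) g2 hwr b0 b1
      have t1 : th e1.2.1 e1.2.2 ≠ 0 := by
        have := (T'.side_edge (w := [(i,0,2)]) hwb).1
        clear * - g1 this; rcases e1 with ⟨i, l, m⟩; simp only at *; subst g1; revert m; decide
      have t3 : th e3.2.1 e3.2.2 ≠ 0 := by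
        have := (T'.side_edge (w := [(i,0,2),e1,e2]) hwb).1
        simp only at g3
        clear * - g3 this; rcases e3 with ⟨i, l, m⟩; simp only at *; subst g3; revert l; decide
      rw [hu4] at hb0
      simp only [cnt_cons, cnt_nil, if_neg t1, if_neg t3] at hb0
      rw [if_neg (show ¬ th 2 0 = 0 by decide), if_neg (show ¬ th 0 2 = 0 by decide)] at hb0
      split_ifs at hb0 <;> omega
  · have v0 := T'.cang 0 a0 a1 (hz 0)
    have v1 := T'.cang 1 b0 b1 (hz 1)
    have v2 := T'.cang 2 c0 c1 (hz 2)
    push_cast at v0 v1 v2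
    obtain ⟨X, Y, e1, e2⟩ := T'.simfam (nv_oth0 a1 (hz _)) (nv_oth1 b0 (hz _)) (by linarith) (by linarith) (by linarith)
    rw [L0, L2] at e1
    rw [L1, L2] at e2
    have hs : √11 * √11 = (11:ℝ) := Real.mul_self_sqrt (by norm_num)
    have f1 : X * t = √11 := by apply mul_left_cancel₀ hc.ne'; linear_combination e1
    have f2 : Y * t = √11 * (t*t-1) := by apply mul_left_cancel₀ hc.ne'; linear_combination e2
    have g1 : (X * t) * (X * t) = (11:ℝ) := by rw [f1, hs]
    have g2 : ((X * (X + Y) : ℕ) : ℝ) = (11 : ℕ) := by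
      apply mul_right_cancel₀ (show t * t ≠ 0 by positivity)
      push_cast
      linear_combination g1 + (X * t) * f2 + (√11 * (t*t-1)) * f1 + (t*t-1)*hs
    have g3 : X * (X + Y) = 11 := by exact_mod_cast g2
    have : X ∣ 11 := ⟨_, g3.symm⟩
    rcases (Nat.dvd_prime (by norm_num)).1 this with rfl | rfl
    · norm_num at g1; clear * - g1 t1 t2; nlinarith
    · norm_num at g1; clear * - g1 t1 t2; nlinarith
theorem Tl.rel (T : Tl A B θ L) (σ : Equiv.Perm (Fin 3)) :
    Tl A (fun i => (B i).reindex σ) (fun k => θ (σ.symm k)) (fun k => L (σ.symm k)) :=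
  T.relabel (fun _ => σ) (fun _ _ => rfl) (fun _ _ => rfl)
theorem nv_rel (σ : Equiv.Perm (Fin 3)) (X : Pt) (k : Fin 3) : nv (fun i => (B i).reindex σ) X k = nv B X (σ.symm k) := by
  simp only [nv, AffineBasis.reindex_apply]
  congr
theorem kap_rel (σ : Equiv.Perm (Fin 3)) (k : Fin 3) : kap A (fun i => (B i).reindex σ) k = kap A B (σ.symm k) := by
  simp only [kap, nv_rel]
theorem trigR2 {x y z : ℝ} (hx : 0 < x) (hy : 0 < y) (h : x + y + z = π) (hz : x + y = π / 2) :
    ∃ k t, 0 < k ∧ 0 < t ∧ t < 1 ∧ sin x = k * (1 - t*t) ∧ sin y = k * (t + t) ∧ sin z = k * (1 + t*t) ∧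
      sin (2 * x) * (1 + t*t) = k * (2 * (1-t*t) * (t+t)) := by
  have hC : 0 < cos y := cos_pos_of_mem_Ioo ⟨by linarith, by linarith⟩
  have hS : 0 < sin y := sin_pos_of_pos_of_lt_pi hy (by linarith)
  have h1 := sin_sq_add_cos_sq y
  have hsx : sin x = cos y := by rw [show x = π/2 - y by linarith, sin_pi_div_two_sub]
  have hcx : cos x = sin y := by rw [show x = π/2 - y by linarith, cos_pi_div_two_sub]
  have hsz : sin z = 1 := by rw [show z = π/2 by linarith, sin_pi_div_two]
  have ht : sin y / (1 + cos y) * (1 + cos y) = sin y := by field_simp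
  refine ⟨(1 + cos y)/2, sin y / (1 + cos y), by positivity, by positivity, ?_, ?_⟩
  · rw [div_lt_one (by positivity)]; nlinarith [sin_le_one y]
  generalize sin y / (1 + cos y) = t at *
  have h2 : t * t * (1 + cos y) = 1 - cos y := by
    apply mul_right_cancel₀ (show 1 + cos y ≠ 0 by positivity)
    linear_combination (t * (1 + cos y) + sin y) * ht + h1
  have h3 : sin z = (1 + cos y)/2 * (1 + t*t) := by rw [hsz]; linear_combination -h2/2
  have h4 : sin x = (1 + cos y)/2 * (1 - t*t) := by rw [hsx]; linear_combination h2/2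
  have h5 : sin y = (1 + cos y)/2 * (t+t) := by linear_combination -ht
  refine ⟨h4, h5, h3, ?_⟩
  rw [sin_two_mul, hcx, h4]
  rw [hsz] at h3
  linear_combination (-2) * (1 + cos y)/2 * (1 - t*t) * (1 + t*t) * ht + (-2 * (1-t*t) * (t+t)*((1+cos y)/2)) * h3
theorem caseR2 (T : Tl A B θ L) (hxy : θ 0 + θ 1 = π / 2) (a0 : nv B (A 0) 0 = 2) (a1 : nv B (A 0) 1 = 0) (b0 : nv B (A 1) 0 = 0) (b1 : nv B (A 1) 1 = 1)
    (c0 : nv B (A 2) 0 = 0) (c1 : nv B (A 2) 1 = 1) (hz : ∀ m, nv B (A m) 2 = 0) : False := by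
  obtain ⟨K, t, hK, t1, t2, s0, s1, s2, s3⟩ := trigR2 (T.pos 0) (T.pos 1) T.sum hxy
  have v0 := T.cang 0 a0 a1 (hz 0)
  have v1 := T.cang 1 b0 b1 (hz 1)
  have v2 := T.cang 2 c0 c1 (hz 2)
  push_cast at v0 v1 v2
  have hp : 1 + t*t ≠ 0 := by positivity
  have hq : 1 - t*t ≠ 0 := by nlinarith
  have S0 : sin (vang A 0) = K * (2 * (1-t*t) * (t+t) / (1 + t*t)) := by
    rw [v0, ← mul_div_assoc, eq_div_iff hp, ← s3]; ring_nf
  have S1 : sin (vang A 1) = K * (t+t) := by rw [v1, ← s1]; ring_nf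
  have S2 : sin (vang A 2) = K * (t+t) := by rw [v2, ← s1]; ring_nf
  obtain ⟨wl, hwl⟩ := T.side (show (0 : Fin 3) ≠ 1 by decide)
  obtain ⟨wb, hwb⟩ := T.side (show (1 : Fin 3) ≠ 2 by decide)
  have tp : t + t ≠ 0 := by positivity
  have el := T.SE hwl s0 s1 s2 S0 S1 S2 (δ := 2) (ν := (1+t*t)*(1+t*t)) hK (Nat.zero_le _) (g := (1-t*t)*(t+t)*(t+t)/(1+t*t))
    (by positivity) (by ring) (by field_simp)
  have eb := T.SE hwb s0 s1 s2 S1 S2 S0 (δ := 1) (ν := 2*((1-t*t)*(1-t*t))) hK (Nat.zero_le _) (g := (t+t)*(t+t))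
    (by positivity) (by ring) (by field_simp)
  obtain ⟨-, e⟩ := numR2 t1 t2 el eb
  simp only [Prod.mk.injEq] at e
  have hlen := cnt_sum wb
  match wb, (show wb.length = 1 by omega) with
  | [(i,l,m)], _ =>
    obtain ⟨hlm, h1, -⟩ := side_first hwb
    obtain ⟨-, h2⟩ := side_last (w := []) hwb
    have h3 := e.2.2
    rw [cnt_cons, cnt_nil] at h3
    have h4 : th l m = 2 := by
      by_contra h; rw [if_neg h] at h3; omega
    have n1 := nv_one h1
    have n2 := nv_one h2
    have : (l = 0 ∧ m = 1) ∨ (l = 1 ∧ m = 0) := by clear * - hlm h4; revert l m; decide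
    rcases this with ⟨rfl, rfl⟩ | ⟨rfl, rfl⟩ <;> omega
theorem famR2 (T : Tl A B θ L) (k0 : kap A B 0 = 2) (k1 : kap A B 1 = 2) (k2 : kap A B 2 = 0) : False := by
  have hke := T.kap_eq
  rw [k0, k1, k2] at hke
  have hsum := T.sum
  push_cast at hke
  obtain ⟨A', T', hE, hz, hl⟩ := T.split (lst := [[(2,0),(0,1),(0,1)], [(0,2),(1,0),(1,0)], [(1,0),(0,1),(1,1)]]) (by decide +kernel) k0 k1 k2
  clear k0 k1 k2
  simp only [List.mem_cons, List.cons.injEq, Prod.mk.injEq, List.not_mem_nil, and_true, or_false] at hl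
  rcases hl with hl | hl | hl <;> obtain ⟨⟨a0, a1⟩, ⟨b0, b1⟩, c0, c1⟩ := hl
  · exact caseR2 T' (by linarith) a0 a1 b0 b1 c0 c1 hz
  · refine caseR2 (T'.rel (Equiv.swap 0 1)) ?_ (by rw [nv_rel]; exact a1) (by rw [nv_rel]; exact a0) (by rw [nv_rel]; exact b1) (by rw [nv_rel]; exact b0)
      (by rw [nv_rel]; exact c1) (by rw [nv_rel]; exact c0) (fun m => by rw [nv_rel]; exact hz m)
    change θ 1 + θ 0 = _
    linarith
  · have v0 := T'.cang 0 a0 a1 (hz 0)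
    have v1 := T'.cang 1 b0 b1 (hz 1)
    have v2 := T'.cang 2 c0 c1 (hz 2)
    push_cast at v0 v1 v2
    obtain ⟨K, t, hK, t1, t2, s0, s1, s2, s3⟩ := trigR2 (T.pos 0) (T.pos 1) T.sum (by linarith)
    obtain ⟨c, hc, L0, L1, L2⟩ := T.Lsin hK s0 s1 s2
    obtain ⟨X, Y, e1, e2⟩ := T'.simfam (nv_oth0 a1 (hz _)) (nv_oth1 b0 (hz _)) (by linarith) (by linarith) (by linarith)
    have hs : √11 * √11 = (11:ℝ) := Real.mul_self_sqrt (by norm_num)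
    have hp := T.lpos 2
    have py : L 0 * L 0 + L 1 * L 1 = L 2 * L 2 := by rw [L0, L1, L2]; ring
    have g2 : ((X * X + Y * Y : ℕ) : ℝ) = (11 : ℕ) := by
      apply mul_right_cancel₀ (show L 2 * L 2 ≠ 0 by positivity)
      push_cast
      linear_combination (X * L 2 + √11 * L 0) * e1 + (Y * L 2 + √11 * L 1) * e2 + 11 * py + (L 0 * L 0 + L 1 * L 1) * hs
    have g3 : X * X + Y * Y = 11 := by exact_mod_cast g2
    clear * - g3
    have : X < 4 := by nlinarith
    have : Y < 4 := by nlinarith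
    interval_cases X <;> interval_cases Y <;> omega
theorem cone_ang (b : AB) {l k m : Fin 3} (hlk : l ≠ k) (hmk : m ≠ k) (hlm : l ≠ m) {v : Pt} (hv : v ≠ 0)
    (h1 : 0 ≤ lin b l v) (h2 : 0 ≤ lin b m v) :
    vang b k = InnerProductGeometry.angle (b l - b k) v + InnerProductGeometry.angle v (b m - b k) := by
  rw [← vang_any b hlk hmk hlm]
  apply InnerProductGeometry.angle_eq_angle_add_add_angle_add_of_mem_span hv
  rw [Submodule.mem_span_pair]
  refine ⟨⟨_, h1⟩, ⟨_, h2⟩, ?_⟩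
  simp only [vsub_eq_sub]
  have hd := dec_lin b k v
  have : (l = k + 1 ∧ m = k + 2) ∨ (l = k + 2 ∧ m = k + 1) := by clear * - hlk hmk hlm; revert l k m; decide
  rcases this with ⟨rfl, rfl⟩ | ⟨rfl, rfl⟩
  · exact hd.symm
  · rw [add_comm]; exact hd.symm
theorem Tl.side_pi (T : Tl A B θ L) {p q : Fin 3} {w w' : Wd} {i l m j l' m'}
    (h : IsSide A B p q (w ++ (i, l, m) :: (j, l', m') :: w')) : ∠ (B i l) (B i m) (B j m') = π := by
  obtain ⟨hkl, hl'm', hV, hij, hE⟩ := T.side_vert h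
  obtain ⟨-, c1, c2, c3, s, t, hst, e1, e2⟩ := T.side_edge h
  have h' : IsSide A B p q ((w ++ [(i, l, m)]) ++ (j, l', m') :: w') := by simpa using h
  obtain ⟨-, d1, d2, d3, s', t', hst', f1, f2⟩ := T.side_edge h'
  have hs : s' = t := by
    have h3 : A p + s' • (A q - A p) = A p + t • (A q - A p) := by rw [← f1, ← e2, hV]
    have h4 : (s' - t) • (A q - A p) = 0 := by
      have := add_left_cancel h3
      rw [sub_smul, this, sub_self]
    rcases smul_eq_zero.1 h4 with h | h
    · linarith
    · exact absurd (sub_eq_zero.1 h) (ab_ne _ h'.1.symm)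
  have hs' : B i m = B i l + ((t - s) / (t' - s)) • (B j m' - B i l) := by
    rw [f2, e1, e2]
    have hne : t' - s ≠ 0 := by linarith
    have : A p + t • (A q - A p) = A p + s • (A q - A p) + ((t - s) / (t' - s) * (t' - s)) • (A q - A p) := by
      rw [div_mul_cancel₀ _ hne]; module
    rw [this]; module
  have hsb : Sbtw ℝ (B i l) (B i m) (B j m') := by
    refine ⟨⟨(t - s) / (t' - s), ⟨by apply div_nonneg <;> linarith, by rw [div_le_one] <;> linarith⟩, ?_⟩, ab_ne _ hkl.symm, ?_⟩
    · rw [hs', AffineMap.lineMap_apply]; simp [add_comm]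
    · rw [hV]; exact ab_ne _ hl'm'
  exact hsb.angle₁₂₃_eq_pi
theorem nv_three {X : Pt} {i j r : Fin 11} {k : Fin 3} (hij : i ≠ j) (hir : i ≠ r) (hjr : j ≠ r) (hi : B i k = X) (hj : B j k = X) (hr : B r k = X) :
    3 ≤ nv B X k := by
  unfold nv
  rw [Nat.succ_le_iff, Finset.two_lt_card]
  exact ⟨i, by simpa using hi, j, by simpa using hj, r, by simpa using hr, hij, hir, hjr⟩
theorem Lex3.nn {c p q : ℝ} (h : Lex3 c p q) : 0 ≤ c := by
  rcases h with h | h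
  · exact h.le
  · exact h.1.ge
theorem Lex3.nn1 {c p q : ℝ} (h : Lex3 c p q) (hc : c = 0) : 0 ≤ p := by
  rcases h with h | ⟨-, h | h⟩
  · linarith
  · exact h.le
  · exact h.1.ge
theorem Tl.fan (T : Tl A B θ L) {p q : Fin 3} {w w' : Wd} {i j r : Fin 11}
    (h : IsSide A B p q (w ++ (i,1,2) :: (j,1,0) :: w')) (hn : ∀ c, nv B (B i 2) c = 1) (hr0 : B r 0 = B i 2) (hr2 : B r 2 = B i 0) :
    ∃ τ : ℝ, 0 < τ ∧ B j 2 = B i 2 + τ • (B r 1 - B i 2) := by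
  obtain ⟨-, -, hV, hij, hE⟩ := T.side_vert h
  have hpi := T.side_pi h
  have h' : IsSide A B p q ((w ++ [(i, 1, 2)]) ++ (j, 1, 0) :: w') := by simpa using h
  obtain ⟨-, d1, d2, d3, -⟩ := T.side_edge h'
  have hu : B j 2 - B i 2 ≠ 0 := by rw [hV]; exact sub_ne_zero.2 (ab_ne _ (by decide))
  have a2 := angle_add_angle_eq_pi_of_angle_eq_pi (B j 2) hpi
  have a3 : ∠ (B j 2) (B i 2) (B j 0) = θ 1 := by
    rw [hV, vang_any _ (by decide) (by decide) (by decide), T.ang]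
  rw [a3] at a2
  have hsum := T.sum
  have hp0 := T.pos 0
  have hG : G A (B i 2) (B j 2 - B i 2) (B j 1 - B j 0) := by
    intro c
    obtain ⟨c0, g0, g1⟩ := hE
    by_cases hc : c = c0
    · subst hc
      have : th p q = c := by
        by_contra hne; have := g1 _ hne; rw [hV] at this; linarith
      right
      refine ⟨g0, Or.inl ?_⟩
      rw [lin_sub, g0, ← this]
      rw [sub_zero]; exact d3
    · exact Or.inl (g1 c hc)
  obtain ⟨x, hx⟩ := germ T.mem hG
  have hnI := not_I_of_E hE
  rcases cases_mem (b := B x) (X := B i 2) (fun k => (hx k).nn) with ⟨k, hk⟩ | h1 | h1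
  · have : k = 0 ∨ k = 1 ∨ k = 2 := by clear * -; revert k; decide
    have hc0 : ∀ c, c ≠ k → (B x).coord c (B i 2) = 0 := by
      intro c hc; rw [← hk, coord_vert, if_neg hc]
    rcases this with rfl | rfl | rfl
    · have hxr := nv_uniq (hn 0).le hk hr0
      subst hxr
      have ca := cone_ang (B x) (l := 2) (k := 0) (m := 1) (by decide) (by decide) (by decide) hu ((hx 2).nn1 (hc0 2 (by decide))) ((hx 1).nn1 (hc0 1 (by decide)))
      have tr := angle_le_angle_add_angle (B i 2) (B i 1) (B i 0) (B j 2)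
      rw [vang_any _ (by decide) (by decide) (by decide), T.ang, angle_comm] at tr
      rw [T.ang, hk, hr2] at ca
      change θ 0 = ∠ (B i 0) (B i 2) (B j 2) + _ at ca
      have hz : InnerProductGeometry.angle (B j 2 - B i 2) (B x 1 - B i 2) = 0 := by
        have := InnerProductGeometry.angle_nonneg (B j 2 - B i 2) (B x 1 - B i 2)
        linarith
      obtain ⟨-, ρ, hρ, e⟩ := InnerProductGeometry.angle_eq_zero_iff.1 hz
      refine ⟨ρ⁻¹, by positivity, ?_⟩
      rw [e, smul_smul, inv_mul_cancel₀ hρ.ne', one_smul]; abel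
    · have hxr := nv_uniq (hn 1).le hk hV.symm
      subst hxr
      exfalso
      rcases hx 0 with h2 | ⟨-, h2 | ⟨-, h2⟩⟩
      · rw [hc0 0 (by decide)] at h2; linarith
      · rw [lin_sub, hc0 0 (by decide), coord_vert, if_neg (by decide)] at h2; linarith
      · rw [lin_sub, coord_vert, coord_vert, if_neg (by decide), if_pos rfl] at h2; linarith
    · have hxr := nv_uniq (hn 2).le hk rfl
      subst hxr
      exfalso
      have ca := cone_ang (B x) (l := 1) (k := 2) (m := 0) (by decide) (by decide) (by decide) hu ((hx 1).nn1 (hc0 1 (by decide))) ((hx 0).nn1 (hc0 0 (by decide)))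
      rw [T.ang] at ca
      change θ 2 = ∠ (B x 1) (B x 2) (B j 2) + _ at ca
      rw [angle_comm] at ca
      have := InnerProductGeometry.angle_nonneg (B j 2 - B x 2) (B x 0 - B x 2)
      linarith
  · exact absurd h1 (T.noE i x 2 hnI)
  · exact absurd h1 (T.noI_of_bd hnI)
theorem coord_pos_or (T : Tl A B θ L) {p q : Fin 3} {w w' : Wd} {i l m} (h : IsSide A B p q (w ++ (i,l,m) :: w')) {X : Pt}
    (hE : isE A X) (hX : A.coord (th p q) X = 0) (c : Fin 3) : 0 < A.coord c X ∨ 0 < A.coord c (B i (th l m)) := by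
  obtain ⟨-, -, -, c3, -⟩ := T.side_edge h
  obtain ⟨c0, g0, g1⟩ := hE
  by_cases hc : c = c0
  · have : th p q = c0 := by
      by_contra hne; have := g1 _ hne; linarith
    rw [hc, ← this]; exact Or.inr c3
  · exact Or.inl (g1 c hc)
theorem caseR3a (T : Tl A B θ L) (hang : 2 * θ 0 + 3 * θ 1 = π) (HS : ∀ i c, isE A (B i c) → (∀ d, nv B (B i c) d = 1) ∨ (nv B (B i c) 0 = 2 ∧ nv B (B i c) 2 = 0))
    (a0 : nv B (A 0) 1 = 1) (a1 : ∀ c, c ≠ 1 → nv B (A 0) c = 0) {i j k o : Fin 11} {wl : Wd} (hwl : IsSide A B 0 2 wl)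
    (h : IsSide A B 0 1 [(i,1,2),(j,1,0),(k,0,1),(o,2,1)]) (hL : L 0 < L 2) (hS : Sgl L 1) : False := by
  rcases wl with _ | ⟨⟨i', l', m'⟩, wl⟩
  · exact absurd rfl hwl.ne_nil
  obtain ⟨e1, -, e2, -, e3, e4⟩ := Tl.corner1 (by decide) h hwl a0 a1
  have e5 : m' = 0 := by clear * - e3 e4; revert m'; decide
  subst e1; subst e2; subst e5
  obtain ⟨-, -, hW1, -⟩ := T.side_edge (w := []) hwl
  obtain ⟨-, -, hV, hij, hE⟩ := T.side_vert (w := []) h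
  obtain ⟨-, -, hcV, -⟩ := T.side_edge (w := []) h
  have hnV : ∀ d, nv B (B i 2) d = 1 := by
    rcases HS _ _ hE with h1 | ⟨-, h1⟩
    · exact h1
    · have := nv_one (rfl : B i 2 = B i 2); omega
  obtain ⟨r, hri, -, hr⟩ := T.opp1 i (l := 2) (m := 0) (by decide) (coord_pos_or T (w := []) h hE hcV) (T.blk_bd (not_I_of_E hE))
    (T.blk_bd (not_I_zero hW1)) hS
  have hr : B r 0 = B i 2 ∧ B r 2 = B i 0 := by
    rcases hr with ⟨r1, r2⟩ | hr
    · exact absurd (nv_uniq (hnV 2).le r1 rfl) hri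
    · exact hr
  obtain ⟨τ, hτ, hU⟩ := T.fan (w := []) h hnV hr.1 hr.2
  have hd1 : dist (B i 2) (B j 2) = L 0 := by rw [hV, dist_th (T.len j) (by decide)]; rfl
  have hd2 : dist (B i 2) (B r 1) = L 2 := by rw [← hr.1, dist_th (T.len r) (by decide)]; rfl
  have hτ1 : τ < 1 := by
    rw [hU, dist_eq_norm, show B i 2 - (B i 2 + τ • (B r 1 - B i 2)) = τ • (B i 2 - B r 1) by module, norm_smul, ← dist_eq_norm, hd2, Real.norm_of_nonneg hτ.le] at hd1
    have := T.lpos 2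
    by_contra h5; push Not at h5
    nlinarith
  have hcr : ∀ c, (B r).coord c (B j 2) = (B r).coord c (B r 0) + τ * ((B r).coord c (B r 1) - (B r).coord c (B r 0)) := by
    intro c
    rw [hU, coord_add, map_smul, lin_sub, hr.1, smul_eq_mul]
  have h2 : IsSide A B 0 1 ([(i,1,2)] ++ (j,1,0) :: [(k,0,1),(o,2,1)]) := h
  obtain ⟨-, -, hM, hjk, hEM⟩ := T.side_vert h2
  obtain ⟨-, -, hcM, -⟩ := T.side_edge h2
  have hnM : nv B (B j 0) 0 = 2 ∧ nv B (B j 0) 2 = 0 := by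
    rcases HS _ _ hEM with h1 | h1
    · have := nv_two hjk rfl hM.symm
      have := h1 0; omega
    · exact h1
  have hpiM := T.side_pi h2
  have hblk : ∀ n, Blk B (B j 2 - B j 0) n (B j 2) := by
    intro n
    refine T.blk_E (j := r) (c := 2) ?_ ?_ ?_
    · rw [hcr]; simp
    · refine fin3 (fun _ => ?_) (fun _ => ?_) (fun h => absurd rfl h)
      · rw [hcr]; simp; exact hτ1
      · rw [hcr]; simp; exact hτ
    · rw [lin_sub, hcr]
      simp only [coord_vert, Fin.isValue, show ¬ ((2 : Fin 3) = 0) by decide, show ¬ ((2 : Fin 3) = 1) by decide, if_false]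
      intro h5
      have h6 : (B r).coord 2 (B j 0) = 0 := by linarith
      have h7 : B j 0 - B i 2 = (lin (B r) 1 (B j 0 - B i 2)) • (B r 1 - B i 2) := by
        have := dec_lin (B r) 0 (B j 0 - B i 2)
        simp only [Fin.isValue, zero_add] at this
        rw [lin_sub (B r) 2, h6, ← hr.1, coord_vert, if_neg (by decide)] at this
        rw [← hr.1]
        simpa using this
      have h8 := congrArg (lin (B j) 0) h7
      have h9 := congrArg (lin (B j) 0) hU
      have h10 : lin (B j) 0 (B j 2 - B i 2) = τ * lin (B j) 0 (B r 1 - B i 2) := by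
        rw [hU]; simp
      rw [hV, lin_sub, coord_vert, coord_vert, if_neg (by decide), if_neg (by decide)] at h10
      have h11 : lin (B j) 0 (B r 1 - B j 1) = 0 := by
        rcases mul_eq_zero.1 (show τ * lin (B j) 0 (B r 1 - B j 1) = 0 by linarith) with h | h
        · linarith
        · exact h
      rw [map_smul, hV, h11, lin_sub, coord_vert, coord_vert, if_pos rfl, if_neg (by decide)] at h8
      norm_num at h8
  obtain ⟨x, hxj, -, hx⟩ := T.opp1 j (l := 0) (m := 2) (by decide) (coord_pos_or T h2 hEM hcM) (T.blk_bd (not_I_of_E hEM))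
    (hblk _) hS
  rcases hx with ⟨x1, x2⟩ | ⟨x1, x2⟩
  · have hxk : x = k := by
      by_contra hne
      have := nv_three hjk hxj.symm (Ne.symm hne) rfl hM.symm x1
      omega
    subst hxk
    have a2 := angle_add_angle_eq_pi_of_angle_eq_pi (B j 2) hpiM
    rw [vang_any _ (by decide) (by decide) (by decide), T.ang, ← x1, ← x2, vang_any _ (by decide) (by decide) (by decide), T.ang] at a2
    have := T.pos 1
    linarith
  · have := nv_one x1; omega
theorem trigR3 {x y z : ℝ} (hx : 0 < x) (hy : 0 < y) (h : x + y + z = π) (hz : 2 * x + 3 * y = π) :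
    ∃ k s, 0 < k ∧ 0 < s ∧ s < 1 ∧ sin x = k * (1 - s*s) ∧ sin y = k * s ∧ sin z = k * 1 ∧
      sin (2 * y) = k * (s * (2 - s*s)) ∧ sin (3 * y) = k * (s * ((1-s*s) * (3 - s*s))) ∧ sin (x + y) = k * 1 := by
  obtain ⟨u, rfl⟩ : ∃ u, y = 2 * u := ⟨y/2, by ring⟩
  have h1 := sin_sq_add_cos_sq u
  have hs : 0 < sin u := sin_pos_of_pos_of_lt_pi (by linarith) (by linarith)
  have hc : 0 < cos u := cos_pos_of_mem_Ioo ⟨by linarith, by linarith⟩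
  have h2 : cos (2 * u) = 1 - 2 * (sin u)^2 := by rw [cos_two_mul]; linarith
  have h3 : sin (2 * u) = cos u * (2 * sin u) := by rw [sin_two_mul]; ring
  refine ⟨cos u, 2 * sin u, hc, by linarith, ?_, ?_, h3, ?_, ?_, ?_, ?_⟩
  · have : sin u < sin (π/6) := sin_lt_sin_of_lt_of_le_pi_div_two (by linarith) (by linarith) (by linarith)
    rw [sin_pi_div_six] at this; linarith
  · rw [show x = π/2 - 3 * u by linarith, sin_pi_div_two_sub, cos_three_mul]
    linear_combination 4 * cos u * h1
  · rw [show z = u + π/2 by linarith, sin_add_pi_div_two]; ring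
  · rw [sin_two_mul, h3, h2]; ring
  · rw [sin_three_mul, h3]
    linear_combination (-32 * sin u ^ 3 * cos u) * h1
  · rw [show x + 2*u = π/2 - u by linarith, sin_pi_div_two_sub]; ring
theorem caseR3b (T : Tl A B θ L) (hG : Gd A B 2) (b0 : nv B (A 1) 0 = 1) (b1 : ∀ c, c ≠ 0 → nv B (A 1) c = 0)
    (c0 : nv B (A 2) 0 = 1) (c1 : ∀ c, c ≠ 0 → nv B (A 2) c = 0) {w : Wd} (h : IsSide A B 1 2 w) (hS : Sgl L 0)
    (hl : w.length ≤ 4) (hl' : 3 ≤ w.length) (hw : cnt w 0 ≠ 0) : False := by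
  obtain ⟨w', hw'⟩ := T.side (show (1 : Fin 3) ≠ 0 by decide)
  obtain ⟨w'', hw''⟩ := T.side (show (2 : Fin 3) ≠ 0 by decide)
  have edge : ∀ {u u' : Wd} {i l m}, IsSide A B 1 2 (u ++ (i,l,m) :: u') → l = 0 ∨ m = 0 → th l m ≠ 0 := by
    intro u u' i l m h h1
    have := (T.side_edge h).1
    clear * - h1 this; revert l m; decide
  have f1 : ∀ {e e' : Fin 11 × Fin 3 × Fin 3} {u : Wd}, IsSide A B 1 2 (e :: e' :: u) → e.2.1 = 0 ∧ e'.2.1 = 0 := by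
    rintro ⟨i, l, m⟩ ⟨i', l', m'⟩ u h
    refine ⟨?_, T.cnext hG (by decide) (by decide) hS h hw' b0 b1⟩
    have := side_first h
    by_contra hne
    have h3 := nv_one this.2.1
    rw [b1 _ hne] at h3; omega
  have f2 : ∀ {e e' : Fin 11 × Fin 3 × Fin 3} {u : Wd}, IsSide A B 2 1 (e :: e' :: u) → e.2.1 = 0 ∧ e'.2.1 = 0 := by
    rintro ⟨i, l, m⟩ ⟨i', l', m'⟩ u h
    refine ⟨?_, T.cnext hG (by decide) (by decide) hS h hw'' c0 c1⟩
    have := side_first h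
    by_contra hne
    have h3 := nv_one this.2.1
    rw [c1 _ hne] at h3; omega
  have hr := h.rev
  apply hw
  match w, (show w.length = 3 ∨ w.length = 4 by omega) with
  | [e1, e2, e3], _ =>
    have g1 := f1 h
    have g2 := f2 hr
    simp only [cnt_cons, cnt_nil]
    rw [if_neg (edge (u := []) h (Or.inl g1.1)), if_neg (edge (u := [e1]) h (Or.inl g1.2)), if_neg (edge (u := [e1,e2]) h (Or.inr g2.1))]
  | [e1, e2, e3, e4], _ =>
    have g1 := f1 h
    have g2 := f2 hr
    simp only [cnt_cons, cnt_nil]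
    rw [if_neg (edge (u := []) h (Or.inl g1.1)), if_neg (edge (u := [e1]) h (Or.inl g1.2)), if_neg (edge (u := [e1,e2]) h (Or.inr g2.2)), if_neg (edge (u := [e1,e2,e3]) h (Or.inr g2.1))]
theorem corner_a {p q r : Fin 3} {w w' : Wd} (hqr : q ≠ r) (h : IsSide A B p q w) (h' : IsSide A B p r w') (n1 : nv B (A p) 1 = 1)
    (n2 : ∀ c, c ≠ 1 → nv B (A p) c = 0) (hc : cnt w' 0 = 0) : ∃ i w'', w = (i,1,2) :: w'' := by
  rcases w with _ | ⟨⟨i, l, m⟩, w⟩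
  · exact absurd rfl h.ne_nil
  rcases w' with _ | ⟨⟨i', l', m'⟩, w'⟩
  · exact absurd rfl h'.ne_nil
  obtain ⟨-, e1, e2, e3, e4, e5⟩ := Tl.corner1 hqr h h' n1 n2
  refine ⟨i, w, ?_⟩
  rw [cnt_cons] at hc
  have h6 : th l' m' ≠ 0 := fun h => by rw [if_pos h] at hc; omega
  have : l = 1 ∧ m = 2 := by clear * - e1 e2 e3 e4 e5 h6; revert l m l' m'; decide
  rw [this.1, this.2]
theorem caseR30 (T : Tl A B θ L) (hang : 2 * θ 0 + 3 * θ 1 = π) (HS : ∀ i c, isE A (B i c) → (∀ d, nv B (B i c) d = 1) ∨ (nv B (B i c) 0 = 2 ∧ nv B (B i c) 2 = 0))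
    (a0 : nv B (A 0) 1 = 1) (a1 : ∀ c, c ≠ 1 → nv B (A 0) c = 0) (b0 : nv B (A 1) 1 = 1) (b1 : ∀ c, c ≠ 1 → nv B (A 1) c = 0) 
    (hG : Gd A B 2) {wl wr wb : Wd} (hwl : IsSide A B 0 2 wl) (hwr : IsSide A B 1 2 wr) (h : IsSide A B 0 1 wb) (hl : cnt wl 0 = 0) (hr : cnt wr 0 = 0)
    (hb1 : cnt wb 1 = 0) (hb : cnt wb 0 = 1 ∧ cnt wb 2 = 1 ∨ cnt wb 0 = 2 ∧ cnt wb 2 = 2 ∧ Sgl L 1 ∧ L 0 < L 2) : False := by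
  have hlen := cnt_sum wb
  obtain ⟨i, u, hu⟩ := corner_a (by decide) h hwl a0 a1 hl
  obtain ⟨j, u', hu'⟩ := corner_a (by decide) h.rev hwr b0 b1 hr
  have h2 : wb = rv u' ++ [(j, 2, 1)] := by rw [← rv_rv wb, hu', rv_cons]
  have hlast : wb.getLast? = some (j,2,1) := by rw [h2]; simp
  clear h2 hu'
  rcases hb with ⟨hb0, hb2⟩ | ⟨hb0, hb2, hS, hL⟩
  · match wb, (show wb.length = 2 by omega) with
    | [e1, e2], _ =>
      simp only [List.getLast?_cons_cons, List.getLast?_singleton, Option.some.injEq] at hlast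
      simp only [List.cons.injEq] at hu
      rw [hlast, hu.1] at hb0
      simp only [cnt_cons, cnt_nil] at hb0
      rw [if_pos (show th 2 1 = 0 by decide), if_pos (show th 1 2 = 0 by decide)] at hb0; omega
  · match wb, (show wb.length = 4 by omega) with
    | [e1, e2, e3, e4], _ =>
      simp only [List.getLast?_cons_cons, List.getLast?_singleton, Option.some.injEq] at hlast
      simp only [List.cons.injEq] at hu
      obtain ⟨hu1, -⟩ := hu
      subst hu1; subst hlast
      have g1 : e2.2.1 = 1 := T.cnext hG (by decide) (by decide) hS h hwl a0 a1
      have g2 : e3.2.2 = 1 := T.cnext hG (by decide) (by decide) hS h.rev hwr b0 b1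
      have k2 := (T.side_edge (w := [(i,1,2)]) h).1
      have k3 := (T.side_edge (w := [(i,1,2),e2]) h).1
      obtain ⟨i2, l2, m2⟩ := e2
      obtain ⟨i3, l3, m3⟩ := e3
      simp only at g1 g2
      subst l2; subst m3
      simp only [cnt_cons, cnt_nil] at hb0
      have hm : m2 = 0 ∧ l3 = 0 := by
        rw [if_pos (show th 2 1 = 0 by decide), if_pos (show th 1 2 = 0 by decide)] at hb0
        have g2 : th 1 m2 ≠ 0 := fun h => by rw [if_pos h] at hb0; omega
        have g3 : th l3 1 ≠ 0 := fun h => by rw [if_pos h] at hb0; omega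
        simp only at k2 k3
        clear * - g2 g3 k2 k3
        revert m2 l3; decide
      obtain ⟨rfl, rfl⟩ := hm
      exact caseR3a T hang HS a0 a1 hwl h hL hS
set_option maxHeartbeats 1000000 in
theorem famR3 (T : Tl A B θ L) (k0 : kap A B 0 = 2) (k1 : kap A B 1 = 3) (k2 : kap A B 2 = 0)
    (HS : ∀ i c, isE A (B i c) → (∀ d, nv B (B i c) d = 1) ∨ (nv B (B i c) 0 = 2 ∧ nv B (B i c) 2 = 0)) : False := by
  have hke := T.kap_eq
  rw [k0, k1, k2] at hke
  have hsum := T.sum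
  have hx := T.pos 0
  have hy := T.pos 1
  push_cast at hke
  have hang : 2 * θ 0 + 3 * θ 1 = π := by linarith
  obtain ⟨k, s, hK, p0, p1, s0, s1, s2, d2, d3, dxy⟩ := trigR3 hx hy hsum hang
  have d2x : sin (2 * θ 0) = k * (s * ((1-s*s) * (3 - s*s))) := by
    rw [← d3, show 2 * θ 0 = π - 3 * θ 1 by linarith, sin_pi_sub]
  obtain ⟨c, hc, L0, L1, L2⟩ := T.Lsin hK s0 s1 s2
  obtain ⟨A', T', hE, hz, hl⟩ := T.split (lst := [[(0,1),(0,1),(2,1)],[(0,1),(0,2),(2,0)],[(0,1),(1,1),(1,1)],[(1,0),(0,1),(1,2)],[(0,2),(1,0),(1,1)],[(0,3),(1,0),(1,0)]]) (by decide +kernel) k0 k1 k2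
  clear k0 k1 k2 T
  replace HS : ∀ i c, isE A' (B i c) → (∀ d, nv B (B i c) d = 1) ∨ (nv B (B i c) 0 = 2 ∧ nv B (B i c) 2 = 0) := fun i c h => HS i c (hE _ h)
  clear hE
  have hG : Gd A' B 2 := ⟨fun i c h => by
    rcases HS i c h with h | h
    · exact ⟨(h 2).le, fun _ => h⟩
    · exact ⟨by omega, fun h' => by omega⟩, fun p => by rw [hz]; omega⟩
  have hpig : ∀ {p q w}, IsSide A' B p q w → 1 ≤ cnt w 2 := fun h => T'.pig (fun i j h => (hG.1 i j h).1) h (hz _) (hz _)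
  obtain ⟨w2, h2⟩ := T'.side (show (0 : Fin 3) ≠ 1 by decide)
  obtain ⟨w1, h1⟩ := T'.side (show (0 : Fin 3) ≠ 2 by decide)
  obtain ⟨w0, h0⟩ := T'.side (show (1 : Fin 3) ≠ 2 by decide)
  have q1 : 0 < 1 - s * s := by nlinarith
  have g1 : s * s ≠ 0 := by positivity
  have g2 : s * s * (1 - s * s) ≠ 0 := by positivity
  simp only [List.mem_cons, List.cons.injEq, Prod.mk.injEq, List.not_mem_nil, and_true, or_false] at hl
  rcases hl with hl | hl | hl | hl | hl | hl <;> obtain ⟨⟨a0, a1⟩, ⟨b0, b1⟩, c0, c1⟩ := hl <;>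
  ( have v0 := T'.cang 0 a0 a1 (hz 0)
    have v1 := T'.cang 1 b0 b1 (hz 1)
    have v2 := T'.cang 2 c0 c1 (hz 2)
    push_cast at v0 v1 v2 )
  · have S0 : sin (vang A' 0) = k * s := by rw [v0, ← s1]; ring_nf
    have S1 : sin (vang A' 1) = k * s := by rw [v1, ← s1]; ring_nf
    have S2 : sin (vang A' 2) = k * (s * (2 - s*s)) := by rw [v2, ← d2, ← sin_pi_sub]; congr 1; linarith
    have e2 := T'.SE h2 s0 s1 s2 S0 S1 S2 (δ := 1) (ν := (1-s*s)*(2-s*s)) hK (hpig h2) g1 (by ring) (by ring)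
    have e1 := T'.SE h1 s0 s1 s2 S0 S2 S1 (δ := 2-s*s) (ν := 1-s*s) hK (hpig h1) g1 (by ring) (by ring)
    have e0 := T'.SE h0 s0 s1 s2 S1 S2 S0 (δ := 2-s*s) (ν := 1-s*s) hK (hpig h0) g1 (by ring) (by ring)
    have f1 := numR30 p0 p1 e1 e2
    have f0 := numR30 p0 p1 e0 e2
    simp only [List.mem_cons, Prod.mk.injEq, List.not_mem_nil, or_false] at f0 f1
    refine caseR30 T' hang HS a1 (nv_oth1 a0 (hz _)) b1 (nv_oth1 b0 (hz _)) hG h1 h0 h2 (by omega) (by omega) (by omega) ?_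
    rcases f1 with f1 | f1
    · left; omega
    · right
      have e := e1.eq
      rw [f1.1.1, f1.1.2.1, f1.1.2.2] at e
      push_cast at e
      have hq : 7 * (s * s) = 3 := by linarith
      refine ⟨by omega, by omega, ?_, ?_⟩
      · intro f hf h
        rw [L0, L1, L2, h] at hf
        have h1 : (4 * f 0 + 7 * f 2 : ℝ) = 7 * s := by
          apply mul_left_cancel₀ hc.ne'
          push_cast at hf; linear_combination 7 * hf + c * f 0 * hq
        have h2 : ((4 * f 0 + 7 * f 2) * (4 * f 0 + 7 * f 2) : ℝ) = 21 := by rw [h1]; linear_combination 7 * hq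
        have h3 : (4 * f 0 + 7 * f 2) * (4 * f 0 + 7 * f 2) = 21 := by exact_mod_cast h2
        clear * - h3
        generalize 4 * f 0 + 7 * f 2 = m at h3
        have : m ≤ 4 := by nlinarith
        interval_cases m <;> omega
      · rw [L0, L2]; apply mul_lt_mul_of_pos_left _ hc; linarith
  · have S0 : sin (vang A' 0) = k * s := by rw [v0, ← s1]; ring_nf
    have S1 : sin (vang A' 1) = k * (s * (2 - s*s)) := by rw [v1, ← d2]; ring_nf
    have S2 : sin (vang A' 2) = k * (s * ((1-s*s) * (3 - s*s))) := by rw [v2, ← d2x]; ring_nf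
    have e2 := T'.SE h2 s0 s1 s2 S0 S1 S2 (δ := 2-s*s) (ν := (1-s*s)*(1-s*s)*(3-s*s)) hK (hpig h2) g1 (by ring) (by ring)
    have e1 := T'.SE h1 s0 s1 s2 S0 S2 S1 (δ := 3-s*s) (ν := 2-s*s) hK (hpig h1) g2 (by ring) (by ring)
    have e0 := T'.SE h0 s0 s1 s2 S1 S2 S0 (δ := (2-s*s)*(3-s*s)) (ν := 1) hK (hpig h0) g2 (by ring) (by ring)
    exact numR31 p0 p1 e0 e1 e2
  · have S0 : sin (vang A' 0) = k * s := by rw [v0, ← s1]; ring_nf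
    have S1 : sin (vang A' 1) = k * 1 := by rw [v1, ← dxy]; ring_nf
    have S2 : sin (vang A' 2) = k * 1 := by rw [v2, ← dxy]; ring_nf
    have e1 := T'.SE h1 s0 s1 s2 S0 S2 S1 (δ := 1) (ν := 1-s*s) hK (hpig h1) p0.ne' (by ring) (by ring)
    have e0 := T'.SE h0 s0 s1 s2 S1 S2 S0 (δ := 1) (ν := (1-s*s)*(s*s)) hK (hpig h0) one_ne_zero (by ring) (by ring)
    exact numR32 p0 p1 e0 e1
  · obtain ⟨X, Y, e1, e2⟩ := T'.simfam (nv_oth0 a1 (hz _)) (nv_oth1 b0 (hz _)) (by linarith) (by linarith) (by linarith)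
    rw [L0, L2] at e1
    rw [L1, L2] at e2
    have hs : √11 * √11 = (11:ℝ) := Real.mul_self_sqrt (by norm_num)
    have f1 : X = √11 * (1 - s * s) := by apply mul_left_cancel₀ hc.ne'; linear_combination e1
    have f2 : Y = √11 * s := by apply mul_left_cancel₀ hc.ne'; linear_combination e2
    have := irr_lin irr11 (a := X) (b := 11 - Y * Y) (by
      push_cast; rw [f1, f2]; linear_combination hs)
    have hX : X = 0 := by exact_mod_cast this.1
    rw [hX] at f1
    have : 0 < √11 * (1 - s*s) := by positivity
    simp only [Nat.cast_zero] at f1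
    linarith
  · have S0 : sin (vang A' 0) = k * (s * (2 - s*s)) := by rw [v0, ← d2]; ring_nf
    have S1 : sin (vang A' 1) = k * (1-s*s) := by rw [v1, ← s0]; ring_nf
    have S2 : sin (vang A' 2) = k * 1 := by rw [v2, ← dxy]; ring_nf
    have e2 := T'.SE h2 s0 s1 s2 S0 S1 S2 (δ := 2-s*s) (ν := 1) hK (hpig h2) (g := s * (1 - s*s)) (by positivity) (by ring) (by ring)
    have e1 := T'.SE h1 s0 s1 s2 S0 S2 S1 (δ := 2-s*s) (ν := (1-s*s)*(1-s*s)) hK (hpig h1) p0.ne' (by ring) (by ring)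
    have e0 := T'.SE h0 s0 s1 s2 S1 S2 S0 (δ := 1) (ν := s*s*(2-s*s)) hK (hpig h0) q1.ne' (by ring) (by ring)
    exact numR33 p0 p1 e0 e1 e2
  · have S0 : sin (vang A' 0) = k * (s * ((1-s*s) * (3 - s*s))) := by rw [v0, ← d3]; ring_nf
    have S1 : sin (vang A' 1) = k * (1-s*s) := by rw [v1, ← s0]; ring_nf
    have S2 : sin (vang A' 2) = k * (1-s*s) := by rw [v2, ← s0]; ring_nf
    have e1 := T'.SE h1 s0 s1 s2 S0 S2 S1 (δ := 3-s*s) (ν := 1) hK (hpig h1) (g := s * ((1 - s*s)*(1-s*s))) (by positivity) (by ring) (by ring)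
    have e0 := T'.SE h0 s0 s1 s2 S1 S2 S0 (δ := 1) (ν := s*s*(3-s*s)) hK (hpig h0) (g := (1 - s*s)*(1-s*s)) (by positivity) (by ring) (by ring)
    obtain ⟨f, f'⟩ := numR34 p0 p1 e0 e1
    simp only [Prod.mk.injEq] at f f'
    have hs : s = 1 / 2 := by
      have e := e1.eq
      rcases f' with f' | f' <;> rw [f'.1, f'.2.1, f'.2.2] at e <;> push_cast at e
      · have : (2 * s - 1) * (2 * s^3 + 3 * s^2 - 4 * s - 8) = 0 := by linear_combination -e
        rcases mul_eq_zero.1 this with h | h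
        · linarith
        · clear * - h p0 p1; nlinarith [mul_pos p0 p0, mul_pos p0 (sub_pos.2 p1), mul_pos (mul_pos p0 p0) (sub_pos.2 p1)]
      · have : (2 * s - 1) * (2 * s + 1) = 0 := by linear_combination -e
        rcases mul_eq_zero.1 this with h | h <;> linarith
    have hlen := cnt_sum w0
    refine caseR3b T' hG b0 (nv_oth0 b1 (hz _)) c0 (nv_oth0 c1 (hz _)) h0 ?_ (by omega) (by omega) (by omega)
    intro f hf h
    rw [L0, L1, L2, h, hs] at hf
    have h1 : (2 * f 1 + 4 * f 2 : ℝ) = 3 := by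
      apply mul_left_cancel₀ hc.ne'
      push_cast at hf; linear_combination 4 * hf
    have h3 : 2 * f 1 + 4 * f 2 = 3 := by exact_mod_cast h1
    omega
theorem trigR4 {x y z : ℝ} (hx : 0 < x) (hy : 0 < y) (h : x + y + z = π) (hz : x + y = π / 3) :
    ∃ k t a b c, 0 < k ∧ 0 < t ∧ t < 1 ∧ a = 1 - t*t ∧ b = t+t+t*t ∧ c = 1+t+t*t ∧
      sin x = k * a ∧ sin y = k * b ∧ sin z = k * c ∧ sin (x + y) = k * c ∧ sin (2 * x) = k * (a * (a+b+b) / c) ∧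
      sin (2 * y) = k * (b * (a+(a+b)) / c) ∧ sin (2 * x + y) = k * (a + b) ∧ sin (3 * x) = k * (3 * a * b * (a + b) / (c * c)) := by
  have hzs : sin z = sin (x + y) := by rw [show z = π - (x + y) by linarith, sin_pi_sub]
  have hc3 : cos (x + y) = 1/2 := by rw [hz, cos_pi_div_three]
  have px : 0 < sin x := sin_pos_of_pos_of_lt_pi hx (by linarith)
  have py : 0 < sin y := sin_pos_of_pos_of_lt_pi hy (by linarith)
  have pz : 0 < sin z := sin_pos_of_pos_of_lt_pi (by linarith) (by linarith)
  have ey : sin y = sin z * cos x - 1/2 * sin x := by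
    rw [hzs, ← hc3, ← sin_sub]; congr 1; ring
  have ex : sin x = sin z * cos y - 1/2 * sin y := by
    rw [hzs, ← hc3, ← sin_sub]; congr 1; ring
  have h3 : sin z * sin z = 3 / 4 := by
    have := sin_sq_add_cos_sq (x + y)
    rw [hc3] at this; rw [hzs]; linarith
  have hlaw : sin z * sin z = sin x * sin x + sin x * sin y + sin y * sin y := by
    have := sin_sq_add_cos_sq x
    rw [ey]; linear_combination (-sin z * sin z) * this  + (sin x * sin x) * h3
  have d1 : sin z * sin (2 * x) = sin x * (sin x + sin y + sin y) := by
    rw [sin_two_mul]; linear_combination -2 * sin x * ey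
  have d2 : sin z * sin (2 * y) = sin y * (sin x + (sin x + sin y)) := by
    rw [sin_two_mul]; linear_combination -2 * sin y * ex
  have d3 : sin (2 * x + y) = sin x + sin y := by
    rw [show 2 * x + y = x + (x + y) by ring, sin_add, hc3, ← hzs]; linear_combination -ey
  have d4 : sin z * sin z * sin (3 * x) = 3 * sin x * sin y * (sin x + sin y) := by
    rw [sin_three_mul]; linear_combination (3 * sin x - 4 * sin x ^ 3) * h3 + 3 * sin x * hlaw - 3 * sin x * h3
  have hlt : sin y < sin z := by nlinarith
  have ht : sin y / (sin x + sin z) * (sin x + sin z) = sin y := by field_simp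
  have t0 : 0 < sin y / (sin x + sin z) := by positivity
  have t1 : sin y / (sin x + sin z) < 1 := by rw [div_lt_one (by positivity)]; linarith
  generalize sin y / (sin x + sin z) = t at *
  have hk : (sin x + sin z) / (2 + t) * (2 + t) = sin x + sin z := by field_simp
  have k0 : 0 < (sin x + sin z) / (2 + t) := by positivity
  generalize (sin x + sin z) / (2 + t) = k at *
  have e1 : sin x * (2 + t) = (sin x + sin z) * (1 - t*t) := by
    apply mul_right_cancel₀ (show sin x + sin z ≠ 0 by positivity)
    linear_combination (sin x + t * (sin x + sin z) + sin y) * ht - hlaw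
  have hsx : sin x = k * (1 - t*t) := by
    apply mul_right_cancel₀ (show 2 + t ≠ 0 by positivity)
    linear_combination e1 - (1-t*t)*hk
  have hsy : sin y = k * (t + t + t*t) := by linear_combination -ht - t * hk
  have hsz : sin z = k * (1 + t + t*t) := by linear_combination -hk - hsx
  have cp : (1 + t + t*t) ≠ 0 := by positivity
  have kp := k0.ne'
  refine ⟨k, t, _, _, _, k0, t0, t1, rfl, rfl, rfl, hsx, hsy, hsz, by rw [← hzs, hsz], ?_, ?_, by rw [d3, hsx, hsy]; ring, ?_⟩
  · rw [hsx, hsy, hsz] at d1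
    rw [← mul_div_assoc, eq_div_iff cp]
    apply mul_left_cancel₀ kp; linear_combination d1
  · rw [hsx, hsy, hsz] at d2
    rw [← mul_div_assoc, eq_div_iff cp]
    apply mul_left_cancel₀ kp; linear_combination d2
  · rw [hsx, hsy, hsz] at d4
    rw [← mul_div_assoc, eq_div_iff (mul_ne_zero cp cp)]
    apply mul_left_cancel₀ (mul_ne_zero kp kp); linear_combination d4
theorem lawR4 (T : Tl A B θ L) (hxy : θ 0 + θ 1 = π / 3) : L 2 * L 2 = L 0 * L 0 + L 0 * L 1 + L 1 * L 1 := by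
  obtain ⟨k, t, a, b, c, hK, p0, p1, ea, eb, ec, s0, s1, s2, -⟩ := trigR4 (T.pos 0) (T.pos 1) T.sum hxy
  obtain ⟨c, hc, L0, L1, L2⟩ := T.Lsin hK s0 s1 s2
  rw [L0, L1, L2, ea, eb, ec]; ring
set_option maxHeartbeats 1000000 in
theorem caseR4 (T : Tl A B θ L) (hang : θ 0 + θ 1 = π / 3) (HS : ∀ i c, isE A (B i c) → nv B (B i c) 2 ≤ 1)
    (hz : ∀ m, nv B (A m) 2 = 0)
    (hl : [(nv B (A 0) 0, nv B (A 0) 1), (nv B (A 1) 0, nv B (A 1) 1), (nv B (A 2) 0, nv B (A 2) 1)] ∈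
      [[(0,1),(0,1),(3,1)],[(0,1),(0,2),(3,0)],[(0,1),(1,1),(2,1)],[(0,1),(1,2),(2,0)],[(0,2),(1,1),(2,0)],[(1,0),(0,1),(2,2)]]) : False := by
  obtain ⟨k, t, a, b, c, hK, p0, p1, ea, eb, ec, s0, s1, s2, dxy, d2x, d2y, d2xy, d3x⟩ := trigR4 (T.pos 0) (T.pos 1) T.sum hang
  have hsum := T.sum
  have hpig : ∀ {p q w}, IsSide A B p q w → 1 ≤ cnt w 2 := fun h => T.pig HS h (hz _) (hz _)
  obtain ⟨w2, h2⟩ := T.side (show (0 : Fin 3) ≠ 1 by decide)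
  obtain ⟨w1, h1⟩ := T.side (show (0 : Fin 3) ≠ 2 by decide)
  obtain ⟨w0, h0⟩ := T.side (show (1 : Fin 3) ≠ 2 by decide)
  have a0' : a ≠ 0 := by rw [ea]; nlinarith
  have b0' : b ≠ 0 := by rw [eb]; positivity
  have c0' : c ≠ 0 := by rw [ec]; positivity
  simp only [List.mem_cons, List.cons.injEq, Prod.mk.injEq, List.not_mem_nil, and_true, or_false] at hl
  rcases hl with hl | hl | hl | hl | hl | hl <;> obtain ⟨⟨a0, a1⟩, ⟨b0, b1⟩, c0, c1⟩ := hl <;>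
  ( have v0 := T.cang 0 a0 a1 (hz 0)
    have v1 := T.cang 1 b0 b1 (hz 1)
    have v2 := T.cang 2 c0 c1 (hz 2)
    push_cast at v0 v1 v2 )
  · have S0 : sin (vang A 0) = k * b := by rw [v0, ← s1]; ring_nf
    have S1 : sin (vang A 1) = k * b := by rw [v1, ← s1]; ring_nf
    have S2 : sin (vang A 2) = k * (b * (a+(a+b)) / c) := by rw [v2, ← d2y, ← sin_pi_sub]; congr 1; linarith
    have e2 := T.SE h2 s0 s1 s2 S0 S1 S2 (δ := 1) (ν := a*(a+(a+b))) hK (hpig h2) (g := b*b) (by positivity) (by ring) (by field_simp)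
    have e1 := T.SE h1 s0 s1 s2 S0 S2 S1 (δ := a+(a+b)) (ν := a*(c*c)) hK (hpig h1) (g := b*b/c) (by positivity) (by ring) (by field_simp)
    exact numR40 p0 p1 ea eb ec e1 e2
  · have S0 : sin (vang A 0) = k * b := by rw [v0, ← s1]; ring_nf
    have S1 : sin (vang A 1) = k * (b * (a+(a+b)) / c) := by rw [v1, ← d2y]; ring_nf
    have S2 : sin (vang A 2) = k * (3 * a * b * (a + b) / (c * c)) := by rw [v2, ← d3x]; ring_nf
    have e2 := T.SE h2 s0 s1 s2 S0 S1 S2 (δ := a+(a+b)) (ν := 3*(a*a*(a+b))) hK (hpig h2) (g := b*b/c) (by positivity) (by ring) (by field_simp)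
    have e1 := T.SE h1 s0 s1 s2 S0 S2 S1 (δ := 3*(a+b)) (ν := c*c*(a+(a+b))) hK (hpig h1) (g := a*b*b/(c*c)) (by positivity) (by ring) (by field_simp)
    have e0 := T.SE h0 s0 s1 s2 S1 S2 S0 (δ := 3*((a+(a+b))*(a+b))) (ν := c*c*(c*c)) hK (hpig h0) (g := a*b*b/(c*c*c)) (by positivity) (by field_simp) (by field_simp)
    exact numR41 p0 p1 ea eb ec e0 e1 e2
  · have S0 : sin (vang A 0) = k * b := by rw [v0, ← s1]; ring_nf
    have S1 : sin (vang A 1) = k * c := by rw [v1, ← dxy]; ring_nf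
    have S2 : sin (vang A 2) = k * (a+b) := by rw [v2, ← d2xy]; ring_nf
    have e2 := T.SE h2 s0 s1 s2 S0 S1 S2 (δ := 1) (ν := a*(a+b)) hK (hpig h2) (g := b*c) (by positivity) (by ring) (by ring)
    have e1 := T.SE h1 s0 s1 s2 S0 S2 S1 (δ := a+b) (ν := a*(c*c)) hK (hpig h1) b0' (by ring) (by ring)
    have e0 := T.SE h0 s0 s1 s2 S1 S2 S0 (δ := a+b) (ν := a*(b*b)) hK (hpig h0) c0' (by ring) (by ring)
    exact numR42 p0 p1 ea eb ec e0 e1 e2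
  · have S0 : sin (vang A 0) = k * b := by rw [v0, ← s1]; ring_nf
    have S1 : sin (vang A 1) = k * (a+b) := by rw [v1, ← d2xy, ← sin_pi_sub]; congr 1; linarith
    have S2 : sin (vang A 2) = k * (a * (a+b+b) / c) := by rw [v2, ← d2x]; ring_nf
    have e2 := T.SE h2 s0 s1 s2 S0 S1 S2 (δ := a+b) (ν := a*a*(a+b+b)) hK (hpig h2) b0' (by ring) (by field_simp)
    have e1 := T.SE h1 s0 s1 s2 S0 S2 S1 (δ := a+b+b) (ν := (a+b)*(c*c)) hK (hpig h1) (g := a*b/c) (by positivity) (by ring) (by field_simp)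
    have e0 := T.SE h0 s0 s1 s2 S1 S2 S0 (δ := (a+b)*(a+b+b)) (ν := b*b*(c*c)) hK (hpig h0) (g := a/c) (by positivity) (by ring) (by field_simp)
    exact numR43 p0 p1 ea eb ec e0 e1 e2
  · have S0 : sin (vang A 0) = k * (b * (a+(a+b)) / c) := by rw [v0, ← d2y]; ring_nf
    have S1 : sin (vang A 1) = k * c := by rw [v1, ← dxy]; ring_nf
    have S2 : sin (vang A 2) = k * (a * (a+b+b) / c) := by rw [v2, ← d2x]; ring_nf
    have e2 := T.SE h2 s0 s1 s2 S0 S1 S2 (δ := a+(a+b)) (ν := a*a*(a+b+b)) hK (hpig h2) b0' (by field_simp) (by field_simp)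
    have e1 := T.SE h1 s0 s1 s2 S0 S2 S1 (δ := (a+(a+b))*(a+b+b)) (ν := c*c*(c*c)) hK (hpig h1) (g := a*b/(c*c)) (by positivity) (by field_simp) (by field_simp)
    have e0 := T.SE h0 s0 s1 s2 S1 S2 S0 (δ := a+b+b) (ν := b*b*(a+(a+b))) hK (hpig h0) a0' (by field_simp) (by field_simp)
    exact numR44 p0 p1 ea eb ec e0 e1 e2
  · obtain ⟨X, Y, e1, e2⟩ := T.simfam (nv_oth0 a1 (hz _)) (nv_oth1 b0 (hz _)) (by linarith) (by linarith) (by linarith)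
    have hs : √11 * √11 = (11:ℝ) := Real.mul_self_sqrt (by norm_num)
    have hp := T.lpos 2
    have py := lawR4 T hang
    have g2 : ((X * X + X * Y + Y * Y : ℕ) : ℝ) = (11 : ℕ) := by
      apply mul_right_cancel₀ (show L 2 * L 2 ≠ 0 by positivity)
      push_cast
      linear_combination (X * L 2 + √11 * L 0 + Y * L 2) * e1 + (Y * L 2 + √11 * L 1 + √11 * L 0) * e2 - 11 * py + (L 0 * L 0 + L 0 * L 1 + L 1 * L 1) * hs
    have g3 : X * X + X * Y + Y * Y = 11 := by exact_mod_cast g2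
    clear * - g3
    have : X < 4 := by nlinarith
    have : Y < 4 := by nlinarith
    interval_cases X <;> interval_cases Y <;> omega
theorem ang_scale {u v : Pt} {s : ℝ} (hs : 0 < s) : InnerProductGeometry.angle (s • u) v = InnerProductGeometry.angle u v :=
  InnerProductGeometry.angle_smul_left_of_pos _ _ hs
theorem vang_any' (b : AB) {k l m : Fin 3} (h1 : l ≠ k) (h2 : m ≠ k) (h3 : l ≠ m) :
    InnerProductGeometry.angle (b l - b k) (b m - b k) = vang b k := vang_any b h1 h2 h3
theorem Tl.corner2 (T : Tl A B θ L) {p q r : Fin 3} (hqr : q ≠ r) {i l m w j l' m' w'}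
    (h : IsSide A B p q ((i,l,m)::w)) (h' : IsSide A B p r ((j,l',m')::w'))
    (n0 : nv B (A p) 0 = 1) (n1 : nv B (A p) 1 = 1) (n2 : nv B (A p) 2 = 0) :
    i ≠ j ∧ ((l = 0 ∧ l' = 1) ∨ (l = 1 ∧ l' = 0)) := by
  obtain ⟨a1, a2, s, a3, a4⟩ := side_first h
  obtain ⟨b1, b2, t, b3, b4⟩ := side_first h'
  have hv := T.cang p n0 n1 n2
  push_cast at hv
  have key : i ≠ j := by
    rintro rfl
    have hll : l = l' := by
      by_contra hc; exact ab_ne (B i) hc (a2.trans b2.symm)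
    subst hll
    have hmm : m ≠ m' := by
      rintro rfl
      have c1 := (coord_side A h.1 s).2.1
      have c2 := (coord_side A h'.1 t).2.2
      rw [← a4] at c1
      have hq : th p r = q := by
        have h1 := h.1; have h2 := h'.1; clear * - hqr h1 h2; revert p q r; decide
      rw [← b4, hq] at c2
      linarith
    have e := vang_any' (B i) a1.symm b1.symm hmm
    rw [a4, b4, a2, add_sub_cancel_left, add_sub_cancel_left, InnerProductGeometry.angle_smul_left_of_pos _ _ a3,
      InnerProductGeometry.angle_smul_right_of_pos _ _ b3, vang_any' A h.1.symm h'.1.symm hqr, T.ang, hv] at e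
    have := T.pos 0
    have := T.pos 1
    have hl : l = 0 ∨ l = 1 ∨ l = 2 := by clear * -; revert l; decide
    rcases hl with rfl | rfl | rfl
    · linarith
    · linarith
    · have := nv_one a2; omega
  refine ⟨key, ?_⟩
  have g1 : l ≠ 2 := by rintro rfl; have := nv_one a2; omega
  have g2 : l' ≠ 2 := by rintro rfl; have := nv_one b2; omega
  have g3 : l ≠ l' := by
    rintro rfl
    have := nv_two key a2 b2
    have hl : l = 0 ∨ l = 1 ∨ l = 2 := by clear * -; revert l; decide
    rcases hl with rfl | rfl | rfl <;> omega
  clear * - g1 g2 g3; revert l l'; decide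
theorem Tl.fan2 (T : Tl A B θ L) {p q r : Fin 3} (hqr : q ≠ r) {i m w j m' w'}
    (h : IsSide A B p q ((i,0,m)::w)) (h' : IsSide A B p r ((j,1,m')::w'))
    (n0 : nv B (A p) 0 = 1) (n1 : nv B (A p) 1 = 1) (n2 : nv B (A p) 2 = 0) :
    ∃ τ : ℝ, 0 < τ ∧ B i (th 0 m) = A p + τ • (B j (th 1 m') - A p) := by
  obtain ⟨a1, a2, s, a3, a4⟩ := side_first h
  obtain ⟨b1, b2, t, b3, b4⟩ := side_first h'
  have hv := T.cang p n0 n1 n2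
  push_cast at hv
  have hp1 := T.pos 1
  obtain ⟨-, -, -, d1, -⟩ := T.side_edge (w := []) h
  have hpq := h.1
  have hpr := h'.1
  have hth : th p q = r := by clear * - hqr hpq hpr; revert p q r; decide
  rw [hth] at d1
  set v := B i (th 0 m) - A p with hvd
  have hv0 : v ≠ 0 := by rw [hvd, ← a2]; exact sub_ne_zero.2 (ab_ne _ (th_ne_l a1))
  have lr : 0 < lin A r v := by rw [hvd, lin_sub, coord_vert, if_neg hpr.symm]; linarith
  have lq : 0 ≤ lin A q v := by
    rw [hvd, lin_sub, coord_vert, if_neg hpq.symm]; have := T.vmem i (th 0 m) q; linarith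
  have ca := cone_ang A hpq.symm hpr.symm hqr hv0 lq lr.le
  have c1 : InnerProductGeometry.angle (A q - A p) v = θ 0 := by
    rw [← T.ang i, ← vang_any' (B i) a1.symm (th_ne_l a1) (th_ne_m a1).symm, a4, a2, add_sub_cancel_left, ang_scale a3]
  have c2 : InnerProductGeometry.angle v (A r - A p) = θ 1 := by linarith
  have lq' : 0 < lin A q v := by
    rcases lq.lt_or_eq with h | h
    · exact h
    · exfalso
      have hd := dec_lin A p v
      have : v = lin A r v • (A r - A p) := by
        have hc : (p + 1 = q ∧ p + 2 = r) ∨ (p + 1 = r ∧ p + 2 = q) := by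
          clear * - hqr hpq hpr; revert p q r; decide
        rcases hc with ⟨e1, e2⟩ | ⟨e1, e2⟩ <;> rw [e1, e2, ← h] at hd <;> simpa using hd
      rw [this, ang_scale lr, InnerProductGeometry.angle_self (sub_ne_zero.2 (ab_ne _ hpr.symm))] at c2
      linarith
  have hG : G A (A p) v (B i 0 - B i m) := by
    intro c
    have : c = p ∨ c = q ∨ c = r := by clear * - hqr hpq hpr; revert p q r c; decide
    rcases this with rfl | rfl | rfl
    · left; rw [coord_vert, if_pos rfl]; norm_num
    · right; rw [coord_vert, if_neg hpq.symm]; exact ⟨rfl, Or.inl lq'⟩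
    · right; rw [coord_vert, if_neg hpr.symm]; exact ⟨rfl, Or.inl lr⟩
  obtain ⟨x, hx⟩ := germ T.mem hG
  have hnI : ¬ isI A (A p) := not_I_vert _ _
  rcases cases_mem (b := B x) (X := A p) (fun k => (hx k).nn) with ⟨k, hk⟩ | h1 | h1
  · have hc0 : ∀ c, c ≠ k → (B x).coord c (A p) = 0 := by
      intro c hc; rw [← hk, coord_vert, if_neg hc]
    have : k = 0 ∨ k = 1 ∨ k = 2 := by clear * -; revert k; decide
    rcases this with rfl | rfl | rfl
    · have hxr := nv_uniq n0.le hk a2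
      subst hxr
      exfalso
      rcases hx m with h2 | ⟨-, h2 | ⟨-, h2⟩⟩
      · rw [hc0 m a1.symm] at h2; linarith
      · rw [hvd, lin_sub, hc0 m a1.symm, coord_vert, if_neg (th_ne_m a1).symm] at h2; linarith
      · rw [lin_sub, coord_vert, coord_vert, if_neg a1.symm, if_pos rfl] at h2; linarith
    · have hxr := nv_uniq n1.le hk b2
      subst hxr
      have ca := cone_ang (B x) (th_ne_l b1) b1.symm (th_ne_m b1) hv0 ((hx _).nn1 (hc0 _ (th_ne_l b1))) ((hx m').nn1 (hc0 m' b1.symm))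
      rw [T.ang, b4, b2, add_sub_cancel_left, InnerProductGeometry.angle_smul_right_of_pos _ _ b3, c2] at ca
      have hz : InnerProductGeometry.angle (B x (th 1 m') - A p) v = 0 := by linarith
      obtain ⟨-, ρ, hρ, e⟩ := InnerProductGeometry.angle_eq_zero_iff.1 hz
      exact ⟨ρ, hρ, by rw [← e, hvd]; abel⟩
    · have := nv_one hk; omega
  · exact absurd h1 (T.noE_corner _ _)
  · exact absurd h1 (T.noI_of_bd hnI)
theorem mid_co {b : AB} {X : Pt} {l m : Fin 3} (hlm : l ≠ m) {τ : ℝ} (h0 : 0 < τ) (h1 : τ < 1)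
    (h : X = b l + τ • (b m - b l)) : b.coord (th l m) X = 0 ∧ ∀ k, k ≠ th l m → 0 < b.coord k X := by
  have hc : ∀ c, b.coord c X = b.coord c (b l) + τ * (b.coord c (b m) - b.coord c (b l)) := by
    intro c; rw [h, coord_add, map_smul, lin_sub, smul_eq_mul]
  constructor
  · rw [hc, coord_vert, coord_vert, if_neg (th_ne_l hlm), if_neg (th_ne_m hlm)]; ring
  · intro k hk
    rw [hc, coord_vert, coord_vert]
    rcases th_cases hlm k with rfl | rfl | rfl
    · rw [if_pos rfl, if_neg hlm]; linarith
    · rw [if_pos rfl, if_neg hlm.symm]; linarith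
    · exact absurd rfl hk
theorem Tl.blk_on (T : Tl A B θ L) {i j : Fin 11} {l m c c' : Fin 3} (hlm : l ≠ m) {τ : ℝ} (h0 : 0 < τ) (h1 : τ < 1)
    (h : B i 2 = B j l + τ • (B j m - B j l)) (hc : B i c = B j l) (hcc : c ≠ c') (hc2 : c ≠ 2) (hc2' : c' ≠ 2) (n : Pt) :
    Blk B (B i 2 - B i c') n (B i 2) := by
  obtain ⟨g0, g1⟩ := mid_co hlm h0 h1 h
  refine T.blk_E g0 g1 fun h5 => ?_
  have h6 : lin (B j) (th l m) (B i c' - B i 2) = 0 := by rw [← neg_sub, map_neg, h5, neg_zero]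
  have h7 : lin (B j) (th l m) (B i c - B i 2) = 0 := by
    rw [lin_sub, g0, hc, coord_vert, if_neg (th_ne_l hlm)]; ring
  have : (c = 0 ∧ c' = 1) ∨ (c = 1 ∧ c' = 0) := by clear * - hcc hc2 hc2'; revert c c'; decide
  rcases this with ⟨rfl, rfl⟩ | ⟨rfl, rfl⟩
  · exact not_all_zero (B i) _ (lin_ne_zero _ _) 2 h7 h6
  · exact not_all_zero (B i) _ (lin_ne_zero _ _) 2 h6 h7
theorem Tl.nv_on (T : Tl A B θ L) {j : Fin 11} {X : Pt} {l m : Fin 3} (hlm : l ≠ m) {τ : ℝ} (h0 : 0 < τ) (h1 : τ < 1)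
    (h : X = B j l + τ • (B j m - B j l)) (h2 : π < 2 * θ 2) : nv B X 2 ≤ 1 := by
  by_contra hn
  have ha := T.asum X
  have he : (1:ℝ) ≤ ec B X := by
    have : 0 < ec B X := Finset.card_pos.2 ⟨j, by simpa using ⟨_, mid_co hlm h0 h1 h⟩⟩
    exact_mod_cast this
  have h3 := angOf_le A X
  rw [Fin.sum_univ_three] at ha
  have : (2:ℝ) ≤ nv B X 2 := by exact_mod_cast (by omega : 2 ≤ nv B X 2)
  have := T.pos 0; have := T.pos 1; have := T.pos 2
  have e0 : (0:ℝ) ≤ nv B X 0 * θ 0 := by positivity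
  have e1 : (0:ℝ) ≤ nv B X 1 * θ 1 := by positivity
  have e2 : (0:ℝ) ≤ ic B X * (2 * π) := by positivity
  have e3 : (2:ℝ) * θ 2 ≤ nv B X 2 * θ 2 := by gcongr
  have e4 : 1 * π ≤ ec B X * π := by gcongr
  linarith
theorem scale_dist {P X Y : Pt} {τ : ℝ} (h0 : 0 < τ) (h : X = P + τ • (Y - P)) : dist P X = τ * dist P Y := by
  rw [h, dist_eq_norm, show P - (P + τ • (Y - P)) = τ • (P - Y) by module, norm_smul, ← dist_eq_norm, Real.norm_of_nonneg h0.le]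
theorem eqnum {a b c : ℝ} (ha : 0 < a) (hb : 0 < b) (hc : 0 < c) (h : c*c = a*a+a*b+b*b) {n0 n1 n2 : ℕ} (h2 : 1 ≤ n2)
    (e : (n0*a+n1*b+n2*c)^2 = 11*(a*b)) : n2 = 1 ∧ ((n1 = 0 ∧ n0 ≤ 2) ∨ (n0 = 0 ∧ n1 ≤ 2)) := by
  have ab : 0 < a * b := by positivity
  have p0 : (0:ℝ) ≤ n0 := by positivity
  have p1 : (0:ℝ) ≤ n1 := by positivity
  have p2 : (1:ℝ) ≤ n2 := by exact_mod_cast h2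
  have hab : b + a/2 < c := by nlinarith only [h, mul_pos ha ha, ha, hb, hc]
  have hba : a + b/2 < c := by nlinarith only [h, mul_pos hb hb, ha, hb, hc]
  have key : ∀ x : ℝ, 0 ≤ x → x ≤ n0*a+n1*b+n2*c → x^2 ≤ 11*(a*b) := by
    intro x hx hx'; rw [← e]; gcongr
  have hn2 : n2 = 1 := by
    by_contra hne
    have : (2:ℝ) ≤ n2 := by exact_mod_cast (by omega : 2 ≤ n2)
    have := key (2*c) (by positivity) (by nlinarith only [mul_nonneg p0 ha.le, mul_nonneg p1 hb.le, mul_le_mul_of_nonneg_right ‹(2:ℝ) ≤ n2› hc.le])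
    nlinarith only [this, h, ab, sq_nonneg (a-b)]
  refine ⟨hn2, ?_⟩
  subst hn2
  rcases Nat.eq_zero_or_pos n0 with z0 | z0
  · right; refine ⟨z0, ?_⟩
    by_contra hne
    have : (3:ℝ) ≤ n1 := by exact_mod_cast (by omega : 3 ≤ n1)
    have := key (3*b+c) (by positivity) (by push_cast; nlinarith only [mul_nonneg p0 ha.le, mul_le_mul_of_nonneg_right this hb.le])
    nlinarith only [this, h, mul_lt_mul_of_pos_left hba hb, sq_nonneg (a-2*b), ab, mul_pos hb hb]
  rcases Nat.eq_zero_or_pos n1 with z1 | z1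
  · left; refine ⟨z1, ?_⟩
    by_contra hne
    have : (3:ℝ) ≤ n0 := by exact_mod_cast (by omega : 3 ≤ n0)
    have := key (3*a+c) (by positivity) (by push_cast; nlinarith only [mul_nonneg p1 hb.le, mul_le_mul_of_nonneg_right this ha.le])
    nlinarith only [this, h, mul_lt_mul_of_pos_left hab ha, sq_nonneg (b-2*a), ab, mul_pos ha ha]
  exfalso
  have q0 : (1:ℝ) ≤ n0 := by exact_mod_cast z0
  have q1 : (1:ℝ) ≤ n1 := by exact_mod_cast z1
  have := key (a+b+c) (by positivity) (by push_cast; nlinarith only [mul_le_mul_of_nonneg_right q0 ha.le, mul_le_mul_of_nonneg_right q1 hb.le])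
  nlinarith only [this, h, ab, sq_nonneg (a-b), mul_lt_mul_of_pos_left hba hb, mul_lt_mul_of_pos_left hab ha]
theorem eqnum2 {a b c : ℝ} (ha : 0 < a) (hb : 0 < b) (hc : 0 < c) (h : c*c = a*a+a*b+b*b) {p q : ℕ} (hp : p ≤ 2) (hq : q ≤ 2)
    (e : (p*a+c)^2 = 11*(a*b)) (e' : (q*b+c)^2 = 11*(a*b)) : p = 0 ∧ q = 0 := by
  have h3 : (p:ℝ)*a = q*b := by
    have : (p*a+c)^2 = (q*b+c)^2 := by rw [e, e']
    have := (sq_eq_sq₀ (by positivity) (by positivity)).1 this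
    linarith
  interval_cases p <;> interval_cases q <;> push_cast at e e' h3 <;> first | exact ⟨rfl, rfl⟩ | (exfalso; linarith) | exfalso
  · have : a = b := by linarith
    subst this
    have : 2 * c = 7 * a := by apply mul_left_cancel₀ ha.ne'; linarith
    nlinarith
  · have : a = 2 * b := by linarith
    subst this
    have : 4 * c = 11 * b := by apply mul_left_cancel₀ hb.ne'; linarith
    nlinarith
  · have : b = 2 * a := by linarith
    subst this
    have : 4 * c = 11 * a := by apply mul_left_cancel₀ ha.ne'; linarith
    nlinarith
  · have : a = b := by linarith
    subst this
    have : 4 * c = 4 * a := by apply mul_left_cancel₀ ha.ne'; linarith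
    nlinarith
theorem sglA {a b c : ℝ} (ha : 0 < a) (hb : 0 < b) (hc : 0 < c) (h : c*c = a*a+a*b+b*b) {p : ℕ} (hp : p = 1 ∨ p = 2)
    (e : (p*a+c)^2 = 11*(a*b)) {f1 f2 : ℕ} (hf : f1 * b + f2 * c = a) : False := by
  have hac : a < c := by nlinarith [mul_pos ha hb, mul_pos hb hb]
  have hf2 : f2 = 0 := by
    by_contra hne
    have : (1:ℝ) ≤ f2 := by exact_mod_cast Nat.pos_of_ne_zero hne
    have : (0:ℝ) ≤ f1 * b := by positivity
    nlinarith
  subst hf2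
  have e1 : a = f1 * b := by push_cast at hf; linarith
  have hn : 0 < (f1:ℝ) := by
    by_contra hh; push Not at hh; nlinarith
  have e2 : 2*p*f1*c = (10*f1-1-(1+p*p)*f1*f1)*b := by
    apply mul_left_cancel₀ hb.ne'
    rw [e1] at e h
    linear_combination e - h
  have e3 : 0 < (10*f1-1-(1+p*p)*f1*f1 : ℝ) := by
    have : 0 < 2*p*f1*c := by
      have : (0:ℝ) < p := by rcases hp with rfl | rfl <;> norm_num
      positivity
    rw [e2] at this; exact (pos_iff_pos_of_mul_pos this).2 hb
  have e4 : c*c = (f1*f1+f1+1)*(b*b) := by rw [h, e1]; ring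
  have e5 : (2*p*f1)^2*(f1*f1+f1+1) = (10*f1-1-(1+p*p)*f1*f1 : ℝ)^2 := by
    apply mul_right_cancel₀ (mul_pos hb hb).ne'
    rw [mul_assoc, ← e4]
    linear_combination (2*p*f1*c + (10*f1-1-(1+p*p)*f1*f1 : ℝ)*b) * e2
  have e6 : f1 < 5 := by
    by_contra hne
    have : (5:ℝ) ≤ f1 := by exact_mod_cast (by omega : 5 ≤ f1)
    rcases hp with rfl | rfl <;> push_cast at e3 <;> nlinarith
  clear * - e5 e6 hp e3
  rcases hp with rfl | rfl <;> interval_cases f1 <;> norm_num at e5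
theorem sglB {a b c : ℝ} (ha : 0 < a) (hb : 0 < b) (hc : 0 < c) (h : c*c = a*a+a*b+b*b)
    (e : c^2 = 11*(a*b)) {f0 f2 : ℕ} (hf : f0 * a + f2 * c = b) : False := by
  have hac : b < c := by nlinarith [mul_pos ha hb, mul_pos ha ha]
  have hf2 : f2 = 0 := by
    by_contra hne
    have : (1:ℝ) ≤ f2 := by exact_mod_cast Nat.pos_of_ne_zero hne
    have : (0:ℝ) ≤ f0 * a := by positivity
    nlinarith
  subst hf2
  have e1 : b = f0 * a := by push_cast at hf; linarith
  have e2 : (f0*f0+1 : ℝ) = 10*f0 := by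
    apply mul_right_cancel₀ (mul_pos ha ha).ne'
    rw [e1] at e h
    linear_combination e - h
  have e3 : f0*f0+1 = 10*f0 := by exact_mod_cast e2
  have : f0 < 10 := by nlinarith
  clear * - e3 this
  interval_cases f0 <;> omega
theorem Tl.eq_side (T : Tl A B θ L) (hang : θ 0 + θ 1 = π / 3) (HS : ∀ i c, isE A (B i c) → nv B (B i c) 2 ≤ 1)
    (n0 : ∀ m, nv B (A m) 0 = 1) (n1 : ∀ m, nv B (A m) 1 = 1) (n2 : ∀ m, nv B (A m) 2 = 0) {j l : Fin 3} {w : Wd} (h : IsSide A B j l w) :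
    (cnt w 0*L 0+cnt w 1*L 1+cnt w 2*L 2)^2 = 11*(L 0*L 1) ∧ 1 ≤ cnt w 2 := by
  obtain ⟨k, t, a, b, c, hK, p0, p1, ea, eb, ec, s0, s1, s2, dxy, -⟩ := trigR4 (T.pos 0) (T.pos 1) T.sum hang
  have hp : 1 ≤ cnt w 2 := T.pig HS h (n2 _) (n2 _)
  have hv : ∀ m, sin (vang A m) = k * c := by
    intro m; rw [T.cang m (n0 m) (n1 m) (n2 m), ← dxy]; congr 1; push_cast; ring
  have c0 : c ≠ 0 := by rw [ec]; positivity
  have e := (T.SE h s0 s1 s2 (hv _) (hv _) (hv _) (δ := 1) (ν := a*b) hK hp (g := c*c) (by positivity) (by ring) (by ring)).eq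
  obtain ⟨d, hd, L0, L1, L2⟩ := T.Lsin hK s0 s1 s2
  refine ⟨?_, hp⟩
  rw [L0, L1, L2]
  linear_combination d*d*e
theorem eqR40 (T : Tl A B θ L)
    (n0 : ∀ m, nv B (A m) 0 = 1) (n1 : ∀ m, nv B (A m) 1 = 1) (n2 : ∀ m, nv B (A m) 2 = 0)
    (hc : ∀ {j l w}, IsSide A B j l w → cnt w 0 = 0 ∧ cnt w 1 = 0 ∧ cnt w 2 = 1) (hL : L 0 < L 1) (hS : Sgl L 1) : False := by
  have hone : ∀ {j l w}, IsSide A B j l w → ∃ i, w = [(i,0,1)] ∨ w = [(i,1,0)] := by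
    intro j l w h
    obtain ⟨c0, c1, c2⟩ := hc h
    have hs := cnt_sum w
    rw [c0, c1, c2] at hs
    obtain ⟨⟨i, a, b⟩, rfl⟩ := List.length_eq_one_iff.1 hs.symm
    obtain ⟨hlm, -⟩ := side_first h
    rw [cnt_cons, cnt_nil] at c2
    have h4 : th a b = 2 := by
      by_contra hne; rw [if_neg hne] at c2; omega
    have : (a = 0 ∧ b = 1) ∨ (a = 1 ∧ b = 0) := by clear * - hlm h4; revert a b; decide
    rcases this with ⟨rfl, rfl⟩ | ⟨rfl, rfl⟩
    · exact ⟨i, Or.inl rfl⟩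
    · exact ⟨i, Or.inr rfl⟩
  obtain ⟨p, q, i, h⟩ : ∃ p q i, IsSide A B p q [(i,0,1)] := by
    obtain ⟨w, h⟩ := T.side (show (0 : Fin 3) ≠ 1 by decide)
    obtain ⟨i, rfl | rfl⟩ := hone h
    · exact ⟨_, _, _, h⟩
    · exact ⟨_, _, _, h.rev⟩
  have hpq := h.1
  have hqr : q ≠ th p q := (th_ne_m hpq).symm
  obtain ⟨w, h1⟩ := T.side hqr
  have h2 : IsSide A B q p [(i,1,0)] := h.rev
  obtain ⟨j, rfl | rfl⟩ := hone h1
  swap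
  · have := (T.corner2 (th_ne_l hpq).symm h2 h1 (n0 _) (n1 _) (n2 _)).2
    revert this; decide
  obtain ⟨τ, hτ, hX⟩ := T.fan2 (th_ne_l hpq) h1 h2 (n0 _) (n1 _) (n2 _)
  change B j 2 = A q + τ • (B i 2 - A q) at hX
  obtain ⟨-, hi, -⟩ := side_first h2
  obtain ⟨-, hi0, -⟩ := side_first h
  obtain ⟨-, hj, -⟩ := side_first h1
  have d := scale_dist hτ hX
  have d1 : dist (A q) (B j 2) = L 1 := by rw [← hj, dist_th (T.len j) (by decide)]; rfl
  have d2 : dist (A q) (B i 2) = L 0 := by rw [← hi, dist_th (T.len i) (by decide)]; rfl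
  rw [d1, d2] at d
  have hτ1 : 1 < τ := by
    have := T.lpos 0
    by_contra hh; push Not at hh; nlinarith
  have hY : B i 2 = B j 0 + τ⁻¹ • (B j 2 - B j 0) := by
    rw [hj, hX, add_sub_cancel_left, smul_smul, inv_mul_cancel₀ hτ.ne', one_smul, add_sub_cancel]
  have hi' : τ⁻¹ < 1 := inv_lt_one_of_one_lt₀ hτ1
  have hblk := T.blk_on (c := 1) (c' := 0) (by decide) (inv_pos.2 hτ) hi' hY (hi.trans hj.symm) (by decide) (by decide) (by decide)
  obtain ⟨x, hx, -, hx2⟩ := T.opp1 i (l := 0) (m := 2) (by decide) (by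
    intro k
    rcases th_cases hpq k with hk | hk | hk
    · left; rw [hk, hi0, coord_vert, if_pos rfl]; norm_num
    · right
      have := T.vmem j 2 q
      rw [hk, hY, coord_add, map_smul, lin_sub, hj, coord_vert, if_pos rfl, smul_eq_mul]
      have := mul_nonneg (inv_pos.2 hτ).le this
      linarith
    · right; rw [hk]
      exact (T.side_edge (w := []) h).2.2.2.1) (T.blk_bd (by rw [hi0]; exact not_I_vert _ _)) (hblk _) hS
  rcases hx2 with ⟨y, -⟩ | ⟨y, -⟩
  · exact hx (nv_uniq (n0 p).le (y.trans hi0) hi0)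
  · have := nv_one (y.trans hi0)
    have := n2 p; omega
theorem eqR41 (T : Tl A B θ L) (hang : θ 0 + θ 1 = π / 3) (HS : ∀ i c, isE A (B i c) → (∀ d, nv B (B i c) d = 1) ∨ nv B (B i c) 2 = 0)
    (n0 : ∀ m, nv B (A m) 0 = 1) (n1 : ∀ m, nv B (A m) 1 = 1) (n2 : ∀ m, nv B (A m) 2 = 0)
    (hc : ∀ {j l w}, IsSide A B j l w → 1 ≤ cnt w 0 ∧ cnt w 1 = 0 ∧ cnt w 2 = 1) (hL : L 1 < L 2) (hS : Sgl L 0) : False := by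
  have tab : ∀ a b : Fin 3, a ≠ b → th a b ≠ 1 → (a = 0 → b = 1) ∧ (a = 1 → b = 2 ∨ b = 0) := by decide
  have good : ∀ {p q r i w j w'}, q ≠ r → IsSide A B p q ((i,0,1)::w) → IsSide A B p r ((j,1,2)::w') → False := by
    intro p q r i w j w' hqr h h'
    obtain ⟨τ, hτ, hX⟩ := T.fan2 hqr h h' (n0 _) (n1 _) (n2 _)
    change B i 2 = A p + τ • (B j 0 - A p) at hX
    obtain ⟨-, hi, -⟩ := side_first h
    obtain ⟨-, hj, -⟩ := side_first h'
    have d := scale_dist hτ hX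
    have d1 : dist (A p) (B i 2) = L 1 := by rw [← hi, dist_th (T.len i) (by decide)]; rfl
    have d2 : dist (A p) (B j 0) = L 2 := by rw [← hj, dist_th (T.len j) (by decide)]; rfl
    rw [d1, d2] at d
    have hτ1 : τ < 1 := by
      have := T.lpos 2
      by_contra hh; push Not at hh; nlinarith
    rw [← hj] at hX
    have hblk := T.blk_on (c := 0) (c' := 1) (by decide) hτ hτ1 hX (hi.trans hj.symm) (by decide) (by decide) (by decide)
    have hn := T.nv_on (by decide) hτ hτ1 hX (by have := T.sum; have := pi_pos; linarith)
    obtain ⟨c0, c1, c2⟩ := hc h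
    rcases w with _ | ⟨⟨j', l', m'⟩, w⟩
    · rw [cnt_cons, cnt_nil, if_neg (by decide : ¬ th (0:Fin 3) 1 = 0)] at c0; omega
    obtain ⟨-, hlm, -, -, hE⟩ := T.side_vert (w := []) h
    have hl := T.next (w := []) h hS hblk (fun hh => by have := hh.2; change 2 ≤ nv B (B i 2) 2 at this; omega) (by
      intro _ h2
      change 1 ≤ nv B (B i 1) 2 at h2
      rcases HS _ _ hE with h3 | h3
      · exact h3
      · omega)
    rw [cnt_cons, if_pos (by decide : th (0:Fin 3) 1 = 2), cnt_cons] at c2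
    rw [cnt_cons, cnt_cons] at c1
    have t2 : th l' m' ≠ 2 := fun hh => by rw [if_pos hh] at c2; omega
    have t1 : th l' m' ≠ 1 := fun hh => by rw [if_pos hh] at c1; omega
    clear * - hl hlm t1 t2
    revert l' m'; decide
  have hne1 : ∀ {p q i l m w}, IsSide A B p q ((i,l,m)::w) → th l m ≠ 1 := by
    intro p q i l m w h hh
    have := (hc h).2.1
    rw [cnt_cons, if_pos hh] at this; omega
  have stp : ∀ {p q r i m w j m' w'}, q ≠ r → IsSide A B p q ((i,0,m)::w) → IsSide A B p r ((j,1,m')::w') → False := by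
    intro p q r i m w j m' w' hqr h h'
    obtain rfl := (tab 0 m (side_first h).1 (hne1 h)).1 rfl
    rcases (tab 1 m' (side_first h').1 (hne1 h')).2 rfl with rfl | rfl
    · exact good hqr h h'
    have hr := h'.rev
    rw [rv_cons] at hr
    have c2 := (hc h').2.2
    have c0 := (hc h').1
    rw [cnt_cons, if_pos (by decide : th (1:Fin 3) 0 = 2), ← cnt_rv] at c2
    rw [cnt_cons, if_neg (by decide : ¬ th (1:Fin 3) 0 = 0), ← cnt_rv] at c0
    rcases hw : rv w' with _ | ⟨⟨i2, l2, m2⟩, w2⟩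
    · rw [hw, cnt_nil] at c0; omega
    rw [hw, List.cons_append] at hr
    rw [hw, cnt_cons] at c2
    have t2 : th l2 m2 ≠ 2 := fun hh => by rw [if_pos hh] at c2; omega
    have t1 := hne1 hr
    have t0 := (side_first hr).1
    obtain ⟨w3, h3⟩ := T.side hqr.symm
    rcases w3 with _ | ⟨⟨i3, l3, m3⟩, w3⟩
    · exact h3.ne_nil rfl
    have hh := (T.corner2 h.1 hr h3 (n0 _) (n1 _) (n2 _)).2
    have : l2 = 1 ∧ m2 = 2 := by
      have : l2 = 0 ∨ l2 = 1 := by tauto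
      clear * - this t2 t1 t0
      revert l2 m2; decide
    obtain ⟨rfl, rfl⟩ := this
    have : l3 = 0 := by
      rcases hh with ⟨h, -⟩ | ⟨-, h⟩
      · exact absurd h (by decide)
      · exact h
    subst this
    obtain rfl := (tab 0 m3 (side_first h3).1 (hne1 h3)).1 rfl
    exact good h.1.symm h3 hr
  obtain ⟨w, h⟩ := T.side (show (0 : Fin 3) ≠ 1 by decide)
  obtain ⟨w', h'⟩ := T.side (show (0 : Fin 3) ≠ 2 by decide)
  rcases w with _ | ⟨⟨i, l, m⟩, w⟩
  · exact h.ne_nil rfl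
  rcases w' with _ | ⟨⟨i', l', m'⟩, w'⟩
  · exact h'.ne_nil rfl
  rcases (T.corner2 (by decide) h h' (n0 _) (n1 _) (n2 _)).2 with ⟨rfl, rfl⟩ | ⟨rfl, rfl⟩
  · exact stp (by decide) h h'
  · exact stp (by decide) h' h
theorem eqR4 (T : Tl A B θ L) (hang : θ 0 + θ 1 = π / 3) (HS : ∀ i c, isE A (B i c) → (∀ d, nv B (B i c) d = 1) ∨ nv B (B i c) 2 = 0)
    (n0 : ∀ m, nv B (A m) 0 = 1) (n1 : ∀ m, nv B (A m) 1 = 1) (n2 : ∀ m, nv B (A m) 2 = 0)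
    {p : ℕ} (hp : p ≤ 2) (e : (p * L 0 + L 2)^2 = 11 * (L 0 * L 1)) (hp0 : p = 0 → L 0 ≤ L 1) : False := by
  have hlaw := lawR4 T hang
  have a0 := T.lpos 0
  have b0 := T.lpos 1
  have c0 := T.lpos 2
  have HS' : ∀ i c, isE A (B i c) → nv B (B i c) 2 ≤ 1 := fun i c h => by
    rcases HS i c h with h | h
    · exact (h 2).le
    · omega
  have hside : ∀ {j l w}, IsSide A B j l w → cnt w 0 = p ∧ cnt w 1 = 0 ∧ cnt w 2 = 1 := by
    intro j l w h
    obtain ⟨s1, s2⟩ := T.eq_side hang HS' n0 n1 n2 h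
    obtain ⟨t1, t2⟩ := eqnum a0 b0 c0 hlaw s2 s1
    rw [t1] at s1
    rcases t2 with ⟨t2, t3⟩ | ⟨t2, t3⟩
    · rw [t2] at s1
      refine ⟨?_, t2, t1⟩
      have : ((cnt w 0:ℕ) * L 0 + L 2)^2 = (p * L 0 + L 2)^2 := by rw [e, ← s1]; push_cast; ring
      have := (sq_eq_sq₀ (by positivity) (by positivity)).1 this
      have : (cnt w 0 : ℝ) = p := mul_right_cancel₀ a0.ne' (by linarith)
      exact_mod_cast this
    · rw [t2] at s1
      obtain ⟨u1, u2⟩ := eqnum2 a0 b0 c0 hlaw hp t3 e (by rw [← s1]; push_cast; ring)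
      exact ⟨t2.trans u1.symm, u2, t1⟩
  have ab := mul_pos a0 b0
  rcases Nat.eq_zero_or_pos p with rfl | hp1
  · have e' : L 2 ^ 2 = 11 * (L 0 * L 1) := by rw [← e]; push_cast; ring
    refine eqR40 T n0 n1 n2 hside ?_ ?_
    · refine lt_of_le_of_ne (hp0 rfl) fun h => ?_
      rw [← h] at e' hlaw; nlinarith
    · intro f hf h0
      rw [h0] at hf
      exact sglB a0 b0 c0 hlaw e' (f0 := f 0) (f2 := f 2) (by rw [← hf]; push_cast; ring)
  · refine eqR41 T hang HS n0 n1 n2 (fun h => ?_) ?_ ?_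
    · rw [(hside h).1]; exact ⟨hp1, (hside h).2⟩
    · clear * - hlaw a0 b0 c0 ab; nlinarith
    · intro f hf h0
      rw [h0] at hf
      exact sglA a0 b0 c0 hlaw (p := p) (by omega) e (f1 := f 1) (f2 := f 2) (by rw [← hf]; push_cast; ring)
theorem famR4 (T : Tl A B θ L) (k0 : kap A B 0 = 3) (k1 : kap A B 1 = 3) (k2 : kap A B 2 = 0)
    (HS : ∀ i c, isE A (B i c) → (∀ d, nv B (B i c) d = 1) ∨ nv B (B i c) 2 = 0) : False := by
  have hke := T.kap_eq
  rw [k0, k1, k2] at hke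
  push_cast at hke
  obtain ⟨A', T', hE, hz, hl⟩ := T.split (lst := [[(0,1),(0,1),(3,1)],[(0,1),(0,2),(3,0)],[(0,1),(1,1),(2,1)],[(0,1),(1,2),(2,0)],[(0,2),(1,1),(2,0)],[(1,0),(0,1),(2,2)],
    [(1,0),(1,0),(1,3)],[(1,0),(2,0),(0,3)],[(1,0),(1,1),(1,2)],[(1,0),(2,1),(0,2)],[(1,1),(1,1),(1,1)]]) (by decide +kernel) k0 k1 k2
  clear k0 k1 k2
  have hang : θ 0 + θ 1 = π / 3 := by linarith
  have hang' : θ 1 + θ 0 = π / 3 := by linarith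
  have HS' : ∀ i c, isE A' (B i c) → nv B (B i c) 2 ≤ 1 := fun i c h => by
    rcases HS i c (hE _ h) with h | h
    · exact (h 2).le
    · omega
  have T2 := T'.rel (Equiv.swap 0 1)
  have HS2 : ∀ i c, isE A' ((fun i => (B i).reindex (Equiv.swap 0 1)) i c) → (∀ d, nv (fun i => (B i).reindex (Equiv.swap 0 1)) ((fun i => (B i).reindex (Equiv.swap 0 1)) i c) d = 1) ∨
      nv (fun i => (B i).reindex (Equiv.swap 0 1)) ((fun i => (B i).reindex (Equiv.swap 0 1)) i c) 2 = 0 := by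
    intro i c h
    simp only [nv_rel]
    rcases HS i _ (hE _ h) with h1 | h1
    · exact Or.inl fun d => h1 _
    · exact Or.inr h1
  have HS2' : ∀ i c, isE A' ((fun i => (B i).reindex (Equiv.swap 0 1)) i c) → nv (fun i => (B i).reindex (Equiv.swap 0 1)) ((fun i => (B i).reindex (Equiv.swap 0 1)) i c) 2 ≤ 1 := by
    intro i c h
    rcases HS2 i c h with h | h
    · exact (h 2).le
    · omega
  have hz2 : ∀ m, nv (fun i => (B i).reindex (Equiv.swap 0 1)) (A' m) 2 = 0 := fun m => by rw [nv_rel]; exact hz m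
  by_cases hl1 : [(nv B (A' 0) 0, nv B (A' 0) 1), (nv B (A' 1) 0, nv B (A' 1) 1), (nv B (A' 2) 0, nv B (A' 2) 1)] ∈
      [[(0,1),(0,1),(3,1)],[(0,1),(0,2),(3,0)],[(0,1),(1,1),(2,1)],[(0,1),(1,2),(2,0)],[(0,2),(1,1),(2,0)],[(1,0),(0,1),(2,2)]]
  · exact caseR4 T' hang HS' hz hl1
  by_cases hl2 : [(nv B (A' 0) 1, nv B (A' 0) 0), (nv B (A' 1) 1, nv B (A' 1) 0), (nv B (A' 2) 1, nv B (A' 2) 0)] ∈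
      [[(0,1),(0,1),(3,1)],[(0,1),(0,2),(3,0)],[(0,1),(1,1),(2,1)],[(0,1),(1,2),(2,0)],[(0,2),(1,1),(2,0)],[(1,0),(0,1),(2,2)]]
  · refine caseR4 T2 hang' HS2' hz2 ?_
    simp only [nv_rel]; exact hl2
  simp only [List.mem_cons, List.cons.injEq, Prod.mk.injEq, List.not_mem_nil, and_true, or_false] at hl
  have heq : ((nv B (A' 0) 0 = 1 ∧ nv B (A' 0) 1 = 1) ∧ (nv B (A' 1) 0 = 1 ∧ nv B (A' 1) 1 = 1) ∧ nv B (A' 2) 0 = 1 ∧ nv B (A' 2) 1 = 1) := by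
    clear * - hl hl1 hl2
    rcases hl with hl | hl | hl | hl | hl | hl | hl | hl | hl | hl | hl <;> obtain ⟨⟨a0, a1⟩, ⟨b0, b1⟩, c0, c1⟩ := hl <;>
    ( rw [a0, a1, b0, b1, c0, c1] at hl1 hl2
      first | exact absurd (by decide) hl1 | exact absurd (by decide) hl2 | exact ⟨⟨a0, a1⟩, ⟨b0, b1⟩, c0, c1⟩ )
  obtain ⟨⟨a0, a1⟩, ⟨b0, b1⟩, c0, c1⟩ := heq
  have n0 := fin3 (P := fun m => nv B (A' m) 0 = 1) a0 b0 c0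
  have n1 := fin3 (P := fun m => nv B (A' m) 1 = 1) a1 b1 c1
  have n0' : ∀ m, nv (fun i => (B i).reindex (Equiv.swap 0 1)) (A' m) 0 = 1 := fun m => by rw [nv_rel]; exact n1 m
  have n1' : ∀ m, nv (fun i => (B i).reindex (Equiv.swap 0 1)) (A' m) 1 = 1 := fun m => by rw [nv_rel]; exact n0 m
  have HS1 : ∀ i c, isE A' (B i c) → (∀ d, nv B (B i c) d = 1) ∨ nv B (B i c) 2 = 0 := fun i c h => HS i c (hE _ h)
  obtain ⟨w, h⟩ := T'.side (show (0 : Fin 3) ≠ 1 by decide)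
  obtain ⟨s1, s2⟩ := T'.eq_side hang HS' n0 n1 hz h
  obtain ⟨t1, t2⟩ := eqnum (T.lpos 0) (T.lpos 1) (T.lpos 2) (lawR4 T hang) s2 s1
  rw [t1] at s1
  generalize cnt w 0 = p at *
  generalize cnt w 1 = q at *
  by_cases hp : q = 0 ∧ p ≤ 2 ∧ (p = 0 → L 0 ≤ L 1)
  · obtain ⟨rfl, hp, hp0⟩ := hp
    exact eqR4 T' hang HS1 n0 n1 hz hp (by rw [← s1]; push_cast; ring) hp0
  by_cases hq : p = 0 ∧ q ≤ 2 ∧ (q = 0 → L 1 ≤ L 0)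
  · obtain ⟨rfl, hq, hq0⟩ := hq
    refine eqR4 T2 hang' HS2 n0' n1' hz2 hq ?_ hq0
    change (q * L 1 + L 2)^2 = 11 * (L 1 * L 0)
    rw [mul_comm (L 1), ← s1]; push_cast; ring
  · rcases le_total (L 0) (L 1) with hh | hh
    · have : p = 0 ∧ q ≤ 2 ∧ q ≠ 0 := by clear * - t2 hp hh; by_cases q = 0 <;> grind
      exact hq ⟨this.1, this.2.1, fun h => absurd h this.2.2⟩
    · have : q = 0 ∧ p ≤ 2 ∧ p ≠ 0 := by clear * - t2 hq hh; by_cases p = 0 <;> grind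
      exact hp ⟨this.1, this.2.1, fun h => absurd h this.2.2⟩
theorem num5q {q : ℕ} (h : q*q*(q*q) ≤ 72*(q*q)) : q < 9 := by
  rcases Nat.eq_zero_or_pos q with rfl | h0
  · norm_num
  have := Nat.le_of_mul_le_mul_right h (Nat.mul_pos h0 h0)
  nlinarith
theorem num5a {a b : ℝ} (ha : 0 < a) (hb : 0 < b)
    (hR : a*a+b*b = 9*(a*b) ∨ a*a+4*(b*b) = 7*(a*b) ∨ 4*(a*a)+b*b = 7*(a*b) ∨ 11*(a*a)+11*(b*b) = 27*(a*b))
    {q : ℕ} (h : (q*b)*(q*b) = a*a+b*b-a*b) : False := by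
  have hbb : b * b ≠ 0 := by positivity
  rcases hR with e | e | e | e
  · have h1 : (q:ℝ)*q*b = 8*a := mul_left_cancel₀ hb.ne' (by linear_combination h + e)
    have h2 : (q:ℝ)*q*(q*q)+64 = 72*(q*q) := by
      apply mul_right_cancel₀ hbb
      linear_combination 64*e + (q*q*b+8*a)*h1 - 72*b*h1
    have h3 : q*q*(q*q)+64 = 72*(q*q) := by exact_mod_cast h2
    have hQ : q*q*(q*q) ≤ 72*(q*q) := by omega
    have := num5q hQ
    clear * - h3 this; interval_cases q <;> omega
  · have h1 : ((q:ℝ)*q+3)*b = 6*a := mul_left_cancel₀ hb.ne' (by linear_combination h + e)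
    have h2 : ((q:ℝ)*q+3)*(q*q+3)+144 = 42*(q*q+3) := by
      apply mul_right_cancel₀ hbb
      linear_combination 36*e + ((q*q+3)*b+6*a)*h1 - 42*b*h1
    have h3 : (q*q+3)*(q*q+3)+144 = 42*(q*q+3) := by exact_mod_cast h2
    have hQ : q*q*(q*q) ≤ 72*(q*q) := by nlinarith only [h3]
    have := num5q hQ
    clear * - h3 this; interval_cases q <;> omega
  · rcases Nat.lt_or_ge q 2 with hq | hq
    · interval_cases q
      · push_cast at h; nlinarith [sq_nonneg (a-b)]
      · push_cast at h
        have : a = b := mul_left_cancel₀ ha.ne' (by linarith)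
        subst this; nlinarith
    · have : (2:ℝ) ≤ q := by exact_mod_cast hq
      have h1 : (2*b)*(2*b) ≤ (q*b)*(q*b) := by gcongr
      rw [h] at h1
      have h2 : 22*b ≤ 13*a := by
        by_contra hh; push Not at hh; nlinarith
      nlinarith
  · have h1 : 11*((q:ℝ)*q)*b = 16*a := mul_left_cancel₀ hb.ne' (by linear_combination 11*h+e)
    have h2 : 121*((q:ℝ)*q*(q*q))+256 = 432*(q*q) := by
      apply mul_right_cancel₀ hbb
      linear_combination 256/11*e + (q*q*b+16/11*a)*11*h1 - 432/11*b*h1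
    have h3 : 121*(q*q*(q*q))+256 = 432*(q*q) := by exact_mod_cast h2
    have hQ : q*q*(q*q) ≤ 72*(q*q) := by omega
    have := num5q hQ
    clear * - h3 this; interval_cases q <;> omega
theorem num5 {a b c : ℝ} (ha : 0 < a) (hb : 0 < b) (hc : 0 < c) (h : c*c = a*a+b*b-a*b) {n0 n1 n2 : ℕ} (h0 : 1 ≤ n0) (h1 : 1 ≤ n1)
    (e : (n0*a+n1*b+n2*c)^2 = 11*(a*b)) : n0+n1+n2 ≤ 3 ∧ ∀ f0 f1 : ℕ, f0*a+f1*b ≠ c := by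
  have ab : 0 < a * b := by positivity
  have p0 : (1:ℝ) ≤ n0 := by exact_mod_cast h0
  have p1 : (1:ℝ) ≤ n1 := by exact_mod_cast h1
  have p2 : (0:ℝ) ≤ n2 := by positivity
  have hcc : a * b ≤ c * c := by nlinarith only [h, sq_nonneg (a-b)]
  have key : ∀ x : ℝ, 0 ≤ x → x ≤ n0*a+n1*b+n2*c → x^2 ≤ 11*(a*b) := by
    intro x hx hx'; rw [← e]; gcongr
  have g0 : 1*a ≤ n0*a := by gcongr
  have g1 : 1*b ≤ n1*b := by gcongr
  have g2 : 0 ≤ n2*c := by positivity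
  have s0 : ¬ 3 ≤ n0 := fun hh => by
    have : (3:ℝ)*a ≤ n0*a := by gcongr; exact_mod_cast hh
    have := key (3*a+b) (by positivity) (by linarith)
    nlinarith only [this, ab, sq_nonneg (3*a-b)]
  have s1 : ¬ 3 ≤ n1 := fun hh => by
    have : (3:ℝ)*b ≤ n1*b := by gcongr; exact_mod_cast hh
    have := key (a+3*b) (by positivity) (by linarith)
    nlinarith only [this, ab, sq_nonneg (a-3*b)]
  have s2 : ¬ (2 ≤ n0 ∧ 2 ≤ n1) := fun ⟨hh, hh'⟩ => by
    have : (2:ℝ)*a ≤ n0*a := by gcongr; exact_mod_cast hh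
    have : (2:ℝ)*b ≤ n1*b := by gcongr; exact_mod_cast hh'
    have := key (2*a+2*b) (by positivity) (by linarith)
    nlinarith only [this, ab, sq_nonneg (a-b)]
  have hcab : a*b < a*c + b*c := by
    have c1 : a/2 < c := by nlinarith only [h, sq_nonneg (b-a/2), mul_pos ha ha, hc, ha]
    have c2 : b/2 < c := by nlinarith only [h, sq_nonneg (a-b/2), mul_pos hb hb, hc, hb]
    nlinarith only [mul_lt_mul_of_pos_left c1 hb, mul_lt_mul_of_pos_left c2 ha]
  have s3 : ¬ 2 ≤ n2 := fun hh => by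
    have : (2:ℝ)*c ≤ n2*c := by gcongr; exact_mod_cast hh
    have := key (a+b+2*c) (by positivity) (by linarith)
    nlinarith only [this, hcab, hcc, ab, sq_nonneg (a-b)]
  have s4 : ¬ (2 ≤ n0 ∧ 1 ≤ n2) := fun ⟨hh, hh'⟩ => by
    have : (2:ℝ)*a ≤ n0*a := by gcongr; exact_mod_cast hh
    have : (1:ℝ)*c ≤ n2*c := by gcongr; exact_mod_cast hh'
    have := key (2*a+b+c) (by positivity) (by linarith)
    nlinarith only [this, ab, hcab, hcc, mul_pos ha hc, sq_nonneg (2*a-b)]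
  have s5 : ¬ (2 ≤ n1 ∧ 1 ≤ n2) := fun ⟨hh, hh'⟩ => by
    have : (2:ℝ)*b ≤ n1*b := by gcongr; exact_mod_cast hh
    have : (1:ℝ)*c ≤ n2*c := by gcongr; exact_mod_cast hh'
    have := key (a+2*b+c) (by positivity) (by linarith)
    nlinarith only [this, ab, hcab, hcc, mul_pos hb hc, sq_nonneg (a-2*b)]
  refine ⟨by omega, fun f0 f1 hf => ?_⟩
  have hR : (a*a+b*b = 9*(a*b) ∨ a*a+4*(b*b) = 7*(a*b) ∨ 4*(a*a)+b*b = 7*(a*b) ∨ 11*(a*a)+11*(b*b) = 27*(a*b)) := by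
    have : (n0 = 1 ∧ n1 = 1 ∧ n2 = 0) ∨ (n0 = 1 ∧ n1 = 2 ∧ n2 = 0) ∨ (n0 = 2 ∧ n1 = 1 ∧ n2 = 0) ∨ (n0 = 1 ∧ n1 = 1 ∧ n2 = 1) := by omega
    clear * - this e h ha hb hc ab
    rcases this with ⟨rfl, rfl, rfl⟩ | ⟨rfl, rfl, rfl⟩ | ⟨rfl, rfl, rfl⟩ | ⟨rfl, rfl, rfl⟩ <;> push_cast at e
    · left; linarith
    · right; left; linarith
    · right; right; left; linarith
    · right; right; right
      have h1 : (a+b)*c = 7*(a*b) - (a+b)*(a+b) := by linarith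
      have h2 : (a*b)*(11*(a*a)+11*(b*b)) = (a*b)*(27*(a*b)) := by
        linear_combination ((a+b)*c+7*(a*b) - (a+b)*(a+b))*h1 - (a+b)*(a+b)*h
      exact mul_left_cancel₀ ab.ne' h2
  rcases Nat.eq_zero_or_pos f0 with rfl | z0
  · exact num5a ha hb hR (q := f1) (by rw [← h, ← hf]; push_cast; ring)
  rcases Nat.eq_zero_or_pos f1 with rfl | z1
  · refine num5a hb ha (a := b) (b := a) ?_ (q := f0) (by rw [show b*b+a*a-b*a = c*c by rw [h]; ring, ← hf]; push_cast; ring)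
    rcases hR with hR | hR | hR | hR
    · left; linarith
    · right; right; left; linarith
    · right; left; linarith
    · right; right; right; linarith
  · have q0 : (1:ℝ) ≤ f0 := by exact_mod_cast z0
    have q1 : (1:ℝ) ≤ f1 := by exact_mod_cast z1
    have : a + b ≤ c := by nlinarith only [mul_le_mul_of_nonneg_right q0 ha.le, mul_le_mul_of_nonneg_right q1 hb.le, hf]
    nlinarith only [mul_le_mul this this (by positivity) hc.le, h, ab]
theorem famR5 (T : Tl A B θ L) (k0 : kap A B 0 = 0) (k1 : kap A B 1 = 0) (k2 : kap A B 2 = 3)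
    (HS : ∀ i c, isE A (B i c) → (∀ d, nv B (B i c) d = 1) ∨ (nv B (B i c) 0 = 0 ∧ nv B (B i c) 1 = 0)) : False := by
  have hke := T.kap_eq
  rw [k0, k1, k2] at hke
  push_cast at hke
  have c0 := T.corner_ne 0
  have c1 := T.corner_ne 1
  have c2 := T.corner_ne 2
  unfold kap at k0 k1 k2
  have n0 := fin3 (P := fun m => nv B (A m) 0 = 0) (by omega) (by omega) (by omega)
  have n1 := fin3 (P := fun m => nv B (A m) 1 = 0) (by omega) (by omega) (by omega)
  have n2 := fin3 (P := fun m => nv B (A m) 2 = 1) (by omega) (by omega) (by omega)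
  have hsum := T.sum
  have hv : ∀ m, vang A m = θ 2 := by
    intro m; rw [T.cang m (n0 m) (n1 m) (n2 m)]; push_cast; ring
  have hs2 : sin (θ 2) = sin (θ 0) * cos (θ 1) + cos (θ 0) * sin (θ 1) := by
    rw [← sin_add, ← sin_pi_sub]; congr 1; linarith
  have hc2 : (1:ℝ)/2 = sin (θ 0) * sin (θ 1) - cos (θ 0) * cos (θ 1) := by
    have : cos (π / 3) = -cos (θ 0 + θ 1) := by rw [← cos_pi_sub]; congr 1; linarith
    rw [cos_pi_div_three, cos_add] at this; linarith
  have hlaw : sin (θ 2) * sin (θ 2) = sin (θ 0) * sin (θ 0) + sin (θ 1) * sin (θ 1) - sin (θ 0) * sin (θ 1) := by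
    have g0 := sin_sq_add_cos_sq (θ 0)
    have g1 := sin_sq_add_cos_sq (θ 1)
    rw [hs2]
    linear_combination (sin (θ 1)^2) * g0 + (sin (θ 0)^2) * g1 + 2 * sin (θ 0) * sin (θ 1) * hc2
  obtain ⟨c, hc, L0, L1, L2⟩ := T.Lsin (K := 1) one_pos (one_mul _).symm (one_mul _).symm (one_mul _).symm
  have hlaw' : L 2 * L 2 = L 0 * L 0 + L 1 * L 1 - L 0 * L 1 := by
    rw [L0, L1, L2]; linear_combination c*c*hlaw
  obtain ⟨w, h⟩ := T.side (show (0 : Fin 3) ≠ 1 by decide)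
  have hb := T.beq h
  rw [hv, hv, hv] at hb
  have hp2 : sin (θ 2) ≠ 0 := fun h => by
    have := T.lpos 2; rw [L2, h] at this; simp at this
  have hb' : (cnt w 0*L 0+cnt w 1*L 1+cnt w 2*L 2)^2 = 11*(L 0*L 1) := by
    apply mul_right_cancel₀ (mul_ne_zero hp2 hp2)
    rw [L0, L1, L2]
    linear_combination c*c*hb
  have HG : ∀ e, e ≠ 2 → ∀ i c, isE A (B i c) → nv B (B i c) e ≤ 1 ∧ (1 ≤ nv B (B i c) e → ∀ d, nv B (B i c) d = 1) := by
    intro e he i c hE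
    rcases HS i c hE with h1 | ⟨h1, h2⟩
    · exact ⟨(h1 e).le, fun _ => h1⟩
    · have : e = 0 ∨ e = 1 := by clear * - he; revert e; decide
      rcases this with rfl | rfl
      · exact ⟨by omega, by omega⟩
      · exact ⟨by omega, by omega⟩
  have q0 := T.pig (fun i j hE => (HG 0 (by decide) i j hE).1) h (n0 _) (n0 _)
  have q1 := T.pig (fun i j hE => (HG 1 (by decide) i j hE).1) h (n1 _) (n1 _)
  obtain ⟨hlen, hsg⟩ := num5 (T.lpos 0) (T.lpos 1) (T.lpos 2) hlaw' q0 q1 hb'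
  have hS : Sgl L 2 := by
    intro f hf h0
    rw [h0] at hf
    exact hsg (f 0) (f 1) (by rw [← hf]; push_cast; ring)
  have hG : Gd A B 0 := ⟨fun i c hE => HG 0 (by decide) i c hE, fun p => by rw [n0]; omega⟩
  obtain ⟨w1, h1⟩ := T.side (show (0 : Fin 3) ≠ 2 by decide)
  obtain ⟨w2, h2⟩ := T.side (show (1 : Fin 3) ≠ 2 by decide)
  have oth : ∀ p : Fin 3, ∀ k', k' ≠ 2 → nv B (A p) k' = 0 := fun p => nv_oth2 (n0 p) (n1 p)
  rw [cnt_sum] at hlen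
  have hlen2 := cnt_sum w
  rcases w with _ | ⟨⟨i, l, m⟩, _ | ⟨⟨j, l', m'⟩, _ | ⟨⟨k, l'', m''⟩, _ | ⟨x, w⟩⟩⟩⟩
  · exact h.ne_nil rfl
  · simp only [List.length_cons, List.length_nil] at hlen2; omega
  · have e1 := T.cnext hG (by decide) (by decide) hS h h1 (n2 _) (oth _)
    have hr : IsSide A B 1 0 [(j,m',l'),(i,m,l)] := h.rev
    rcases w2 with _ | ⟨⟨i2, l2, m2⟩, w2⟩
    · exact h2.ne_nil rfl
    have e2 := (Tl.corner1 (by decide) hr h2 (n2 _) (oth _)).2.1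
    exact (T.side_vert (w := []) h).2.1 (e1.trans e2.symm)
  · have e1 := T.cnext hG (by decide) (by decide) hS h h1 (n2 _) (oth _)
    have hr : IsSide A B 1 0 [(k,m'',l''),(j,m',l'),(i,m,l)] := h.rev
    have e2 := T.cnext hG (by decide) (by decide) hS hr h2 (n2 _) (oth _)
    exact (T.side_vert (w := []) h).2.1 (e1.trans e2.symm)
  · simp only [List.length_cons] at hlen; omega
theorem Tl.numkill (T : Tl A B θ L) {n i j k : ℕ} (hT : inT n i j = true) (hi : 0 < i) (hj : 0 < j) (hk : 0 < k)
    (hn : i + j + k = n) (e0 : θ 0 = π * i / n) (e1 : θ 1 = π * j / n) (e2 : θ 2 = π * k / n) : False := by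
  have n0 : (0:ℝ) < n := by exact_mod_cast (by omega : 0 < n)
  obtain ⟨a, ha⟩ : ∃ a : Fin 3 → ℕ, ∀ m, a m = nv B (A m) 0 * i + nv B (A m) 1 * j + nv B (A m) 2 * k := ⟨_, fun _ => rfl⟩
  have hv : ∀ m, vang A m = π * a m / n := fun m => by
    rw [T.cang m rfl rfl rfl, ha, e0, e1, e2]; push_cast; ring
  have hp : ∀ m, 0 < a m := fun m => by
    by_contra h
    have := vang_pos A m
    rw [hv, show a m = 0 by omega] at this; simp at this
  have hs : a 0 + a 1 + a 2 = n := by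
    have h := vang_sum A
    rw [hv, hv, hv] at h
    have : π * ((a 0 + a 1 + a 2 : ℕ) : ℝ) = π * n := by
      push_cast; field_simp at h; rw [h]
    exact_mod_cast mul_left_cancel₀ Real.pi_ne_zero this
  have key : ∀ x y z : Fin 3, y ≠ z → th y z = x → a x ≤ a y → a y ≤ a z → a x + a y + a z = n → False := by
    intro x y z hyz hx h1 h2 h3
    obtain ⟨w, hw⟩ := T.side hyz
    have h := T.beq hw
    rw [hx, e0, e1, e2, hv, hv, hv] at h
    exact num_sound hT hi hj hk hn (hp x) h1 h2 h3 (by rw [cnt_sum]; exact (T.side_len hw).2) h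
  rcases le_total (a 0) (a 1) with h | h <;> rcases le_total (a 1) (a 2) with h' | h' <;> rcases le_total (a 0) (a 2) with h'' | h''
  · exact key 0 1 2 (by decide) (by decide) h h' hs
  · exact key 0 1 2 (by decide) (by decide) h h' hs
  · exact key 0 2 1 (by decide) (by decide) h'' h' (by omega)
  · exact key 2 0 1 (by decide) (by decide) h'' h (by omega)
  · exact key 1 0 2 (by decide) (by decide) h h'' (by omega)
  · exact key 1 2 0 (by decide) (by decide) h' h'' (by omega)
  · exact key 2 1 0 (by decide) (by decide) h' h (by omega)
  · exact key 2 1 0 (by decide) (by decide) h' h (by omega)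
def chkT (x y z : ℕ) : Bool :=
  cond (Nat.ble x y) (cond (Nat.ble y z) (frc (Nat.gcd (Nat.gcd x y) z) fun g =>
    inT (Nat.div (Nat.add (Nat.add x y) z) g) (Nat.div x g) (Nat.div y g)) true) true
def pos3 (x y z : ℕ) : Bool := cond (Nat.ble 1 x) (cond (Nat.ble 1 y) (Nat.ble 1 z) false) false
def crP (w p q r s : ℕ) : ℕ := Nat.add (Nat.add (Nat.mul p s) q) (Nat.mul w r)
def rat (w p q r a b c : ℕ) : Bool :=
  frc (crP w q r b c) fun P0 => frc (crP w r q c b) fun N0 =>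
  frc (crP w r p c a) fun P1 => frc (crP w p r a c) fun N1 =>
  frc (crP w p q a b) fun P2 => frc (crP w q p b a) fun N2 =>
  cond (pos3 (Nat.sub P0 N0) (Nat.sub P1 N1) (Nat.sub P2 N2)) (chkT (Nat.sub P0 N0) (Nat.sub P1 N1) (Nat.sub P2 N2))
  (cond (pos3 (Nat.sub N0 P0) (Nat.sub N1 P1) (Nat.sub N2 P2)) (chkT (Nat.sub N0 P0) (Nat.sub N1 P1) (Nat.sub N2 P2))
  (cond (Nat.beq P0 N0) (cond (Nat.beq P1 N1) (cond (Nat.beq P2 N2) false true) true) true))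
theorem pos3_iff (x y z : ℕ) : pos3 x y z = true ↔ 0 < x ∧ 0 < y ∧ 0 < z := by
  simp only [pos3, Bool.cond_false_right, Bool.and_eq_true, Nat.ble_eq]; exact Iff.rfl
theorem Tl.chkT (T : Tl A B θ L) (s1 : θ 0 ≤ θ 1) (s2 : θ 1 ≤ θ 2) {x y z : ℕ} (hp : 0 < x ∧ 0 < y ∧ 0 < z)
    (h : chkT x y z = true) (e1 : θ 0 * y = θ 1 * x) (e2 : θ 0 * z = θ 2 * x) (e3 : θ 1 * z = θ 2 * y) : False := by
  obtain ⟨hx, hy, hz⟩ := hp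
  have p0 := T.pos 0
  have p1 := T.pos 1
  have p2 := T.pos 2
  have hx' : (0:ℝ) < x := by exact_mod_cast hx
  have hy' : (0:ℝ) < y := by exact_mod_cast hy
  have hz' : (0:ℝ) < z := by exact_mod_cast hz
  have h1 : x ≤ y := by
    have : (x:ℝ) ≤ y := by nlinarith only [e1, s1, p0, hx']
    exact_mod_cast this
  have h2 : y ≤ z := by
    have : (y:ℝ) ≤ z := by nlinarith only [e3, s2, p1, hy']
    exact_mod_cast this
  have hS := T.sum
  simp only [_root_.chkT, frc_eq, Nat.ble_eq_true_of_le h1, Nat.ble_eq_true_of_le h2, cond_true] at h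
  set g := Nat.gcd (Nat.gcd x y) z with hg
  have g0 : 0 < g := Nat.gcd_pos_of_pos_right _ hz
  have d0 : g ∣ x := (Nat.gcd_dvd_left _ _).trans (Nat.gcd_dvd_left _ _)
  have d1 : g ∣ y := (Nat.gcd_dvd_left _ _).trans (Nat.gcd_dvd_right _ _)
  have d2 : g ∣ z := Nat.gcd_dvd_right _ _
  obtain ⟨i, hi⟩ := d0
  obtain ⟨j, hj⟩ := d1
  obtain ⟨k, hk⟩ := d2
  clear_value g
  subst hi hj hk
  have g0' : (0:ℝ) < g := by exact_mod_cast g0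
  have h' : inT (i + j + k) i j = true := by
    have q0 : (g * i).div g = i := Nat.mul_div_cancel_left i g0
    have q1 : (g * j).div g = j := Nat.mul_div_cancel_left j g0
    have q2 : (((g * i).add (g * j)).add (g * k)).div g = i + j + k := by
      have := Nat.mul_div_cancel_left (i + j + k) g0
      rw [mul_add, mul_add] at this; exact this
    rwa [q0, q1, q2] at h
  push_cast at e1 e2 e3 hx' hy' hz'
  have i0 := Nat.pos_of_mul_pos_left hx
  have j0 := Nat.pos_of_mul_pos_left hy
  have k0 := Nat.pos_of_mul_pos_left hz
  have i0' : (0:ℝ) < i := by exact_mod_cast i0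
  have j0' : (0:ℝ) < j := by exact_mod_cast j0
  have k0' : (0:ℝ) < k := by exact_mod_cast k0
  have f1 : θ 0 * j = θ 1 * i := mul_left_cancel₀ g0'.ne' (by linear_combination e1)
  have f2 : θ 0 * k = θ 2 * i := mul_left_cancel₀ g0'.ne' (by linear_combination e2)
  have f3 : θ 1 * k = θ 2 * j := mul_left_cancel₀ g0'.ne' (by linear_combination e3)
  refine T.numkill h' i0 j0 k0 rfl ?_ ?_ ?_ <;> rw [eq_div_iff (by positivity)] <;> push_cast
  · linear_combination i * hS + f1 + f2
  · linear_combination j * hS - f1 + f3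
  · linear_combination k * hS - f2 - f3
theorem Tl.rat (T : Tl A B θ L) (s1 : θ 0 ≤ θ 1) (s2 : θ 1 ≤ θ 2) {w p q r a b c : ℕ}
    (h : rat w p q r a b c = true) (h1 : p * θ 0 + q * θ 1 + r * θ 2 = w * π) (h2 : a * θ 0 + b * θ 1 + c * θ 2 = π) : False := by
  have p0 := T.pos 0
  have p1 := T.pos 1
  have p2 := T.pos 2
  have hS := T.sum
  simp only [_root_.rat, frc_eq] at h
  obtain ⟨P0, hP0⟩ : ∃ x, x = crP w q r b c := ⟨_, rfl⟩
  obtain ⟨N0, hN0⟩ : ∃ x, x = crP w r q c b := ⟨_, rfl⟩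
  obtain ⟨P1, hP1⟩ : ∃ x, x = crP w r p c a := ⟨_, rfl⟩
  obtain ⟨N1, hN1⟩ : ∃ x, x = crP w p r a c := ⟨_, rfl⟩
  obtain ⟨P2, hP2⟩ : ∃ x, x = crP w p q a b := ⟨_, rfl⟩
  obtain ⟨N2, hN2⟩ : ∃ x, x = crP w q p b a := ⟨_, rfl⟩
  rw [← hP0, ← hP1, ← hP2, ← hN0, ← hN1, ← hN2] at h
  have E : ∀ x y z u v : ℕ, ((crP x y z u v : ℕ) : ℝ) = y * v + z + x * u := fun x y z u v => by
    show ((y * v + z + x * u : ℕ) : ℝ) = _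
    push_cast; ring
  have e1 : θ 0 * ((P1:ℝ) - N1) = θ 1 * (P0 - N0) := by
    rw [hP0, hP1, hN0, hN1]; simp only [E]
    linear_combination (1 - (c:ℝ)) * h1 + ((r:ℝ) - w) * h2 + (w * ((c:ℝ) - 1) - ((r:ℝ) - w)) * hS
  have e2 : θ 0 * ((P2:ℝ) - N2) = θ 2 * (P0 - N0) := by
    rw [hP0, hP2, hN0, hN2]; simp only [E]
    linear_combination ((b:ℝ) - 1) * h1 - ((q:ℝ) - w) * h2 - (w * ((b:ℝ) - 1) - ((q:ℝ) - w)) * hS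
  have e3 : θ 1 * ((P2:ℝ) - N2) = θ 2 * (P1 - N1) := by
    rw [hP1, hP2, hN1, hN2]; simp only [E]
    linear_combination (1 - (a:ℝ)) * h1 + ((p:ℝ) - w) * h2 + (w * ((a:ℝ) - 1) - ((p:ℝ) - w)) * hS
  clear hP0 hP1 hP2 hN0 hN1 hN2 h1 h2 E
  have lt : ∀ {u v : ℕ}, (u:ℝ) < v ↔ u < v := Nat.cast_lt
  by_cases c1 : N0 < P0 ∧ N1 < P1 ∧ N2 < P2
  · have c2 : 0 < P0 - N0 ∧ 0 < P1 - N1 ∧ 0 < P2 - N2 := by omega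
    rw [show pos3 (P0.sub N0) (P1.sub N1) (P2.sub N2) = true from (pos3_iff _ _ _).2 c2, cond_true] at h
    refine T.chkT s1 s2 c2 h ?_ ?_ ?_ <;> rw [Nat.cast_sub (by omega), Nat.cast_sub (by omega)] <;> assumption
  by_cases c2 : P0 < N0 ∧ P1 < N1 ∧ P2 < N2
  · have c3 : 0 < N0 - P0 ∧ 0 < N1 - P1 ∧ 0 < N2 - P2 := by omega
    have c4 : ¬ (0 < P0 - N0 ∧ 0 < P1 - N1 ∧ 0 < P2 - N2) := by omega
    have c5 : pos3 (P0.sub N0) (P1.sub N1) (P2.sub N2) = false := by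
      rw [← Bool.not_eq_true, pos3_iff]; exact c4
    rw [c5, cond_false, show pos3 (N0.sub P0) (N1.sub P1) (N2.sub P2) = true from (pos3_iff _ _ _).2 c3, cond_true] at h
    refine T.chkT s1 s2 c3 h ?_ ?_ ?_ <;> rw [Nat.cast_sub (by omega), Nat.cast_sub (by omega)] <;> linarith
  by_cases c3 : P0 = N0 ∧ P1 = N1 ∧ P2 = N2
  · obtain ⟨rfl, rfl, rfl⟩ := c3
    have c5 : pos3 (P0.sub P0) (P1.sub P1) (P2.sub P2) = false := by
      rw [← Bool.not_eq_true, pos3_iff]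
      show ¬ (0 < P0 - P0 ∧ _)
      omega
    have b : ∀ x : ℕ, x.beq x = true := fun x => Nat.beq_refl x
    rw [c5, b, b, b] at h; simp at h
  have K : ∀ {x y d e : ℝ}, 0 < x → 0 < y → x * d = y * e → (0 < d ↔ 0 < e) ∧ (d < 0 ↔ e < 0) := by
    intro x y d e hx hy hh
    refine ⟨⟨fun hd => ?_, fun hd => ?_⟩, ⟨fun hd => ?_, fun hd => ?_⟩⟩ <;> by_contra hc <;> push Not at hc <;>
      nlinarith only [hh, mul_nonneg hx.le (sub_nonneg.2 hc), hc, hd, mul_pos hx hy, hx, hy, mul_nonneg hy.le (sub_nonneg.2 hc), mul_pos hx (sub_pos.2 hd), mul_pos hy (sub_pos.2 hd)]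
  have k1 := K p0 p1 e1
  have k2 := K p0 p2 e2
  simp only [sub_pos, sub_neg, Nat.cast_lt] at k1 k2
  omega
def famL : List (ℕ × ℕ × ℕ) := [(1,1,1),(0,0,3),(3,0,0),(0,1,2),(2,1,0),(0,2,1),(2,0,1),(1,0,2),(1,2,0),(2,2,0),(0,3,0),
  (3,1,0),(1,3,0),(3,0,1),(2,3,0),(3,2,0),(3,3,0)]
def mem3 (l : List (ℕ × ℕ × ℕ)) (a b c : ℕ) : Bool :=
  l.any fun t => cond (Nat.beq t.1 a) (cond (Nat.beq t.2.1 b) (Nat.beq t.2.2 c) false) false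
def abel (w a b c : ℕ) : Bool :=
  cond (Nat.ble w c) (cond (Nat.ble (Nat.add w w) (Nat.add b c)) (Nat.blt (Nat.add (Nat.add w w) w) (Nat.add a (Nat.add b c))) false) false
def surp (w a b c : ℕ) : Bool := cond (Nat.blt w c) true (cond (Nat.beq c w) (Nat.blt w b) false)
def st1 : Bool := aF (fun w => aF (fun p => aF (fun q => aF (fun r =>
  cond (surp w p q r) (cond (abel w p q r) true
   (aF (fun a => aF (fun b => aF (fun c => cond (abel 1 a b c) true (cond (Nat.blt (Nat.add a (Nat.add b c)) 3) true (cond (mem3 famL a b c) true (rat w p q r a b c)))) 0 4) 0 12) 0 12)) true)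
     0 12) 0 12) 0 12) 1 2
theorem st1_ok : st1 = true := by decide +kernel
def st2 : Bool := (famL.drop 10).all fun t => aF (fun p => aF (fun q => aF (fun r =>
  cond (abel 1 p q r) true (cond (mem3 [(1,1,1),t] p q r) true (rat 1 p q r t.1 t.2.1 t.2.2))) 0 4) 0 12) 0 12
theorem st2_ok : st2 = true := by decide +kernel
theorem Tl.abelK (T : Tl A B θ L) (s1 : θ 0 ≤ θ 1) (s2 : θ 1 ≤ θ 2) {w p q r : ℕ} (h : p * θ 0 + q * θ 1 + r * θ 2 = w * π)
    (h1 : w ≤ r) (h2 : w + w ≤ q + r) (h3 : w + w + w < p + (q + r)) : False := by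
  have p0 := T.pos 0
  have hS := T.sum
  have h1' : (w:ℝ) ≤ r := by exact_mod_cast h1
  have h2' : (w:ℝ) + w ≤ q + r := by exact_mod_cast h2
  have h3' : (w:ℝ) + w + w < p + (q + r) := by exact_mod_cast h3
  nlinarith only [mul_nonneg (sub_nonneg.2 h1') (sub_nonneg.2 s2), mul_nonneg (sub_nonneg.2 h2') (sub_nonneg.2 s1),
    mul_pos (sub_pos.2 h3') p0, h, hS]
theorem all3 {P : Fin 3 → Prop} : (∀ k, P k) ↔ P 0 ∧ P 1 ∧ P 2 := by simp [Fin.forall_fin_succ]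
theorem abel_iff (w a b c : ℕ) : abel w a b c = true ↔ w ≤ c ∧ w + w ≤ b + c ∧ w + w + w < a + (b + c) := by
  simp only [abel, Bool.cond_false_right, Bool.and_eq_true, Nat.ble_eq, Nat.blt_eq]; exact Iff.rfl
theorem mem3_iff (l : List (ℕ × ℕ × ℕ)) (a b c : ℕ) : mem3 l a b c = true ↔ (a, b, c) ∈ l := by
  simp only [mem3, List.any_eq_true, Bool.cond_false_right, Bool.and_eq_true, Nat.beq_eq]
  constructor
  · rintro ⟨⟨x, y, z⟩, h, rfl, rfl, rfl⟩; exact h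
  · exact fun h => ⟨_, h, rfl, rfl, rfl⟩
theorem surp_iff (w a b c : ℕ) : surp w a b c = true ↔ w < c ∨ (c = w ∧ w < b) := by
  simp only [surp, Bool.cond_false_right, Bool.cond_true_left, Bool.or_eq_true, Bool.and_eq_true, Nat.blt_eq, Nat.beq_eq]
theorem Tl.stage1 (T : Tl A B θ L) (s1 : θ 0 ≤ θ 1) (s2 : θ 1 ≤ θ 2) :
    (kap A B 0, kap A B 1, kap A B 2) ∈ famL := by
  by_cases hk : kap A B 0 = 1 ∧ kap A B 1 = 1 ∧ kap A B 2 = 1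
  · rw [hk.1, hk.2.1, hk.2.2]; decide
  obtain ⟨v, w, hw, hv, h1, h2⟩ := T.surplus hk
  have hK := T.kap_eq
  have l0 := kap_le T 0
  have l1 := kap_le T 1
  have c0 := T.corner_ne 0
  have c1 := T.corner_ne 1
  have c2 := T.corner_ne 2
  have hs : 3 ≤ kap A B 0 + (kap A B 1 + kap A B 2) := by unfold kap; omega
  generalize kap A B 0 = a at *
  generalize kap A B 1 = b at *
  generalize kap A B 2 = c at *
  have l2 : c < 4 := by
    by_contra hc
    exact T.abelK s1 s2 (w := 1) (p := a) (q := b) (r := c) (by push_cast; linarith) (by omega) (by omega) (by omega)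
  have H := st1_ok
  replace H := aF_sound _ H (p := w) (by omega) (by omega)
  replace H := aF_sound _ H (p := v 0) (by omega) (by have := hv 0; omega)
  replace H := aF_sound _ H (p := v 1) (by omega) (by have := hv 1; omega)
  replace H := aF_sound _ H (p := v 2) (by omega) (by have := hv 2; omega)
  have e1 : surp w (v 0) (v 1) (v 2) = true := (surp_iff _ _ _ _).2 h2
  simp only [e1, cond_true] at H
  by_cases e2 : abel w (v 0) (v 1) (v 2) = true
  · rw [abel_iff] at e2
    exact (T.abelK s1 s2 h1 e2.1 e2.2.1 e2.2.2).elim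
  rw [Bool.not_eq_true] at e2
  simp only [e2, cond_false] at H
  replace H := aF_sound _ H (p := a) (by omega) (by omega)
  replace H := aF_sound _ H (p := b) (by omega) (by omega)
  replace H := aF_sound _ H (p := c) (by omega) (by omega)
  by_cases e3 : abel 1 a b c = true
  · rw [abel_iff] at e3
    exact (T.abelK s1 s2 (w := 1) (by push_cast; linarith) e3.1 e3.2.1 e3.2.2).elim
  rw [Bool.not_eq_true] at e3
  have e4 : Nat.blt (Nat.add a (Nat.add b c)) 3 = false := by
    rw [← Bool.not_eq_true, Nat.blt_eq]; show ¬ (a + (b + c) < 3); omega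
  simp only [e3, e4, cond_false] at H
  by_cases e5 : mem3 famL a b c = true
  · exact (mem3_iff _ _ _ _).1 e5
  rw [Bool.not_eq_true] at e5
  simp only [e5, cond_false] at H
  exact (T.rat s1 s2 H h1 hK).elim
def HSg (A : AB) (B : Fin 11 → AB) : Prop := ∀ i c, isE A (B i c) →
  (∀ d, nv B (B i c) d = 1) ∨ (∀ d, nv B (B i c) d = kap A B d)
theorem Tl.stage2 (T : Tl A B θ L) (s1 : θ 0 ≤ θ 1) (s2 : θ 1 ≤ θ 2)
    (h : (kap A B 0, kap A B 1, kap A B 2) ∈ famL.drop 10) : HSg A B := by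
  intro i c hE
  have h1 := T.straight i c hE
  rw [Fin.sum_univ_three] at h1
  have n0 := nv_le (B := B) (B i c) 0
  have n1 := nv_le (B := B) (B i c) 1
  have hK := T.kap_eq
  rw [all3, all3]
  generalize kap A B 0 = a at *
  generalize kap A B 1 = b at *
  generalize kap A B 2 = d at *
  generalize nv B (B i c) 0 = p at *
  generalize nv B (B i c) 1 = q at *
  generalize nv B (B i c) 2 = r at *
  have h1' : p * θ 0 + q * θ 1 + r * θ 2 = (1:ℕ) * π := by push_cast; linarith
  have l2 : r < 4 := by
    by_contra hc
    exact T.abelK s1 s2 h1' (by omega) (by omega) (by omega)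
  have H := st2_ok
  rw [st2, List.all_eq_true] at H
  replace H := H _ h
  replace H := aF_sound _ H (p := p) (by omega) (by omega)
  replace H := aF_sound _ H (p := q) (by omega) (by omega)
  replace H := aF_sound _ H (p := r) (by omega) (by omega)
  by_cases e3 : abel 1 p q r = true
  · rw [abel_iff] at e3
    exact (T.abelK s1 s2 h1' e3.1 e3.2.1 e3.2.2).elim
  rw [Bool.not_eq_true] at e3
  simp only [e3, cond_false] at H
  by_cases e5 : mem3 [(1,1,1),(a,b,d)] p q r = true
  · rw [mem3_iff] at e5
    simpa using e5
  rw [Bool.not_eq_true] at e5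
  simp only [e5, cond_false] at H
  exact (T.rat s1 s2 H h1' hK).elim
theorem HSg_rel (h : HSg A B) (σ : Equiv.Perm (Fin 3)) : HSg A (fun i => (B i).reindex σ) := by
  intro i c hE
  rw [AffineBasis.reindex_apply] at hE ⊢
  rcases h i _ hE with h' | h'
  · left; intro d; rw [nv_rel, h']
  · right; intro d; rw [nv_rel, kap_rel, h']
theorem Tl.sum3 (T : Tl A B θ L) (hs : kap A B 0 + kap A B 1 + kap A B 2 = 3) :
    ∃ f : Fin 3 → Fin 3, (∀ m, 1 ≤ nv B (A m) (f m)) ∧ (∀ m, vang A m = θ (f m)) ∧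
      ∀ k, kap A B k = (if f 0 = k then 1 else 0) + (if f 1 = k then 1 else 0) + (if f 2 = k then 1 else 0) := by
  have c0 := T.corner_ne 0
  have c1 := T.corner_ne 1
  have c2 := T.corner_ne 2
  have h : ∀ m, nv B (A m) 0 + nv B (A m) 1 + nv B (A m) 2 = 1 := by
    rw [all3]; unfold kap at hs; omega
  have h' : ∀ m, ∃ k, ∀ d, nv B (A m) d = if k = d then 1 else 0 := by
    intro m
    have := h m
    by_cases a0 : nv B (A m) 0 = 1
    · refine ⟨0, ?_⟩; rw [all3]; simp; omega
    by_cases a1 : nv B (A m) 1 = 1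
    · refine ⟨1, ?_⟩; rw [all3]; simp; omega
    · refine ⟨2, ?_⟩; rw [all3]; simp; omega
  choose f hf using h'
  refine ⟨f, fun m => by rw [hf, if_pos rfl], fun m => ?_, fun k => by simp only [kap, hf]⟩
  rw [← T.corner m, Fin.sum_univ_three, hf, hf, hf]
  generalize f m = x
  fin_cases x <;> simp
set_option synthInstance.maxSize 4096 in
set_option synthInstance.maxHeartbeats 400000 in
theorem R0aux : ∀ a b x y z : Fin 3, a ≠ b → (if x = a then 1 else 0) + (if y = a then 1 else 0) + (if z = a then 1 else 0) = 2 →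
    (if x = b then 1 else 0) + (if y = b then 1 else 0) + (if z = b then 1 else 0) = 0 →
    ∃ m0 : Fin 3, ![x, y, z] m0 = a ∧ (∀ m : Fin 3, ![x, y, z] m ≠ b) ∧ ∀ m m' : Fin 3, m ≠ m' → m ≠ m0 → m' ≠ m0 → ![x, y, z] m ≠ ![x, y, z] m' := by
  decide +kernel
theorem Tl.R0 (T : Tl A B θ L) {a b : Fin 3} (hab : a ≠ b) (hθ : θ a = θ b) (ha : kap A B a = 2) (hb : kap A B b = 0)
    (hs : kap A B 0 + kap A B 1 + kap A B 2 = 3) : False := by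
  obtain ⟨f, h1, h2, h3⟩ := T.sum3 hs
  rw [h3] at ha hb
  have : ∃ m0, f m0 = a ∧ (∀ m, f m ≠ b) ∧ ∀ m m', m ≠ m' → m ≠ m0 → m' ≠ m0 → f m ≠ f m' := by
    clear * - hab ha hb
    obtain ⟨x, hx⟩ : ∃ x, f 0 = x := ⟨_, rfl⟩
    obtain ⟨y, hy⟩ : ∃ x, f 1 = x := ⟨_, rfl⟩
    obtain ⟨z, hz⟩ : ∃ x, f 2 = x := ⟨_, rfl⟩
    have : f = ![x, y, z] := by funext m; fin_cases m <;> simp [hx, hy, hz]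
    subst this
    exact R0aux a b x y z hab ha hb
  obtain ⟨m0, q0, q1, q2⟩ := this
  exact T.caseR0 hab hθ f h1 h2 q0 q1 q2
theorem Tl.inj (T : Tl A B θ L) (h : ∀ k, kap A B k = 1) : False := by
  obtain ⟨f, h1, h2, h3⟩ := T.sum3 (by rw [h, h, h])
  have hf : Function.Injective f := by
    have q : ∀ k, 1 = (if f 0 = k then 1 else 0) + (if f 1 = k then 1 else 0) + (if f 2 = k then 1 else 0) := fun k => by rw [← h3, h]
    refine Finite.injective_iff_surjective.2 fun k => ?_
    by_contra hc
    push Not at hc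
    have := q k
    simp [hc] at this
  obtain ⟨p, hp⟩ := perm_of f hf
  exact T.caseP p (fun m => by rw [hp]; exact h1 m) (fun m => by rw [hp]; exact h2 m)
theorem Tl.equi (T : Tl A B θ L) (h1 : θ 0 = θ 1) (h2 : θ 1 = θ 2) : False := by
  have hS := T.sum
  refine T.numkill (n := 3) (i := 1) (j := 1) (k := 1) (by decide +kernel) (by decide) (by decide) (by decide) rfl ?_ ?_ ?_ <;>
    push_cast <;> linarith
theorem Tl.fR1 (T : Tl A B θ L) (H : HSg A B) (h : kap A B 0 = 3 ∧ kap A B 1 = 1 ∧ kap A B 2 = 0) : False :=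
  famR1 T h.1 h.2.1 h.2.2 fun i c hE => (H i c hE).imp id fun h' => by rw [h', h.2.2]
theorem Tl.fR3 (T : Tl A B θ L) (H : HSg A B) (h : kap A B 0 = 2 ∧ kap A B 1 = 3 ∧ kap A B 2 = 0) : False :=
  famR3 T h.1 h.2.1 h.2.2 fun i c hE => (H i c hE).imp id fun h' => by rw [h', h', h.1, h.2.2]; exact ⟨rfl, rfl⟩
theorem core1 (T : Tl A B θ L) (s1 : θ 0 ≤ θ 1) (s2 : θ 1 ≤ θ 2) : False := by
  have h := T.stage1 s1 s2
  have hS := T.sum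
  have hK := T.kap_eq
  have hH := T.stage2 s1 s2
  have R1 := fun σ H h => (T.rel σ).fR1 (HSg_rel H σ) h
  have R3 := fun σ H h => (T.rel σ).fR3 (HSg_rel H σ) h
  have R5 := fun σ => famR5 (T.rel σ)
  simp only [kap_rel] at R1 R3 R5
  simp only [famL, List.mem_cons, Prod.mk.injEq, List.not_mem_nil, or_false] at h
  rcases h with h|h|h|h|h|h|h|h|h|h|h|h|h|h|h|h|h <;> obtain ⟨k0, k1, k2⟩ := h <;>
    simp only [k0, k1, k2] at hH <;> rw [k0, k1, k2] at hK <;> push_cast at hK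
  · exact T.inj (by rw [all3]; exact ⟨k0, k1, k2⟩)
  · exact T.equi (by linarith) (by linarith)
  · exact T.equi (by linarith) (by linarith)
  · exact T.equi (by linarith) (by linarith)
  · exact T.equi (by linarith) (by linarith)
  · exact T.R0 (a := 1) (b := 0) (by decide) (by linarith) k1 k0 (by omega)
  · exact T.R0 (a := 0) (b := 1) (by decide) (by linarith) k0 k1 (by omega)
  · exact T.R0 (a := 2) (b := 1) (by decide) (by linarith) k2 k1 (by omega)
  · exact T.R0 (a := 1) (b := 2) (by decide) (by linarith) k1 k2 (by omega)
  · exact famR2 T k0 k1 k2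
  · have H := HSg_rel (hH (by decide)) (Equiv.swap 1 2)
    refine R5 (Equiv.swap 1 2) k0 k2 k1 fun i c hE => (H i c hE).imp id fun h' => ?_
    rw [h', h', kap_rel, kap_rel]; exact ⟨k0, k2⟩
  · exact R1 1 (hH (by decide)) ⟨k0, k1, k2⟩
  · exact R1 (Equiv.swap 0 1) (hH (by decide)) ⟨k1, k0, k2⟩
  · exact R1 (Equiv.swap 1 2) (hH (by decide)) ⟨k0, k2, k1⟩
  · exact R3 1 (hH (by decide)) ⟨k0, k1, k2⟩
  · exact R3 (Equiv.swap 0 1) (hH (by decide)) ⟨k1, k0, k2⟩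
  · exact famR4 T k0 k1 k2 fun i c hE => (hH (by decide) i c hE).imp id fun h' => by rw [h', k2]
theorem core (T : Tl A B θ L) : False := by
  have : ∃ σ : Equiv.Perm (Fin 3), θ (σ.symm 0) ≤ θ (σ.symm 1) ∧ θ (σ.symm 1) ≤ θ (σ.symm 2) := by
    have hm := Tuple.monotone_sort θ
    exact ⟨(Tuple.sort θ).symm, hm (by decide), hm (by decide)⟩
  obtain ⟨σ, h1, h2⟩ := this
  exact core1 (T.rel σ) h1 h2
end
theorem indep_iff (T : Tri) : AffineIndependent ℝ T ↔ ∀ k, dist (T k) (T (k+1)) + dist (T (k+1)) (T (k+2)) ≠ dist (T k) (T (k+2)) := by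
  have hT : T = ![T 0, T 1, T 2] := by funext m; fin_cases m <;> rfl
  have : AffineIndependent ℝ T ↔ ¬ Collinear ℝ {T 0, T 1, T 2} := by
    rw [← affineIndependent_iff_not_collinear_set, ← hT]
  rw [this, all3]
  have W : ∀ x y z : Pt, dist x y + dist y z = dist x z ↔ Wbtw ℝ x y z := fun x y z => dist_add_dist_eq_iff
  simp only [ne_eq, W]
  show _ ↔ ¬ Wbtw ℝ (T 0) (T 1) (T 2) ∧ ¬ Wbtw ℝ (T 1) (T 2) (T 0) ∧ ¬ Wbtw ℝ (T 2) (T 0) (T 1)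
  constructor
  · intro h
    refine ⟨fun w => h w.collinear, fun w => h ?_, fun w => h ?_⟩
    · rw [show ({T 0, T 1, T 2} : Set Pt) = {T 1, T 2, T 0} by ext x; simp; tauto]; exact w.collinear
    · rw [show ({T 0, T 1, T 2} : Set Pt) = {T 2, T 0, T 1} by ext x; simp; tauto]; exact w.collinear
  · rintro ⟨h1, h2, h3⟩ h
    rcases h.wbtw_or_wbtw_or_wbtw with w | w | w
    · exact h1 w
    · exact h2 w
    · exact h3 w
theorem basis_of (T : Tri) (h : AffineIndependent ℝ T) : ∃ b : AB, ∀ k, b k = T k := by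
  refine ⟨⟨T, h, ?_⟩, fun _ => rfl⟩
  rw [h.affineSpan_eq_top_iff_card_eq_finrank_add_one]; simp
theorem ang_of {a b : Tri} (ha : Function.Injective a) (h : ∀ i j, dist (a i) (a j) = dist (b i) (b j)) (i j k : Fin 3)
    (h1 : i ≠ j) (h2 : k ≠ j) : ∠ (a i) (a j) (a k) = ∠ (b i) (b j) (b k) := by
  have e1 := dist_sq_eq_dist_sq_add_dist_sq_sub_two_mul_dist_mul_dist_mul_cos_angle (a i) (a j) (a k)
  have e2 := dist_sq_eq_dist_sq_add_dist_sq_sub_two_mul_dist_mul_dist_mul_cos_angle (b i) (b j) (b k)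
  rw [← h, ← h, ← h] at e2
  have d1 : dist (a i) (a j) ≠ 0 := dist_ne_zero.2 (ha.ne h1)
  have d2 : dist (a k) (a j) ≠ 0 := dist_ne_zero.2 (ha.ne h2)
  have : cos (∠ (a i) (a j) (a k)) = cos (∠ (b i) (b j) (b k)) :=
    mul_left_cancel₀ (mul_ne_zero d1 d2) (by linarith)
  exact Real.injOn_cos ⟨angle_nonneg _ _ _, angle_le_pi _ _ _⟩ ⟨angle_nonneg _ _ _, angle_le_pi _ _ _⟩ this
/-- **There is no 11-tiling of any triangle.** For every triangle `ABC` and every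
triangle `T`, there is no family of 11 triangles, each congruent to `T`, with
pairwise disjoint interiors, whose union is the closed triangle `ABC`. -/
theorem no_eleven_tiling (ABC T : Tri) (hABC : IsTriangle ABC) (hT : IsTriangle T)
    (tiles : Fin 11 → Tri) : ¬ IsTiling 11 ABC T tiles := by
  intro H
  choose σ hσ using H.congr
  have hd : ∀ n i j, dist (tiles n ((σ n).symm i)) (tiles n ((σ n).symm j)) = dist (T i) (T j) := fun n i j => by
    rw [hσ, Equiv.apply_symm_apply, Equiv.apply_symm_apply]
  obtain ⟨A, hA⟩ := basis_of ABC hABC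
  have hb : ∀ n, ∃ b : AB, ∀ k, b k = tiles n ((σ n).symm k) := fun n => basis_of (fun k => tiles n ((σ n).symm k)) (by
    rw [indep_iff]
    intro k
    rw [hd, hd, hd]
    exact (indep_iff T).1 hT k)
  choose B hB using hb
  have rA : Set.range ABC = Set.range A := by rw [funext hA]
  have rB : ∀ n, Set.range (tiles n) = Set.range (B n) := fun n => by
    rw [funext (hB n)]; exact ((σ n).symm.surjective.range_comp (tiles n)).symm
  refine core (A := A) (B := B) (θ := fun k => ∠ (T (k+1)) (T k) (T (k+2))) (L := fun k => dist (T (k+1)) (T (k+2))) ⟨?_, ?_, ?_, ?_⟩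
  · intro i k
    unfold vang
    rw [hB, hB, hB]
    refine ang_of (a := fun k => tiles i ((σ i).symm k)) ?_ (hd i) _ _ _ (by revert k; decide) (by revert k; decide)
    intro x y hxy
    have := hd i x y
    rw [show tiles i ((σ i).symm x) = tiles i ((σ i).symm y) from hxy, dist_self, eq_comm, dist_eq_zero] at this
    exact hT.injective this
  · intro i k
    rw [hB, hB]; exact hd i _ _
  · intro X
    have h1 : X ∈ triSet ABC ↔ ∀ k, 0 ≤ A.coord k X := by
      rw [triSet, rA, AffineBasis.convexHull_eq_nonneg_coord]; rfl
    have h2 : ∀ n, X ∈ triSet (tiles n) ↔ ∀ k, 0 ≤ (B n).coord k X := fun n => by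
      rw [triSet, rB, AffineBasis.convexHull_eq_nonneg_coord]; rfl
    rw [← h1, ← H.cover, Set.mem_iUnion]
    simp only [h2]
  · intro i j X hi hj
    by_contra hij
    have h2 : ∀ n, isI (B n) X → X ∈ interior (triSet (tiles n)) := fun n h => by
      rw [triSet, rB, AffineBasis.interior_convexHull]; exact h
    have := H.disj i j hij
    exact (Set.eq_empty_iff_forall_notMem.1 this X) ⟨h2 i hi, h2 j hj⟩
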